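/- Let Λ be a finite dimensional algebra over a field K. The assignment T ↦ Fac T gives a bijection between the set of isomorphism classes of basic Gorenstein projective support τ-tilting modules in mod Λ and the set of functorially finite Gorenstein torsion pairs in mod Λ; moreover both sets are in bijection with the set of isomorphism classes of basic Gorenstein injective support τ⁻¹-tilting modules in mod Λ. -/

import Mathlib

/-!  Common definitions: Gorenstein projective/injective modules, transpose,
Auslander–Reiten translation, τ-rigid and τ-tilting modules and pairs,
torsion pairs, etc., over a finite dimensional algebra.
Throughout, "mod Λ" is modelled by the category of finitely generated
(left) modules over a finite dimensional `K`-algebra `R`, and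
"mod Λᵒᵖ" by finitely generated `Rᵐᵒᵖ`-modules. -/

universe u

open Function MulOpposite

namespace GPTau

section Ring

variable (R : Type u) [Ring R]

/-- A submodule `N ≤ M` is superfluous (small) if `N ⊔ N' = ⊤` implies `N' = ⊤`. -/
def IsSuperfluous {M : Type u} [AddCommGroup M] [Module R M] (N : Submodule R M) : Prop :=
  ∀ N' : Submodule R M, N ⊔ N' = ⊤ → N' = ⊤

/-- `M` is Gorenstein projective: there is a doubly infinite exact sequence of
finitely generated projective modules which stays exact under `Hom(-, R)` and
such that `M ≅ Im (P₋₁ → P₀)`. -/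
def IsGP (M : Type u) [AddCommGroup M] [Module R M] : Prop :=
  ∃ (P : ℤ → Type u) (_ : ∀ n, AddCommGroup (P n)) (_ : ∀ n, Module R (P n))
    (d : ∀ n : ℤ, P n →ₗ[R] P (n + 1)),
    (∀ n, Module.Finite R (P n)) ∧
    (∀ n, Module.Projective R (P n)) ∧
    (∀ n, Function.Exact (d n) (d (n + 1))) ∧
    (∀ n, Function.Exact
      (fun g : P (n + 1 + 1) →ₗ[R] R => g.comp (d (n + 1)))
      (fun g : P (n + 1) →ₗ[R] R => g.comp (d n))) ∧
    Nonempty (M ≃ₗ[R] LinearMap.range (d (-1)))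

/-- A linear map factors through a (finitely generated) projective module. -/
def FactorsThroughProj {A B : Type u} [AddCommGroup A] [Module R A]
    [AddCommGroup B] [Module R B] (f : A →ₗ[R] B) : Prop :=
  ∃ (Q : Type u) (_ : AddCommGroup Q) (_ : Module R Q),
    Module.Projective R Q ∧ ∃ (a : A →ₗ[R] Q) (b : Q →ₗ[R] B), b.comp a = f

/-- Two maps are equal in the stable category (mod projectives). -/
def StEq {A B : Type u} [AddCommGroup A] [Module R A] [AddCommGroup B] [Module R B]
    (f g : A →ₗ[R] B) : Prop :=
  FactorsThroughProj R (f - g)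

/-- An indecomposable module. -/
def IsIndec (M : Type u) [AddCommGroup M] [Module R M] : Prop :=
  Nontrivial M ∧ ∀ N₁ N₂ : Submodule R M, IsCompl N₁ N₂ → N₁ = ⊥ ∨ N₂ = ⊥

/-- `|M| = k` : `M` decomposes into indecomposable direct summands having
exactly `k` isomorphism classes. -/
def NumIndec (M : Type u) [AddCommGroup M] [Module R M] (k : ℕ) : Prop :=
  ∃ (n : ℕ) (N : Fin n → Submodule R M),
    DirectSum.IsInternal N ∧ (∀ i, IsIndec R (N i)) ∧
    ∃ c : Fin n → Fin k, Surjective c ∧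
      ∀ i j, (c i = c j ↔ Nonempty ((N i) ≃ₗ[R] (N j)))

/-- A basic module: it is a direct sum of pairwise nonisomorphic indecomposables. -/
def IsBasic (M : Type u) [AddCommGroup M] [Module R M] : Prop :=
  ∃ (n : ℕ) (N : Fin n → Submodule R M),
    DirectSum.IsInternal N ∧ (∀ i, IsIndec R (N i)) ∧
    ∀ i j, i ≠ j → ¬ Nonempty ((N i) ≃ₗ[R] (N j))

/-- `M` has no nonzero projective direct summand. -/
def NoProjSummand (M : Type u) [AddCommGroup M] [Module R M] : Prop :=
  ∀ N₁ N₂ : Submodule R M, IsCompl N₁ N₂ → Module.Projective R N₁ → N₁ = ⊥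

/-- `X` is a direct summand of `T`. -/
def IsDirectSummand (X T : Type u) [AddCommGroup X] [Module R X]
    [AddCommGroup T] [Module R T] : Prop :=
  ∃ (i : X →ₗ[R] T) (p : T →ₗ[R] X), p.comp i = LinearMap.id

/-- `Ext¹(X, Y) = 0`: every short exact sequence `0 → Y → E → X → 0` splits. -/
def Ext1Vanishes (X Y : Type u) [AddCommGroup X] [Module R X]
    [AddCommGroup Y] [Module R Y] : Prop :=
  ∀ (E : Type u) [AddCommGroup E] [Module R E] (i : Y →ₗ[R] E) (p : E →ₗ[R] X),
    Injective i → Surjective p → Function.Exact i p →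
    ∃ s : X →ₗ[R] E, p.comp s = LinearMap.id

/-- `X ∈ Fac G`: `X` is a quotient of a finite direct sum of copies of `G`. -/
def FacOf (G X : Type u) [AddCommGroup G] [Module R G] [AddCommGroup X] [Module R X] : Prop :=
  ∃ (n : ℕ) (p : (Fin n → G) →ₗ[R] X), Surjective p

/-- `X ∈ Sub C`: `X` embeds into a finite direct sum of copies of `C`. -/
def SubOf (C X : Type u) [AddCommGroup C] [Module R C] [AddCommGroup X] [Module R X] : Prop :=
  ∃ (n : ℕ) (i : X →ₗ[R] (Fin n → C)), Injective i

/-- `X ∈ add G`: `X` is a direct summand of a finite direct sum of copies of `G`. -/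
def InAdd (G X : Type u) [AddCommGroup G] [Module R G] [AddCommGroup X] [Module R X] : Prop :=
  ∃ (n : ℕ) (i : X →ₗ[R] (Fin n → G)) (p : (Fin n → G) →ₗ[R] X), p.comp i = LinearMap.id

/-- The Jacobson radical of `R` (as a left ideal). -/
def JacobsonRad : Ideal R := (⊥ : Ideal R).jacobson

/-- The Jacobson radical squares to zero. -/
def RadSquareZero : Prop :=
  ∀ x y : R, x ∈ JacobsonRad R → y ∈ JacobsonRad R → x * y = 0

/-- A uniserial module: its submodules form a chain. -/
def IsUniserial (M : Type u) [AddCommGroup M] [Module R M] : Prop :=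
  ∀ N₁ N₂ : Submodule R M, N₁ ≤ N₂ ∨ N₂ ≤ N₁

/-- `R` has finite global dimension: there is `n` such that every finitely
generated module has a projective resolution vanishing in degrees `> n`. -/
def FiniteGlobalDimension : Prop :=
  ∃ n : ℕ, ∀ (M : Type u) [AddCommGroup M] [Module R M], Module.Finite R M →
    ∃ (P : ℕ → Type u) (_ : ∀ i, AddCommGroup (P i)) (_ : ∀ i, Module R (P i))
      (d : ∀ i : ℕ, P (i + 1) →ₗ[R] P i) (ε : P 0 →ₗ[R] M),
      (∀ i, Module.Projective R (P i)) ∧ Surjective ε ∧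
      Function.Exact (d 0) ε ∧ (∀ i, Function.Exact (d (i + 1)) (d i)) ∧
      (∀ i, n < i → Subsingleton (P i))

/-- The injective dimension of `R` as a module over itself is at most 1. -/
def SelfInjDimLE1 : Prop :=
  ∃ (I₀ I₁ : Type u) (_ : AddCommGroup I₀) (_ : Module R I₀)
    (_ : AddCommGroup I₁) (_ : Module R I₁),
    Module.Finite R I₀ ∧ Module.Finite R I₁ ∧
    Module.Injective R I₀ ∧ Module.Injective R I₁ ∧
    ∃ (i : R →ₗ[R] I₀) (p : I₀ →ₗ[R] I₁),
      Injective i ∧ Surjective p ∧ Function.Exact i p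

end Ring

section Algebra

variable (R : Type u) [Ring R] (K : Type u) [Field K] [Algebra K R]

/-- For an algebra over a field, the scalars of the base field commute with the
ring action on any compatible module. -/
instance (priority := 100) smulCommClass_of_tower (M : Type u) [AddCommGroup M]
    [Module R M] [Module K M] [IsScalarTower K R M] : SMulCommClass R K M :=
  ⟨fun r k m => by
    rw [← algebraMap_smul R k m, ← mul_smul, ← Algebra.commutes, mul_smul, algebraMap_smul]⟩

end Algebra

section OpDual

variable (R : Type u) [Ring R] (K : Type u) [Field K] [Algebra K R]
variable (M : Type u) [AddCommGroup M] [Module Rᵐᵒᵖ M] [Module K M]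
  [IsScalarTower K Rᵐᵒᵖ M]

/-- The `K`-dual of a (finitely generated) `Rᵐᵒᵖ`-module, as an `R`-module:
this is the duality `D : mod Λᵒᵖ → mod Λ`. -/
def OpDual (R : Type u) [Ring R] (K : Type u) [Field K] [Algebra K R]
    (M : Type u) [AddCommGroup M] [Module Rᵐᵒᵖ M] [Module K M]
    [IsScalarTower K Rᵐᵒᵖ M] : Type u := M →ₗ[K] K

instance : AddCommGroup (OpDual R K M) := inferInstanceAs (AddCommGroup (M →ₗ[K] K))

instance : Module K (OpDual R K M) := inferInstanceAs (Module K (M →ₗ[K] K))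

/-- Scalar action `x ↦ op r • x` as a `K`-linear map. -/
def opSmulHom (r : R) : M →ₗ[K] M where
  toFun x := op r • x
  map_add' x y := smul_add _ x y
  map_smul' k x := smul_comm (op r) k x

/-- Reinterpret an element of the dual as a linear functional. -/
def OpDual.toL (f : OpDual R K M) : M →ₗ[K] K := f

lemma OpDual.toL_injective :
    Function.Injective (OpDual.toL R K M) := fun _ _ h => h

instance : SMul R (OpDual R K M) :=
  ⟨fun r f => ((OpDual.toL R K M f).comp (opSmulHom R K M r) : M →ₗ[K] K)⟩

lemma OpDual.smul_toL (r : R) (f : OpDual R K M) (x : M) :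
    OpDual.toL R K M (r • f) x = OpDual.toL R K M f (op r • x) := rfl

lemma OpDual.toL_add (f g : OpDual R K M) :
    OpDual.toL R K M (f + g) = OpDual.toL R K M f + OpDual.toL R K M g := rfl

lemma OpDual.toL_zero : OpDual.toL R K M 0 = 0 := rfl

instance : Module R (OpDual R K M) where
  one_smul f := OpDual.toL_injective R K M <| LinearMap.ext fun x => by
    rw [OpDual.smul_toL, op_one, one_smul]
  mul_smul r s f := OpDual.toL_injective R K M <| LinearMap.ext fun x => by
    rw [OpDual.smul_toL, OpDual.smul_toL, OpDual.smul_toL, op_mul, mul_smul]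
  smul_zero r := OpDual.toL_injective R K M <| LinearMap.ext fun x => by
    rw [OpDual.smul_toL, OpDual.toL_zero]; simp
  smul_add r f g := OpDual.toL_injective R K M <| LinearMap.ext fun x => by
    rw [OpDual.smul_toL, OpDual.toL_add]
    simp only [LinearMap.add_apply, OpDual.toL_add]
    rw [OpDual.smul_toL, OpDual.smul_toL]
  add_smul r s f := OpDual.toL_injective R K M <| LinearMap.ext fun x => by
    rw [OpDual.smul_toL]
    simp only [OpDual.toL_add, LinearMap.add_apply]
    rw [OpDual.smul_toL, OpDual.smul_toL, op_add, add_smul, map_add]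
  zero_smul f := OpDual.toL_injective R K M <| LinearMap.ext fun x => by
    rw [OpDual.smul_toL, OpDual.toL_zero, op_zero, zero_smul, map_zero]; rfl

instance : IsScalarTower K R (OpDual R K M) :=
  ⟨fun k r f => OpDual.toL_injective R K M <| LinearMap.ext fun x => by
    have h1 : OpDual.toL R K M ((k • r) • f) x = OpDual.toL R K M f (op (k • r) • x) := rfl
    have h2 : OpDual.toL R K M (k • (r • f)) x = k • OpDual.toL R K M f (op r • x) := rfl
    rw [h1, h2, op_smul, smul_assoc, map_smul]⟩

end OpDual

section LDual

variable (R : Type u) [Ring R] (K : Type u) [Field K] [Algebra K R]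
variable (M : Type u) [AddCommGroup M] [Module R M] [Module K M]
  [IsScalarTower K R M]

/-- The `K`-dual of a (finitely generated) `R`-module, as an `Rᵐᵒᵖ`-module:
this is the duality `D : mod Λ → mod Λᵒᵖ`. -/
def LDual (R : Type u) [Ring R] (K : Type u) [Field K] [Algebra K R]
    (M : Type u) [AddCommGroup M] [Module R M] [Module K M]
    [IsScalarTower K R M] : Type u := M →ₗ[K] K

instance : AddCommGroup (LDual R K M) := inferInstanceAs (AddCommGroup (M →ₗ[K] K))

instance : Module K (LDual R K M) := inferInstanceAs (Module K (M →ₗ[K] K))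

/-- Scalar action `x ↦ r • x` as a `K`-linear map. -/
def lSmulHom (r : R) : M →ₗ[K] M where
  toFun x := r • x
  map_add' x y := smul_add _ x y
  map_smul' k x := smul_comm r k x

/-- Reinterpret an element of the dual as a linear functional. -/
def LDual.toL (f : LDual R K M) : M →ₗ[K] K := f

lemma LDual.toL_injective : Function.Injective (LDual.toL R K M) := fun _ _ h => h

instance : SMul Rᵐᵒᵖ (LDual R K M) :=
  ⟨fun s f => ((LDual.toL R K M f).comp (lSmulHom R K M (unop s)) : M →ₗ[K] K)⟩

lemma LDual.smul_toL (s : Rᵐᵒᵖ) (f : LDual R K M) (x : M) :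
    LDual.toL R K M (s • f) x = LDual.toL R K M f (unop s • x) := rfl

lemma LDual.toL_add (f g : LDual R K M) :
    LDual.toL R K M (f + g) = LDual.toL R K M f + LDual.toL R K M g := rfl

lemma LDual.toL_zero : LDual.toL R K M 0 = 0 := rfl

instance : Module Rᵐᵒᵖ (LDual R K M) where
  one_smul f := LDual.toL_injective R K M <| LinearMap.ext fun x => by
    rw [LDual.smul_toL, unop_one, one_smul]
  mul_smul s t f := LDual.toL_injective R K M <| LinearMap.ext fun x => by
    rw [LDual.smul_toL, LDual.smul_toL, LDual.smul_toL, unop_mul, mul_smul]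
  smul_zero s := LDual.toL_injective R K M <| LinearMap.ext fun x => by
    rw [LDual.smul_toL, LDual.toL_zero]; simp
  smul_add s f g := LDual.toL_injective R K M <| LinearMap.ext fun x => by
    rw [LDual.smul_toL, LDual.toL_add]
    simp only [LinearMap.add_apply, LDual.toL_add]
    rw [LDual.smul_toL, LDual.smul_toL]
  add_smul s t f := LDual.toL_injective R K M <| LinearMap.ext fun x => by
    rw [LDual.smul_toL]
    simp only [LDual.toL_add, LinearMap.add_apply]
    rw [LDual.smul_toL, LDual.smul_toL, unop_add, add_smul, map_add]
  zero_smul f := LDual.toL_injective R K M <| LinearMap.ext fun x => by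
    rw [LDual.smul_toL, LDual.toL_zero, unop_zero, zero_smul, map_zero]; rfl

instance : IsScalarTower K Rᵐᵒᵖ (LDual R K M) :=
  ⟨fun k s f => LDual.toL_injective R K M <| LinearMap.ext fun x => by
    have h1 : LDual.toL R K M ((k • s) • f) x = LDual.toL R K M f (unop (k • s) • x) := rfl
    have h2 : LDual.toL R K M (k • (s • f)) x = k • LDual.toL R K M f (unop s • x) := rfl
    rw [h1, h2, unop_smul, smul_assoc, map_smul]⟩

end LDual

section GI

variable (R : Type u) [Ring R] (K : Type u) [Field K] [Algebra K R]

/-- `M` is Gorenstein injective: there is a doubly infinite exact sequence of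
finitely generated injective modules which stays exact under `Hom(DΛ, -)` and
such that `M ≅ Im (I₋₁ → I₀)`. Here `DΛ = OpDual R K R` is the `K`-dual of the
regular module. -/
def IsGI (M : Type u) [AddCommGroup M] [Module R M] : Prop :=
  ∃ (I : ℤ → Type u) (_ : ∀ n, AddCommGroup (I n)) (_ : ∀ n, Module R (I n))
    (d : ∀ n : ℤ, I n →ₗ[R] I (n + 1)),
    (∀ n, Module.Finite R (I n)) ∧
    (∀ n, Module.Injective R (I n)) ∧
    (∀ n, Function.Exact (d n) (d (n + 1))) ∧
    (∀ n, Function.Exact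
      (fun g : OpDual R K R →ₗ[R] I n => (d n).comp g)
      (fun g : OpDual R K R →ₗ[R] I (n + 1) => (d (n + 1)).comp g)) ∧
    Nonempty (M ≃ₗ[R] LinearMap.range (d (-1)))

end GI



section MinPres

variable (R : Type u) [Ring R]

/-- A minimal projective presentation `P₁ → P₀ → M → 0`. -/
structure MinPres (M : Type u) [AddCommGroup M] [Module R M] : Type (u + 1) where
  P₁ : Type u
  P₀ : Type u
  [acg₁ : AddCommGroup P₁]
  [acg₀ : AddCommGroup P₀]
  [mod₁ : Module R P₁]
  [mod₀ : Module R P₀]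
  fin₁ : Module.Finite R P₁
  fin₀ : Module.Finite R P₀
  proj₁ : Module.Projective R P₁
  proj₀ : Module.Projective R P₀
  d : P₁ →ₗ[R] P₀
  p : P₀ →ₗ[R] M
  surj : Function.Surjective p
  exact : Function.Exact d p
  min₀ : IsSuperfluous R (LinearMap.ker p)
  min₁ : IsSuperfluous R (LinearMap.ker d)

attribute [instance] MinPres.acg₁ MinPres.acg₀ MinPres.mod₁ MinPres.mod₀

variable {R}
variable {M : Type u} [AddCommGroup M] [Module R M] (pr : MinPres R M)

/-- The map `Hom(P₀, R) → Hom(P₁, R)` dual to `d`, as a map of `Rᵐᵒᵖ`-modules. -/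
def MinPres.dualMap : (pr.P₀ →ₗ[R] R) →ₗ[Rᵐᵒᵖ] (pr.P₁ →ₗ[R] R) where
  toFun g := g.comp pr.d
  map_add' g h := by ext x; simp
  map_smul' s g := by ext x; simp

/-- The transpose `Tr M = Coker (Hom(P₀, R) → Hom(P₁, R))`, an `Rᵐᵒᵖ`-module. -/
def MinPres.Tr : Type u := (pr.P₁ →ₗ[R] R) ⧸ LinearMap.range pr.dualMap

instance : AddCommGroup pr.Tr :=
  inferInstanceAs (AddCommGroup ((pr.P₁ →ₗ[R] R) ⧸ LinearMap.range pr.dualMap))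

instance : Module Rᵐᵒᵖ pr.Tr :=
  inferInstanceAs (Module Rᵐᵒᵖ ((pr.P₁ →ₗ[R] R) ⧸ LinearMap.range pr.dualMap))

/-- The canonical projection onto the transpose. -/
def MinPres.toTr (h : pr.P₁ →ₗ[R] R) : pr.Tr :=
  Submodule.Quotient.mk (p := LinearMap.range pr.dualMap) h

section TauDef

variable (K : Type u) [Field K] [Algebra K R]

instance : Module K pr.Tr :=
  inferInstanceAs (Module K ((pr.P₁ →ₗ[R] R) ⧸ LinearMap.range pr.dualMap))

instance : IsScalarTower K Rᵐᵒᵖ pr.Tr :=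
  inferInstanceAs
    (IsScalarTower K Rᵐᵒᵖ ((pr.P₁ →ₗ[R] R) ⧸ LinearMap.range pr.dualMap))

/-- The Auslander–Reiten translate `τM = D (Tr M)`, an `R`-module. -/
def MinPres.tau : Type u := OpDual R K pr.Tr

instance : AddCommGroup (pr.tau K) := inferInstanceAs (AddCommGroup (OpDual R K pr.Tr))

instance : Module R (pr.tau K) := inferInstanceAs (Module R (OpDual R K pr.Tr))

instance : Module K (pr.tau K) := inferInstanceAs (Module K (OpDual R K pr.Tr))

instance : IsScalarTower K R (pr.tau K) :=
  inferInstanceAs (IsScalarTower K R (OpDual R K pr.Tr))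

end TauDef

end MinPres

section Tau

variable (R : Type u) [Ring R] (K : Type u) [Field K] [Algebra K R]

/-- `M` is τ-rigid: `Hom(M, τM) = 0`. -/
def IsTauRigid (M : Type u) [AddCommGroup M] [Module R M] : Prop :=
  ∀ pr : MinPres R M, ∀ f : M →ₗ[R] pr.tau K, f = 0

/-- `N ∈ ⊥(τM)`, i.e. `Hom(N, τM) = 0`. -/
def InPerpTau (M : Type u) [AddCommGroup M] [Module R M]
    (N : Type u) [AddCommGroup N] [Module R N] : Prop :=
  ∀ pr : MinPres R M, ∀ f : N →ₗ[R] pr.tau K, f = 0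

/-- `M` is a τ-tilting module: τ-rigid with `|M| = |R|`. -/
def IsTauTilting (M : Type u) [AddCommGroup M] [Module R M] : Prop :=
  IsTauRigid R K M ∧ ∃ m l : ℕ, NumIndec R M m ∧ NumIndec R R l ∧ m = l

/-- `M` is τ⁻¹-rigid: `Hom(τ⁻¹M, M) = 0`, where `τ⁻¹M = Tr (D M)`.
A homomorphism `τ⁻¹M → M` is an additive map compatible with the identification
`R ≅ Rᵐᵒᵖᵐᵒᵖ` of scalars. -/
def IsTauInvRigid (M : Type u) [AddCommGroup M] [Module R M] [Module K M]
    [IsScalarTower K R M] : Prop :=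
  ∀ pr : MinPres Rᵐᵒᵖ (LDual R K M), ∀ f : pr.Tr →+ M,
    (∀ (r : R) (x : pr.Tr), f (op (op r) • x) = r • f x) → f = 0

/-- `M` is a τ⁻¹-tilting module. -/
def IsTauInvTilting (M : Type u) [AddCommGroup M] [Module R M] [Module K M]
    [IsScalarTower K R M] : Prop :=
  IsTauInvRigid R K M ∧ ∃ m l : ℕ, NumIndec R M m ∧ NumIndec R R l ∧ m = l

end Tau

section Pairs

variable (K : Type u) [Field K] (R : Type u) [Ring R] [Algebra K R]

/-- A pair `(M, P)` of finitely generated modules (with compatible `K`-structure). -/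
structure ModPair : Type (u + 1) where
  M : Type u
  [acgM : AddCommGroup M]
  [modM : Module R M]
  [modKM : Module K M]
  [towM : IsScalarTower K R M]
  finM : Module.Finite R M
  P : Type u
  [acgP : AddCommGroup P]
  [modP : Module R P]
  [modKP : Module K P]
  [towP : IsScalarTower K R P]
  finP : Module.Finite R P

attribute [instance] ModPair.acgM ModPair.modM ModPair.modKM ModPair.towM
attribute [instance] ModPair.acgP ModPair.modP ModPair.modKP ModPair.towP

variable {K R}

/-- Isomorphism of pairs. -/
def ModPair.Iso (x y : ModPair K R) : Prop :=
  Nonempty (x.M ≃ₗ[R] y.M) ∧ Nonempty (x.P ≃ₗ[R] y.P)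

variable (K R)

/-- The setoid of pairs satisfying a property `Q`, up to isomorphism. -/
def pairSetoid (Q : ModPair K R → Prop) : Setoid {x : ModPair K R // Q x} where
  r a b := ModPair.Iso a.1 b.1
  iseqv := by
    constructor
    · exact fun a => ⟨⟨LinearEquiv.refl R a.1.M⟩, ⟨LinearEquiv.refl R a.1.P⟩⟩
    · rintro a b ⟨⟨e⟩, ⟨e'⟩⟩; exact ⟨⟨e.symm⟩, ⟨e'.symm⟩⟩
    · rintro a b c ⟨⟨e⟩, ⟨e'⟩⟩ ⟨⟨f⟩, ⟨f'⟩⟩; exact ⟨⟨e.trans f⟩, ⟨e'.trans f'⟩⟩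

/-- `(M, P)` is a τ-rigid pair: `M` is τ-rigid, `P` is projective and `Hom(P, M) = 0`. -/
def IsTauRigidPair (x : ModPair K R) : Prop :=
  IsTauRigid R K x.M ∧ Module.Projective R x.P ∧ ∀ f : x.P →ₗ[R] x.M, f = 0

/-- A Gorenstein projective τ-rigid pair. -/
def IsGPTauRigidPair (x : ModPair K R) : Prop :=
  IsTauRigidPair K R x ∧ IsGP R x.M

/-- A support τ-tilting pair: a τ-rigid pair with `|M| + |P| = |R|`. -/
def IsSuppTauTiltingPair (x : ModPair K R) : Prop :=
  IsTauRigidPair K R x ∧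
    ∃ m p l : ℕ, NumIndec R x.M m ∧ NumIndec R x.P p ∧ NumIndec R R l ∧ m + p = l

/-- A Gorenstein projective support τ-tilting pair. -/
def IsGPSuppTauTiltingPair (x : ModPair K R) : Prop :=
  IsSuppTauTiltingPair K R x ∧ IsGP R x.M

/-- `(I, N)` is a τ⁻¹-rigid pair; here `x.M = N` is the module and `x.P = I` is
injective, with `Hom(N, I) = 0`. -/
def IsTauInvRigidPair (x : ModPair K R) : Prop :=
  IsTauInvRigid R K x.M ∧ Module.Injective R x.P ∧ ∀ f : x.M →ₗ[R] x.P, f = 0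

/-- A Gorenstein injective τ⁻¹-rigid pair. -/
def IsGITauInvRigidPair (x : ModPair K R) : Prop :=
  IsTauInvRigidPair K R x ∧ IsGI R K x.M

/-- A support τ⁻¹-tilting pair: a τ⁻¹-rigid pair with `|N| + |I| = |R|`. -/
def IsSuppTauInvTiltingPair (x : ModPair K R) : Prop :=
  IsTauInvRigidPair K R x ∧
    ∃ m p l : ℕ, NumIndec R x.M m ∧ NumIndec R x.P p ∧ NumIndec R R l ∧ m + p = l

/-- A Gorenstein injective support τ⁻¹-tilting pair. -/
def IsGISuppTauInvTiltingPair (x : ModPair K R) : Prop :=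
  IsSuppTauInvTiltingPair K R x ∧ IsGI R K x.M

/-- A basic pair. -/
def IsBasicPair (x : ModPair K R) : Prop := IsBasic R x.M ∧ IsBasic R x.P

/-- `y` is (a representative of) the dagger `(M, P)† = (Tr M_np ⊕ P*, M_p*)` of `x`,
where `M = M_p ⊕ M_np` with `M_p` a maximal projective direct summand. -/
def IsDaggerOf (x : ModPair K R) (y : ModPair K Rᵐᵒᵖ) : Prop :=
  ∃ Mp Mnp : Submodule R x.M, IsCompl Mp Mnp ∧ Module.Projective R Mp ∧
    NoProjSummand R Mnp ∧
    ∃ pr : MinPres R Mnp,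
      Nonempty (y.M ≃ₗ[Rᵐᵒᵖ] (pr.Tr × (x.P →ₗ[R] R))) ∧
      Nonempty (y.P ≃ₗ[Rᵐᵒᵖ] (Mp →ₗ[R] R))

/-- `y` is (a representative of) `D((M, P)†)`, the Gorenstein injective pair
`(D(M_p*), D(Tr M_np ⊕ P*))` associated to `x`; in our convention `y.M` is the
τ⁻¹-rigid module `D(Tr M_np ⊕ P*)` and `y.P` is the injective module `D(M_p*)`. -/
def IsDDaggerOf (x : ModPair K R) (y : ModPair K R) : Prop :=
  ∃ z : ModPair K Rᵐᵒᵖ, IsDaggerOf K R x z ∧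
    Nonempty (y.M ≃ₗ[R] OpDual R K z.M) ∧ Nonempty (y.P ≃ₗ[R] OpDual R K z.P)

end Pairs

section Support

variable (R : Type u) [Ring R] (K : Type u) [Field K] [Algebra K R]

/-- `φ : R →+* S` realizes `S` as the quotient of `R` by the two-sided ideal
generated by `e` (universal property). -/
def IsQuotientByIdem (e : R) (S : Type u) [Ring S] (φ : R →+* S) : Prop :=
  Function.Surjective φ ∧ φ e = 0 ∧
    ∀ (S' : Type u) (_ : Ring S') (ψ : R →+* S'), ψ e = 0 → ∃ χ : S →+* S', χ.comp φ = ψ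

/-- `M` is a support τ-tilting module: `M` is a τ-tilting module over `Λ/(e)` for
some idempotent `e`. -/
def IsSuppTauTilting (M : Type u) [AddCommGroup M] [Module R M] : Prop :=
  ∃ e : R, IsIdempotentElem e ∧
    ∃ (S : Type u) (_ : Ring S) (_ : Algebra K S) (φ : R →+* S),
      (∀ k : K, φ (algebraMap K R k) = algebraMap K S k) ∧
      IsQuotientByIdem R e S φ ∧
      ∃ _ : Module S M, (∀ (r : R) (m : M), φ r • m = r • m) ∧ IsTauTilting S K M

/-- `M` is a support τ⁻¹-tilting module: `M` is a τ⁻¹-tilting module over `Λ/(e)`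
for some idempotent `e`. -/
def IsSuppTauInvTilting (M : Type u) [AddCommGroup M] [Module R M] [Module K M] : Prop :=
  ∃ e : R, IsIdempotentElem e ∧
    ∃ (S : Type u) (_ : Ring S) (_ : Algebra K S) (φ : R →+* S),
      (∀ k : K, φ (algebraMap K R k) = algebraMap K S k) ∧
      IsQuotientByIdem R e S φ ∧
      ∃ _ : Module S M, (∀ (r : R) (m : M), φ r • m = r • m) ∧
        ∃ _ : IsScalarTower K S M, IsTauInvTilting S K M

end Support

section Torsion

variable (R : Type u) [Ring R]

/-- A class of modules is closed under isomorphism. -/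
def RespectsIso (T : ModuleCat.{u} R → Prop) : Prop :=
  ∀ X Y : ModuleCat.{u} R, Nonempty (X ≃ₗ[R] Y) → T X → T Y

/-- `(T, F)` is a torsion pair in the category of finitely generated `R`-modules. -/
def IsTorsionPair (T F : ModuleCat.{u} R → Prop) : Prop :=
  RespectsIso R T ∧ RespectsIso R F ∧
  (∀ X, T X → Module.Finite R X) ∧ (∀ X, F X → Module.Finite R X) ∧
  (∀ X Y : ModuleCat.{u} R, T X → F Y → ∀ f : X →ₗ[R] Y, f = 0) ∧
  (∀ X : ModuleCat.{u} R, Module.Finite R X →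
    ∃ t : Submodule R X, T (ModuleCat.of R t) ∧ F (ModuleCat.of R (X ⧸ t)))

/-- `T` is covariantly finite: every finitely generated module admits a left
`T`-approximation. -/
def CovariantlyFinite (T : ModuleCat.{u} R → Prop) : Prop :=
  ∀ X : ModuleCat.{u} R, Module.Finite R X →
    ∃ (M : ModuleCat.{u} R) (f : X →ₗ[R] M), T M ∧
      ∀ (M' : ModuleCat.{u} R) (g : X →ₗ[R] M'), T M' → ∃ h : M →ₗ[R] M', h.comp f = g

/-- `T` is contravariantly finite: every finitely generated module admits a right
`T`-approximation. -/
def ContravariantlyFinite (T : ModuleCat.{u} R → Prop) : Prop :=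
  ∀ X : ModuleCat.{u} R, Module.Finite R X →
    ∃ (M : ModuleCat.{u} R) (f : M →ₗ[R] X), T M ∧
      ∀ (M' : ModuleCat.{u} R) (g : M' →ₗ[R] X), T M' → ∃ h : M' →ₗ[R] M, f.comp h = g

/-- A functorially finite class. -/
def FunctoriallyFinite (T : ModuleCat.{u} R → Prop) : Prop :=
  CovariantlyFinite R T ∧ ContravariantlyFinite R T

/-- `G` is the basic Ext-projective generator of the torsion class `T`:
`G ∈ T` is basic, Ext-projective in `T`, `T = Fac G`, and every Ext-projective
module in `T` lies in `add G`. -/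
def IsBasicExtProjGen (T : ModuleCat.{u} R → Prop) (G : ModuleCat.{u} R) : Prop :=
  T G ∧ IsBasic R G ∧ (∀ X : ModuleCat.{u} R, T X → Ext1Vanishes R G X) ∧
  (∀ X : ModuleCat.{u} R, T X ↔ (Module.Finite R X ∧ FacOf R G X)) ∧
  (∀ X : ModuleCat.{u} R, T X → (∀ Y : ModuleCat.{u} R, T Y → Ext1Vanishes R X Y) →
    InAdd R G X)

/-- `C` is the basic Ext-injective cogenerator of the torsion-free class `F`:
`C ∈ F` is basic, Ext-injective in `F`, `F = Sub C`, and every Ext-injective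
module in `F` lies in `add C`. -/
def IsBasicExtInjCogen (F : ModuleCat.{u} R → Prop) (C : ModuleCat.{u} R) : Prop :=
  F C ∧ IsBasic R C ∧ (∀ X : ModuleCat.{u} R, F X → Ext1Vanishes R X C) ∧
  (∀ X : ModuleCat.{u} R, F X ↔ (Module.Finite R X ∧ SubOf R C X)) ∧
  (∀ X : ModuleCat.{u} R, F X → (∀ Y : ModuleCat.{u} R, F Y → Ext1Vanishes R Y X) →
    InAdd R C X)

variable (K : Type u) [Field K] [Algebra K R]

/-- A (functorially finite) Gorenstein torsion pair: the basic Ext-projective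
generator of `T` is Gorenstein projective. -/
def IsGorensteinTP (T F : ModuleCat.{u} R → Prop) : Prop :=
  IsTorsionPair R T F ∧ FunctoriallyFinite R T ∧
    ∀ G : ModuleCat.{u} R, IsBasicExtProjGen R T G → IsGP R G

/-- A trivial torsion pair: the basic Ext-projective generator of `T` is projective. -/
def IsTrivialTP (T F : ModuleCat.{u} R → Prop) : Prop :=
  IsTorsionPair R T F ∧ FunctoriallyFinite R T ∧
    ∀ G : ModuleCat.{u} R, IsBasicExtProjGen R T G → Module.Projective R G

end Torsion

section Misc

variable (R : Type u) [Ring R] (K : Type u) [Field K] [Algebra K R]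

/-- A projective cover `π : P → M`. -/
structure ProjCover (M : Type u) [AddCommGroup M] [Module R M] : Type (u + 1) where
  P : Type u
  [acg : AddCommGroup P]
  [mod : Module R P]
  fin : Module.Finite R P
  proj : Module.Projective R P
  π : P →ₗ[R] M
  surj : Function.Surjective π
  min : IsSuperfluous R (LinearMap.ker π)

attribute [instance] ProjCover.acg ProjCover.mod

/-- The canonical evaluation map `M → M** = Hom_{Rᵐᵒᵖ}(Hom_R(M, R), Rᵐᵒᵖ)`. -/
def bidualEval (M : Type u) [AddCommGroup M] [Module R M] (m : M) :
    (M →ₗ[R] R) →ₗ[Rᵐᵒᵖ] Rᵐᵒᵖ where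
  toFun f := op (f m)
  map_add' f g := by simp
  map_smul' s f := rfl

/-- `R` is CM-τ-tilting finite: up to isomorphism there are only finitely many
indecomposable Gorenstein projective τ-rigid modules. -/
def CMTauTiltingFinite : Prop :=
  ∃ (n : ℕ) (V : Fin n → ModuleCat.{u} R),
    ∀ (M : Type u) [AddCommGroup M] [Module R M], Module.Finite R M →
      IsIndec R M → IsGP R M → IsTauRigid R K M → ∃ i, Nonempty (M ≃ₗ[R] V i)

/-- `R` is CM-finite: up to isomorphism there are only finitely many
indecomposable Gorenstein projective modules. -/
def CMFinite : Prop :=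
  ∃ (n : ℕ) (V : Fin n → ModuleCat.{u} R),
    ∀ (M : Type u) [AddCommGroup M] [Module R M], Module.Finite R M →
      IsIndec R M → IsGP R M → ∃ i, Nonempty (M ≃ₗ[R] V i)

/-- `T` is the Bongartz completion of the τ-rigid module `M`: the basic
Ext-projective generator of `⊥(τM)`, with `⊥(τM) = Fac T`. -/
def IsBongartzCompletion (M : Type u) [AddCommGroup M] [Module R M]
    (T : Type u) [AddCommGroup T] [Module R T] : Prop :=
  Module.Finite R T ∧ IsBasic R T ∧ InPerpTau R K M T ∧
  (∀ (X : Type u) [AddCommGroup X] [Module R X], Module.Finite R X →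
    InPerpTau R K M X → Ext1Vanishes R T X) ∧
  (∀ (X : Type u) [AddCommGroup X] [Module R X], Module.Finite R X →
    (InPerpTau R K M X ↔ FacOf R T X))

end Misc

/-- Isomorphism classes of bundled modules satisfying a property. -/
def modSetoid (R : Type u) [Ring R] (Q : ModuleCat.{u} R → Prop) :
    Setoid {X : ModuleCat.{u} R // Q X} where
  r a b := Nonempty ((a.1 : Type u) ≃ₗ[R] (b.1 : Type u))
  iseqv := by
    refine ⟨fun a => ⟨LinearEquiv.refl R _⟩, ?_, ?_⟩
    · rintro a b ⟨e⟩; exact ⟨e.symm⟩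
    · rintro a b c ⟨e⟩ ⟨f⟩; exact ⟨e.trans f⟩

/-- A finitely generated module with compatible `K`-structure. -/
structure KMod (K R : Type u) [Field K] [Ring R] [Algebra K R] : Type (u + 1) where
  M : Type u
  [acg : AddCommGroup M]
  [mod : Module R M]
  [modK : Module K M]
  [tow : IsScalarTower K R M]
  fin : Module.Finite R M

attribute [instance] KMod.acg KMod.mod KMod.modK KMod.tow

/-- Isomorphism classes of bundled `K`-structured modules satisfying a property. -/
def kmodSetoid (K R : Type u) [Field K] [Ring R] [Algebra K R] (Q : KMod K R → Prop) :
    Setoid {X : KMod K R // Q X} where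
  r a b := Nonempty (a.1.M ≃ₗ[R] b.1.M)
  iseqv := by
    refine ⟨fun a => ⟨LinearEquiv.refl R _⟩, ?_, ?_⟩
    · rintro a b ⟨e⟩; exact ⟨e.symm⟩
    · rintro a b c ⟨e⟩ ⟨f⟩; exact ⟨e.trans f⟩

/-- Basic Gorenstein projective support τ-tilting modules. -/
def GPSTTmod (K R : Type u) [Field K] [Ring R] [Algebra K R] :
    ModuleCat.{u} R → Prop :=
  fun X => Module.Finite R X ∧ IsBasic R X ∧ IsGP R X ∧ IsSuppTauTilting R K X

/-- Basic Gorenstein injective support τ⁻¹-tilting modules. -/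
def GISTTmod (K R : Type u) [Field K] [Ring R] [Algebra K R] : KMod K R → Prop :=
  fun X => IsBasic R X.M ∧ IsGI R K X.M ∧ IsSuppTauInvTilting R K X.M

section Basics

variable {A : Type u} [Ring A]

theorem nilpotent_or_bijective_of_isIndec {M : Type u} [AddCommGroup M] [Module A M]
    [IsNoetherian A M] [IsArtinian A M] (h : IsIndec A M) (f : Module.End A M) :
    IsNilpotent f ∨ Bijective f := by
  obtain ⟨n, hn, hn1⟩ := ((LinearMap.eventually_isCompl_ker_pow_range_pow f).and
    (Filter.eventually_ge_atTop 1)).exists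
  rcases h.2 _ _ hn with hk | hr
  · right
    refine IsArtinian.bijective_of_injective_endomorphism f ?_
    have hinj : Injective ⇑(f ^ n) := LinearMap.ker_eq_bot.mp hk
    obtain ⟨m, rfl⟩ : ∃ m, n = m + 1 := ⟨n - 1, by omega⟩
    intro x y hxy
    apply hinj
    rw [pow_succ]
    simp only [Module.End.mul_apply, hxy]
  · left
    exact ⟨n, LinearMap.range_eq_bot.mp hr⟩

theorem isIndec_of_end {M : Type u} [AddCommGroup M] [Module A M] [Nontrivial M]
    (h : ∀ f : Module.End A M, IsNilpotent f ∨ Bijective f) : IsIndec A M := by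
  refine ⟨inferInstance, fun N₁ N₂ hN => ?_⟩
  have hid : IsIdempotentElem (Submodule.projection N₁ N₂ hN) :=
    Submodule.isIdempotentElem_projection hN
  rcases h (Submodule.projection N₁ N₂ hN) with ⟨n, hn⟩ | hb
  · left
    have h0 : Submodule.projection N₁ N₂ hN = 0 := by
      rcases n with _ | n
      · have h1 : (1 : Module.End A M) = 0 := by rwa [pow_zero] at hn
        rw [← mul_one (Submodule.projection N₁ N₂ hN), h1, mul_zero]
      · rw [hid.pow_succ_eq] at hn; exact hn
    rw [eq_bot_iff]
    intro x hx
    have := LinearMap.congr_fun h0 x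
    rw [Submodule.projection_apply_of_mem_left hN hx] at this
    simpa using this
  · right
    rw [eq_bot_iff]
    intro x hx
    have : Submodule.projection N₁ N₂ hN x = Submodule.projection N₁ N₂ hN 0 := by
      rw [Submodule.projection_apply_of_mem_right hN hx, map_zero]
    simpa using hb.1 this

theorem IsIndec.of_equiv {M N : Type u} [AddCommGroup M] [Module A M] [AddCommGroup N]
    [Module A N] (e : M ≃ₗ[A] N) (h : IsIndec A M) : IsIndec A N := by
  have := h.1
  refine ⟨e.symm.toEquiv.nontrivial, fun N₁ N₂ hN => ?_⟩
  have key := h.2 (N₁.comap e.toLinearMap) (N₂.comap e.toLinearMap)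
    (((Submodule.orderIsoMapComap e).symm.isCompl_iff).mp hN)
  refine key.imp (fun h1 => ?_) (fun h1 => ?_) <;>
  · rw [eq_bot_iff]
    intro x hx
    have : e.symm x ∈ (⊥ : Submodule A M) := by rw [← h1]; simpa using hx
    simpa using this

theorem isDirectSummand_of_equiv {M N : Type u} [AddCommGroup M] [Module A M] [AddCommGroup N]
    [Module A N] (e : M ≃ₗ[A] N) : IsDirectSummand A M N :=
  ⟨e.toLinearMap, e.symm.toLinearMap, by ext; simp⟩

theorem IsDirectSummand.trans {X Y Z : Type u} [AddCommGroup X] [Module A X]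
    [AddCommGroup Y] [Module A Y] [AddCommGroup Z] [Module A Z]
    (h : IsDirectSummand A X Y) (h' : IsDirectSummand A Y Z) : IsDirectSummand A X Z := by
  obtain ⟨i, p, h⟩ := h
  obtain ⟨j, q, h'⟩ := h'
  refine ⟨j ∘ₗ i, p ∘ₗ q, LinearMap.ext fun x => ?_⟩
  have h1 := LinearMap.congr_fun h' (i x)
  have h2 := LinearMap.congr_fun h x
  simp only [LinearMap.comp_apply, LinearMap.id_apply] at h1 h2 ⊢
  rw [h1, h2]

theorem isDirectSummand_pi {ι : Type*} [DecidableEq ι] (X : ι → ModuleCat.{u} A)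
    {M : Type u} [AddCommGroup M] [Module A M] (e : M ≃ₗ[A] ∀ i, X i) (i : ι) :
    IsDirectSummand A (X i) M :=
  ⟨e.symm.toLinearMap ∘ₗ LinearMap.single A (fun i => X i) i, LinearMap.proj i ∘ₗ e.toLinearMap,
    by ext; simp⟩

theorem equiv_of_isDirectSummand_indec {X Y : Type u} [AddCommGroup X] [Module A X]
    [AddCommGroup Y] [Module A Y] [Nontrivial X] (h : IsIndec A Y)
    (hs : IsDirectSummand A X Y) : Nonempty (X ≃ₗ[A] Y) := by
  obtain ⟨i, p, hip⟩ := hs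
  have hip' : ∀ x, p (i x) = x := fun x => LinearMap.congr_fun hip x
  have hi : Injective i := fun x y hxy => by rw [← hip' x, hxy, hip']
  have hc : IsCompl (LinearMap.range i) (LinearMap.ker p) := by
    constructor
    · rw [Submodule.disjoint_def]
      rintro _ ⟨x, rfl⟩ hx
      have : x = 0 := by rw [← hip' x]; exact hx
      simp [this]
    · rw [codisjoint_iff, eq_top_iff]
      intro y _
      rw [Submodule.mem_sup]
      exact ⟨i (p y), ⟨_, rfl⟩, y - i (p y), by simp [hip'], by simp⟩
  rcases h.2 _ _ hc with h0 | h0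
  · exfalso
    obtain ⟨x, hx⟩ := exists_ne (0 : X)
    exact hx (hi (by rw [map_zero]; exact (Submodule.mem_bot A).mp (h0 ▸ ⟨x, rfl⟩)))
  · exact ⟨LinearEquiv.ofBijective i ⟨hi, fun y =>
      ⟨p y, LinearMap.ker_eq_bot.mp h0 (by rw [hip'])⟩⟩⟩

theorem isLocalRing_end {M : Type u} [AddCommGroup M] [Module A M]
    [IsNoetherian A M] [IsArtinian A M] (h : IsIndec A M) : IsLocalRing (Module.End A M) := by
  have := h.1
  have : Nontrivial (Module.End A M) := by
    obtain ⟨x, hx⟩ := exists_ne (0 : M)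
    exact ⟨1, 0, fun h => hx (by simpa using LinearMap.congr_fun h x)⟩
  refine IsLocalRing.of_isUnit_or_isUnit_one_sub_self fun f => ?_
  rcases nilpotent_or_bijective_of_isIndec h f with hf | hf
  · exact Or.inr hf.isUnit_one_sub
  · exact Or.inl ((Module.End.isUnit_iff f).mpr hf)

theorem exists_bijective_of_sum_bijective {M : Type u} [AddCommGroup M] [Module A M]
    [IsNoetherian A M] [IsArtinian A M] (h : IsIndec A M) {ι : Type*} (s : Finset ι)
    (f : ι → Module.End A M) (hf : Bijective (∑ i ∈ s, f i : Module.End A M)) : ∃ i ∈ s, Bijective (f i) := by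
  classical
  have := isLocalRing_end h
  have := h.1
  induction s using Finset.induction_on with
  | empty =>
    exfalso
    obtain ⟨x, hx⟩ := exists_ne (0 : M)
    exact hx (hf.1 (by simp))
  | insert a s ha ih =>
    rw [Finset.sum_insert ha, ← Module.End.isUnit_iff] at hf
    obtain ⟨v, hv⟩ := hf
    have h1 : (↑v⁻¹ : Module.End A M) * f a + ↑v⁻¹ * ∑ i ∈ s, f i = 1 := by
      rw [← mul_add, ← hv]; simp
    rcases IsLocalRing.isUnit_or_isUnit_of_add_one h1 with h2 | h2
    · refine ⟨a, by simp, (Module.End.isUnit_iff _).mp ?_⟩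
      exact (Units.isUnit_units_mul _ _).mp h2
    · obtain ⟨i, hi, hb⟩ := ih ((Module.End.isUnit_iff _).mp
        ((Units.isUnit_units_mul _ _).mp h2))
      exact ⟨i, by simp [hi], hb⟩

/-- If the identity of an indecomposable module is a sum of maps factoring through `Z i`, then the
module is a direct summand of one of them. -/
theorem isDirectSummand_of_sum {M : Type u} [AddCommGroup M] [Module A M]
    [IsNoetherian A M] [IsArtinian A M] (h : IsIndec A M) {ι : Type*} [Fintype ι]
    (Z : ι → ModuleCat.{u} A) (q : ∀ i, M →ₗ[A] Z i) (p : ∀ i, Z i →ₗ[A] M)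
    (hf : Bijective (∑ i, p i ∘ₗ q i : Module.End A M)) : ∃ i, IsDirectSummand A M (Z i) := by
  obtain ⟨i, -, hi⟩ := exists_bijective_of_sum_bijective h _ _ hf
  refine ⟨i, q i, (LinearEquiv.ofBijective _ hi).symm.toLinearMap ∘ₗ p i, LinearMap.ext fun x => ?_⟩
  exact (LinearEquiv.ofBijective _ hi).symm_apply_apply x

theorem isDirectSummand_of_pi {M : Type u} [AddCommGroup M] [Module A M]
    [IsNoetherian A M] [IsArtinian A M] (h : IsIndec A M) {ι : Type*} [Fintype ι]
    (Z : ι → ModuleCat.{u} A) {T : Type*} [AddCommGroup T] [Module A T]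
    (e : T ≃ₗ[A] ∀ i, Z i) (i : M →ₗ[A] T) (p : T →ₗ[A] M) (hip : p ∘ₗ i = LinearMap.id) :
    ∃ i, IsDirectSummand A M (Z i) := by
  classical
  refine isDirectSummand_of_sum h Z (fun j => LinearMap.proj j ∘ₗ e.toLinearMap ∘ₗ i)
    (fun j => p ∘ₗ e.symm.toLinearMap ∘ₗ LinearMap.single A (fun i => Z i) j) ?_
  convert bijective_id
  ext x
  simp only [LinearMap.coe_sum, Finset.sum_apply, LinearMap.comp_apply, LinearEquiv.coe_coe,
    LinearMap.proj_apply, ← map_sum, LinearMap.coe_single]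
  rw [Finset.univ_sum_single, e.symm_apply_apply]
  exact LinearMap.congr_fun hip x

theorem exists_equiv_of_isDirectSummand_pi {M : Type u} [AddCommGroup M] [Module A M]
    [IsNoetherian A M] [IsArtinian A M] (h : IsIndec A M) {ι : Type*} [Fintype ι]
    (Z : ι → ModuleCat.{u} A) (hZ : ∀ i, IsIndec A (Z i)) {T : Type u} [AddCommGroup T]
    [Module A T] (e : T ≃ₗ[A] ∀ i, Z i) (hs : IsDirectSummand A M T) :
    ∃ i, Nonempty (M ≃ₗ[A] Z i) := by
  obtain ⟨i, p, hip⟩ := hs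
  obtain ⟨j, hj⟩ := isDirectSummand_of_pi h Z e i p hip
  have := h.1
  exact ⟨j, equiv_of_isDirectSummand_indec (hZ j) hj⟩

end Basics

section Decompositions

variable {A : Type u} [Ring A]

/-- A family of pairwise nonisomorphic indecomposable modules. -/
def IndecFam {ι : Type*} (X : ι → ModuleCat.{u} A) : Prop :=
  (∀ i, IsIndec A (X i)) ∧ ∀ i j, Nonempty (X i ≃ₗ[A] X j) → i = j

/-- `M` is a direct sum of copies of the members of the family `X`, each of which occurs. -/
def Skel (M : Type u) [AddCommGroup M] [Module A M] {k : ℕ} (X : Fin k → ModuleCat.{u} A) : Prop :=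
  IndecFam X ∧ ∃ (n : ℕ) (c : Fin n → Fin k), Surjective c ∧ Nonempty (M ≃ₗ[A] ∀ j, X (c j))

theorem isCompl_map_lt {M : Type u} [AddCommGroup M] [Module A M] {N : Submodule A M}
    {N₁ N₂ : Submodule A N} (hc : IsCompl N₁ N₂) (h2 : N₂ ≠ ⊥) : N₁.map N.subtype < N := by
  refine lt_of_le_of_ne (Submodule.map_subtype_le _ _) fun h => h2 ?_
  have h3 : N₁ = ⊤ := by
    rw [eq_top_iff]
    intro x _
    have hx : (x : M) ∈ N₁.map N.subtype := by rw [h]; exact x.2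
    obtain ⟨y, hy, hyx⟩ := hx
    have : y = x := Subtype.ext hyx
    exact this ▸ hy
  rw [h3] at hc
  exact eq_bot_of_top_isCompl hc

theorem exists_decomp_fintype (M : Type u) [AddCommGroup M] [Module A M] [IsArtinian A M] :
    ∃ (ι : Type) (_ : Fintype ι) (X : ι → ModuleCat.{u} A), (∀ i, IsIndec A (X i)) ∧
      Nonempty (M ≃ₗ[A] ∀ i, X i) := by
  have key : ∀ N : Submodule A M, ∃ (ι : Type) (_ : Fintype ι) (X : ι → ModuleCat.{u} A),
      (∀ i, IsIndec A (X i)) ∧ Nonempty (N ≃ₗ[A] ∀ i, X i) := by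
    intro N
    induction N using IsArtinian.induction with
    | _ N ih =>
      by_cases hN : Nontrivial N
      · by_cases hI : IsIndec A N
        · exact ⟨Unit, inferInstance, fun _ => ModuleCat.of A N, fun _ => hI,
            ⟨(LinearEquiv.funUnique Unit A N).symm⟩⟩
        · simp only [IsIndec, hN, true_and, not_forall, not_or] at hI
          obtain ⟨N₁, N₂, hc, h1, h2⟩ := hI
          have hinj : Injective N.subtype := N.injective_subtype
          obtain ⟨ι₁, _, X₁, hX₁, ⟨e₁⟩⟩ := ih _ (isCompl_map_lt hc h2)
          obtain ⟨ι₂, _, X₂, hX₂, ⟨e₂⟩⟩ := ih _ (isCompl_map_lt hc.symm h1)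
          have f₁ : N₁ ≃ₗ[A] ∀ i, X₁ i := (Submodule.equivMapOfInjective _ hinj N₁).trans e₁
          have f₂ : N₂ ≃ₗ[A] ∀ i, X₂ i := (Submodule.equivMapOfInjective _ hinj N₂).trans e₂
          have f₃ : N ≃ₗ[A] (∀ i, X₁ i) × (∀ i, X₂ i) :=
            (Submodule.prodEquivOfIsCompl N₁ N₂ hc).symm.trans (f₁.prodCongr f₂)
          refine ⟨ι₁ ⊕ ι₂, inferInstance, Sum.elim X₁ X₂, ?_, ⟨f₃.trans
            (LinearEquiv.sumPiEquivProdPi A ι₁ ι₂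
              (fun s => ((Sum.elim X₁ X₂ : ι₁ ⊕ ι₂ → ModuleCat.{u} A) s : Type u))).symm⟩⟩
          rintro (j | j)
          · exact hX₁ j
          · exact hX₂ j
      · have : Subsingleton N := not_nontrivial_iff_subsingleton.mp hN
        exact ⟨Empty, inferInstance, Empty.elim, fun i => i.elim, ⟨0⟩⟩
  obtain ⟨ι, hι, X, hX, ⟨e⟩⟩ := key ⊤
  exact ⟨ι, hι, X, hX, ⟨(Submodule.topEquiv (R := A) (M := M)).symm.trans e⟩⟩

/-- Reindexing a direct product. -/
def piReindex {ι κ : Type*} (e : κ ≃ ι) (X : ι → ModuleCat.{u} A) :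
    (∀ i, X i) ≃ₗ[A] ∀ k, X (e k) :=
  (LinearEquiv.piCongrLeft A (fun i => (X i : Type u)) e).symm

theorem exists_decomp (M : Type u) [AddCommGroup M] [Module A M] [IsArtinian A M] :
    ∃ (n : ℕ) (X : Fin n → ModuleCat.{u} A), (∀ i, IsIndec A (X i)) ∧
      Nonempty (M ≃ₗ[A] ∀ i, X i) := by
  obtain ⟨ι, _, X, hX, ⟨e⟩⟩ := exists_decomp_fintype (A := A) M
  exact ⟨_, fun j => X ((Fintype.equivFin ι).symm j), fun i => hX _,
    ⟨e.trans (piReindex (Fintype.equivFin ι).symm X)⟩⟩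

theorem exists_skel (M : Type u) [AddCommGroup M] [Module A M] [IsArtinian A M] :
    ∃ (k : ℕ) (X : Fin k → ModuleCat.{u} A), Skel M X := by
  obtain ⟨n, Y, hY, ⟨e⟩⟩ := exists_decomp (A := A) M
  let s : Setoid (Fin n) := ⟨fun i j => Nonempty (Y i ≃ₗ[A] Y j), fun i => ⟨.refl _ _⟩,
    
    fun h => ⟨h.some.symm⟩, fun h h' => ⟨h.some.trans h'.some⟩⟩
  classical
  let q := Fintype.equivFin (Quotient s)
  have hout : ∀ i, Nonempty (Y i ≃ₗ[A] Y (Quotient.mk s i).out) :=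
    fun i => Quotient.exact (s := s) (Quotient.out_eq _).symm
  have f : (∀ i, Y i) ≃ₗ[A] ∀ i, Y (q.symm (q (Quotient.mk s i))).out := by
    refine LinearEquiv.piCongrRight fun i => (hout i).some.trans
      (LinearEquiv.cast (R := A) (M := fun t : Quotient s => (Y t.out : Type u))
      (q.symm_apply_apply (Quotient.mk s i)).symm)
  refine ⟨_, fun j => Y (q.symm j).out, ⟨fun i => hY _, fun i j h => ?_⟩, n,
    fun i => q (Quotient.mk s i), q.surjective.comp Quotient.mk_surjective, ⟨e.trans f⟩⟩
  have := Quotient.sound (s := s) (a := (q.symm i).out) (b := (q.symm j).out) h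
  rw [Quotient.out_eq, Quotient.out_eq] at this
  exact q.symm.injective this

end Decompositions

section Bridges

variable {A : Type u} [Ring A]

/-- The internal summands coming from a product decomposition. -/
def piSummand {n : ℕ} {X : Fin n → ModuleCat.{u} A} {M : Type u} [AddCommGroup M] [Module A M]
    (e : M ≃ₗ[A] ∀ i, X i) (i : Fin n) : Submodule A M :=
  LinearMap.range (e.symm.toLinearMap ∘ₗ LinearMap.single A (fun i => (X i : Type u)) i)

/-- The internal summands are isomorphic to the factors. -/
noncomputable def piSummandEquiv {n : ℕ} {X : Fin n → ModuleCat.{u} A} {M : Type u}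
    [AddCommGroup M] [Module A M] (e : M ≃ₗ[A] ∀ i, X i) (i : Fin n) :
    X i ≃ₗ[A] piSummand e i :=
  LinearEquiv.ofInjective (e.symm.toLinearMap ∘ₗ LinearMap.single A (fun i => (X i : Type u)) i)
    (e.symm.injective.comp fun _ _ h => Pi.single_injective (M := fun i => (X i : Type u)) i h)

theorem isInternal_piSummand {n : ℕ} {X : Fin n → ModuleCat.{u} A} {M : Type u}
    [AddCommGroup M] [Module A M] (e : M ≃ₗ[A] ∀ i, X i) :
    DirectSum.IsInternal (piSummand e) := by
  have key : ⇑(DirectSum.coeLinearMap (piSummand e)) =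
      ⇑(((DFinsupp.mapRange.linearEquiv fun i => (piSummandEquiv e i).symm).trans
        (DirectSum.linearEquivFunOnFintype A (Fin n) fun i => (X i : Type u))).trans e.symm) := by
    rw [← LinearEquiv.coe_coe]
    congr 1
    refine DirectSum.linearMap_ext A fun i => LinearMap.ext fun x => ?_
    obtain ⟨y, rfl⟩ := (piSummandEquiv e i).surjective x
    have h1 : (DirectSum.coeLinearMap (piSummand e)) (DirectSum.lof A (Fin n) (fun i =>
        piSummand e i) i (piSummandEquiv e i y)) = e.symm (Pi.single i y) :=
      DirectSum.coeLinearMap_lof _ _ _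
    have h2 : (DFinsupp.mapRange.linearEquiv fun i => (piSummandEquiv e i).symm)
        (DirectSum.lof A (Fin n) (fun i => piSummand e i) i (piSummandEquiv e i y)) =
        DirectSum.lof A (Fin n) (fun i => (X i : Type u)) i y := by
      refine (DFinsupp.mapRange_single (hf := fun i => map_zero _)).trans ?_
      rw [LinearEquiv.symm_apply_apply]
      rfl
    simp only [LinearMap.comp_apply, LinearEquiv.coe_coe, LinearEquiv.trans_apply]
    rw [h1, h2, DirectSum.linearEquivFunOnFintype_lof]
  unfold DirectSum.IsInternal
  have h3 : ⇑(DirectSum.coeAddMonoidHom (piSummand e)) =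
    ⇑(DirectSum.coeLinearMap (piSummand e)) := rfl
  rw [h3, key]
  exact LinearEquiv.bijective _

/-- An internal decomposition gives a product decomposition. -/
noncomputable def equivOfInternal {n : ℕ} {M : Type u} [AddCommGroup M] [Module A M]
    {N : Fin n → Submodule A M} (h : DirectSum.IsInternal N) :
    M ≃ₗ[A] ∀ i, ModuleCat.of A (N i) :=
  (LinearEquiv.ofBijective (DirectSum.coeLinearMap N) h).symm.trans
    (DirectSum.linearEquivFunOnFintype A (Fin n) fun i => N i)

theorem isBasic_iff {M : Type u} [AddCommGroup M] [Module A M] :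
    IsBasic A M ↔ ∃ (n : ℕ) (X : Fin n → ModuleCat.{u} A), IndecFam X ∧
      Nonempty (M ≃ₗ[A] ∀ i, X i) := by
  constructor
  · rintro ⟨n, N, hN, hI, hne⟩
    exact ⟨n, fun i => ModuleCat.of A (N i), ⟨hI, fun i j h => by
      by_contra hij; exact hne i j hij h⟩, ⟨equivOfInternal hN⟩⟩
  · rintro ⟨n, X, ⟨hI, hne⟩, ⟨e⟩⟩
    refine ⟨n, piSummand e, isInternal_piSummand e,
      fun i => (hI i).of_equiv (piSummandEquiv e i), fun i j hij ⟨f⟩ => hij (hne i j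
      ⟨((piSummandEquiv e i).trans f).trans (piSummandEquiv e j).symm⟩)⟩

theorem numIndec_iff {M : Type u} [AddCommGroup M] [Module A M] {k : ℕ} :
    NumIndec A M k ↔ ∃ X : Fin k → ModuleCat.{u} A, Skel M X := by
  constructor
  · rintro ⟨n, N, hN, hI, c, hc, hcN⟩
    have hs := surjInv_eq hc
    refine ⟨fun i => ModuleCat.of A (N (surjInv hc i)), ⟨fun i => hI _, fun i j h => ?_⟩, n, c, hc,
      ⟨(equivOfInternal hN).trans (LinearEquiv.piCongrRight fun i =>
        ((hcN i (surjInv hc (c i))).mp (hs (c i)).symm).some)⟩⟩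
    rw [← hs i, ← hs j]
    exact (hcN _ _).mpr h
  · rintro ⟨X, ⟨hI, hne⟩, n, c, hc, ⟨e⟩⟩
    let e' : M ≃ₗ[A] ∀ i, (fun j => X (c j)) i := e
    refine ⟨n, piSummand e', isInternal_piSummand e',
      fun i => (hI (c i)).of_equiv (piSummandEquiv e' i), c, hc, fun i j => ⟨fun h => ?_,
      fun ⟨f⟩ => hne _ _ ⟨((piSummandEquiv e' i).trans f).trans (piSummandEquiv e' j).symm⟩⟩⟩
    exact ⟨((piSummandEquiv e' i).symm.trans (LinearEquiv.cast (R := A)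
      (M := fun t : Fin k => (X t : Type u)) h)).trans (piSummandEquiv e' j)⟩

theorem Skel.of_equiv {M N : Type u} [AddCommGroup M] [Module A M] [AddCommGroup N] [Module A N]
    {k : ℕ} {X : Fin k → ModuleCat.{u} A} (e : M ≃ₗ[A] N) (h : Skel M X) : Skel N X := by
  obtain ⟨h1, n, c, hc, ⟨f⟩⟩ := h
  exact ⟨h1, n, c, hc, ⟨e.symm.trans f⟩⟩

theorem NumIndec.of_equiv {M N : Type u} [AddCommGroup M] [Module A M] [AddCommGroup N]
    [Module A N] {k : ℕ} (e : M ≃ₗ[A] N) (h : NumIndec A M k) : NumIndec A N k := by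
  rw [numIndec_iff] at h ⊢
  exact h.imp fun X hX => hX.of_equiv e

theorem IsBasic.of_equiv {M N : Type u} [AddCommGroup M] [Module A M] [AddCommGroup N]
    [Module A N] (e : M ≃ₗ[A] N) (h : IsBasic A M) : IsBasic A N := by
  rw [isBasic_iff] at h ⊢
  obtain ⟨n, X, hX, ⟨f⟩⟩ := h
  exact ⟨n, X, hX, ⟨e.symm.trans f⟩⟩

theorem IndecFam.skel {n : ℕ} {X : Fin n → ModuleCat.{u} A} (hX : IndecFam X)
    {M : Type u} [AddCommGroup M] [Module A M] (e : M ≃ₗ[A] ∀ i, X i) : Skel M X :=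
  ⟨hX, n, id, surjective_id, ⟨e⟩⟩

theorem Skel.isDirectSummand {M : Type u} [AddCommGroup M] [Module A M]
    {k : ℕ} {X : Fin k → ModuleCat.{u} A} (h : Skel M X) (i : Fin k) :
    IsDirectSummand A (X i) M := by
  obtain ⟨h1, n, c, hc, ⟨f⟩⟩ := h
  obtain ⟨j, rfl⟩ := hc i
  exact isDirectSummand_pi (fun j => X (c j)) f j

theorem finite_of_isDirectSummand {X M : Type u} [AddCommGroup X] [Module A X] [AddCommGroup M]
    [Module A M] [Module.Finite A M] (h : IsDirectSummand A X M) : Module.Finite A X := by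
  obtain ⟨i, p, h⟩ := h
  exact Module.Finite.of_surjective p fun x => ⟨i x, LinearMap.congr_fun h x⟩

theorem Skel.exists_equiv {M : Type u} [AddCommGroup M] [Module A M]
    {k : ℕ} {X : Fin k → ModuleCat.{u} A} (h : Skel M X) {Y : Type u} [AddCommGroup Y]
    [Module A Y] [IsNoetherian A Y] [IsArtinian A Y] (hY : IsIndec A Y)
    (hs : IsDirectSummand A Y M) : ∃ i, Nonempty (Y ≃ₗ[A] X i) := by
  obtain ⟨h1, n, c, hc, ⟨f⟩⟩ := h
  obtain ⟨j, hj⟩ := exists_equiv_of_isDirectSummand_pi hY (fun j => X (c j)) (fun j => h1.1 _) f hs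
  exact ⟨c j, hj⟩

/-- Krull–Schmidt for basic modules. -/
theorem IndecFam.equiv_of_forall {k l : ℕ} {X : Fin k → ModuleCat.{u} A}
    {Y : Fin l → ModuleCat.{u} A} (hX : IndecFam X) (hY : IndecFam Y)
    (h : ∀ i, ∃ j, Nonempty (X i ≃ₗ[A] Y j)) (h' : ∀ j, ∃ i, Nonempty (Y j ≃ₗ[A] X i)) :
    ∃ e : Fin k ≃ Fin l, ∀ i, Nonempty (X i ≃ₗ[A] Y (e i)) := by
  choose f hf using h
  choose g hg using h'
  have hgf : ∀ i, g (f i) = i := fun i => (hX.2 _ _ ⟨(hf i).some.trans (hg (f i)).some⟩).symm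
  have hfg : ∀ i, f (g i) = i := fun i => (hY.2 _ _ ⟨(hg i).some.trans (hf (g i)).some⟩).symm
  exact ⟨⟨f, g, hgf, hfg⟩, hf⟩

theorem pi_equiv_of_forall {k l : ℕ} {X : Fin k → ModuleCat.{u} A}
    {Y : Fin l → ModuleCat.{u} A} (hX : IndecFam X) (hY : IndecFam Y)
    (h : ∀ i, ∃ j, Nonempty (X i ≃ₗ[A] Y j)) (h' : ∀ j, ∃ i, Nonempty (Y j ≃ₗ[A] X i)) :
    Nonempty ((∀ i, X i) ≃ₗ[A] ∀ i, Y i) := by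
  obtain ⟨e, he⟩ := hX.equiv_of_forall hY h h'
  exact ⟨(LinearEquiv.piCongrRight fun i => (he i).some).trans (piReindex e Y).symm⟩

theorem IndecFam.of_equiv {ι : Type*} {X Y : ι → ModuleCat.{u} A} (hX : IndecFam X)
    (e : ∀ i, Nonempty (X i ≃ₗ[A] Y i)) : IndecFam Y :=
  ⟨fun i => (hX.1 i).of_equiv (e i).some, fun i j ⟨f⟩ =>
    hX.2 i j ⟨((e i).some.trans f).trans (e j).some.symm⟩⟩

variable [IsArtinianRing A]

theorem Skel.exists_equiv_skel {M : Type u} [AddCommGroup M] [Module A M] [Module.Finite A M]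
    {k l : ℕ} {X : Fin k → ModuleCat.{u} A} {Y : Fin l → ModuleCat.{u} A} (hX : Skel M X)
    (hY : Skel M Y) : ∃ e : Fin k ≃ Fin l, ∀ i, Nonempty (X i ≃ₗ[A] Y (e i)) := by
  refine hX.1.equiv_of_forall hY.1 (fun i => ?_) fun j => ?_
  · have := finite_of_isDirectSummand (hX.isDirectSummand i)
    exact hY.exists_equiv (hX.1.1 i) (hX.isDirectSummand i)
  · have := finite_of_isDirectSummand (hY.isDirectSummand j)
    exact hX.exists_equiv (hY.1.1 j) (hY.isDirectSummand j)

theorem NumIndec.unique {M : Type u} [AddCommGroup M] [Module A M] [Module.Finite A M]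
    {k l : ℕ} (h : NumIndec A M k) (h' : NumIndec A M l) : k = l := by
  obtain ⟨X, hX⟩ := numIndec_iff.mp h
  obtain ⟨Y, hY⟩ := numIndec_iff.mp h'
  obtain ⟨e, -⟩ := hX.exists_equiv_skel hY
  simpa using Fintype.card_congr e

end Bridges

section Covers

variable {A : Type u} [Ring A]

theorem exists_dualBasis (P : Type u) [AddCommGroup P] [Module A P] [Module.Finite A P]
    [Module.Projective A P] : ∃ (n : ℕ) (p : Fin n → P) (φ : Fin n → (P →ₗ[A] A)),
      ∀ x, x = ∑ k, φ k x • p k := by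
  obtain ⟨n, f, g, -, -, hfg⟩ := Module.Finite.exists_comp_eq_id_of_projective A P
  refine ⟨n, fun k => f (Pi.single k 1), fun k => LinearMap.proj k ∘ₗ g, fun x => ?_⟩
  have h1 : f (g x) = x := LinearMap.congr_fun hfg x
  conv_lhs => rw [← h1, ← Finset.univ_sum_single (g x), map_sum]
  refine Finset.sum_congr rfl fun k _ => ?_
  rw [← map_smul]
  congr 1
  ext j
  by_cases hj : j = k
  · subst hj; simp
  · simp [hj]

theorem superfluous_map_eq {P N : Type u} [AddCommGroup P] [Module A P] [AddCommGroup N]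
    [Module A N] {U : Submodule A P} (hU : IsSuperfluous A U) (g : P →ₗ[A] N)
    (h : LinearMap.range g ≤ U.map g) : g = 0 := by
  rw [← LinearMap.ker_eq_top]
  refine hU _ ?_
  rw [eq_top_iff]
  intro x _
  obtain ⟨y, hy, hyx⟩ := h ⟨x, rfl⟩
  exact Submodule.mem_sup.mpr ⟨y, hy, x - y, by simp [hyx], by simp⟩

theorem exists_projCover [IsArtinianRing A] (M : Type u) [AddCommGroup M] [Module A M]
    [Module.Finite A M] : Nonempty (ProjCover A M) := by
  obtain ⟨n, π, hπ⟩ := Module.Finite.exists_fin' A M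
  have hsurj := hπ
  have key : ∀ N : Submodule A (Fin n → A), Module.Projective A N →
      Surjective (π ∘ₗ N.subtype) → Nonempty (ProjCover A M) := by
    intro N
    induction N using IsArtinian.induction with
    | _ N ih =>
      intro hP hs
      by_cases hsup : IsSuperfluous A (LinearMap.ker (π ∘ₗ N.subtype))
      · exact ⟨⟨N, inferInstance, hP, π ∘ₗ N.subtype, hs, hsup⟩⟩
      simp only [IsSuperfluous, not_forall] at hsup
      obtain ⟨N', hN', hne⟩ := hsup
      have hs' : Surjective ((π ∘ₗ N.subtype) ∘ₗ N'.subtype) := by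
        intro m
        obtain ⟨x, rfl⟩ := hs m
        obtain ⟨k, hk, y, hy, rfl⟩ := Submodule.mem_sup.mp
          (show x ∈ LinearMap.ker (π ∘ₗ N.subtype) ⊔ N' by rw [hN']; trivial)
        refine ⟨⟨y, hy⟩, ?_⟩
        rw [map_add, LinearMap.mem_ker.mp hk, zero_add]
        rfl
      obtain ⟨a, ha⟩ := Module.projective_lifting_property _ (π ∘ₗ N.subtype) hs'
      let b : Module.End A N := N'.subtype ∘ₗ a
      have hb : ∀ x, (π ∘ₗ N.subtype) (b x) = (π ∘ₗ N.subtype) x :=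
        fun x => LinearMap.congr_fun ha x
      have hbk : ∀ (k : ℕ) x, (π ∘ₗ N.subtype) ((b ^ k) x) = (π ∘ₗ N.subtype) x := by
        intro k
        induction k with
        | zero => intro x; simp
        | succ k ihk => intro x; rw [pow_succ', Module.End.mul_apply, hb, ihk]
      obtain ⟨k, hk, hk1⟩ := ((LinearMap.eventually_isCompl_ker_pow_range_pow b).and
        (Filter.eventually_ge_atTop 1)).exists
      have hproj : Module.Projective A (LinearMap.range (b ^ k)) :=
        Module.Projective.of_split (LinearMap.range (b ^ k)).subtype
          (Submodule.projectionOnto _ _ hk.symm)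
          (LinearMap.ext fun x => Submodule.projectionOnto_apply_left hk.symm x)
      have hlt : (LinearMap.range (b ^ k)).map N.subtype < N := by
        refine lt_of_le_of_ne (Submodule.map_subtype_le _ _) fun h => hne ?_
        rw [eq_top_iff]
        intro x _
        obtain ⟨y, ⟨z, rfl⟩, hy⟩ : (x : Fin n → A) ∈ (LinearMap.range (b ^ k)).map N.subtype := by
          rw [h]; exact x.2
        have : (b ^ k) z = x := Subtype.ext hy
        rw [← this, (by omega : k = (k - 1) + 1), pow_succ', Module.End.mul_apply]
        exact (a _).2
      refine ih _ hlt (Module.Projective.of_equiv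
        (Submodule.equivMapOfInjective _ N.injective_subtype (LinearMap.range (b ^ k)))) ?_
      intro m
      obtain ⟨x, rfl⟩ := hs m
      exact ⟨⟨_, Submodule.mem_map_of_mem ⟨x, rfl⟩⟩, hbk k x⟩
  exact key ⊤ (Module.Projective.of_equiv Submodule.topEquiv.symm)
    fun m => let ⟨x, hx⟩ := hsurj m; ⟨⟨x, trivial⟩, hx⟩

theorem exists_minPres [IsArtinianRing A] (M : Type u) [AddCommGroup M] [Module A M]
    [Module.Finite A M] : Nonempty (MinPres A M) := by
  obtain ⟨c⟩ := exists_projCover (A := A) M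
  have := c.fin
  obtain ⟨c'⟩ := exists_projCover (A := A) (LinearMap.ker c.π)
  refine ⟨⟨c'.P, c.P, c'.fin, c.fin, c'.proj, c.proj, (LinearMap.ker c.π).subtype ∘ₗ c'.π, c.π,
    c.surj, ?_, c.min, ?_⟩⟩
  · rw [LinearMap.exact_iff, LinearMap.range_comp, LinearMap.range_eq_top.mpr c'.surj,
      Submodule.map_top, Submodule.range_subtype]
  · rw [LinearMap.ker_comp_of_ker_eq_bot _ (Submodule.ker_subtype _)]
    exact c'.min

end Covers

section Ext

variable {A : Type u} [Ring A]

/-- If `Ext¹(M, N) = 0` then maps from the kernel of a surjection onto `M` to `N` extend. -/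
theorem Ext1Vanishes.extend {M N P : Type u} [AddCommGroup M] [Module A M] [AddCommGroup N]
    [Module A N] [AddCommGroup P] [Module A P] (h : Ext1Vanishes A M N) (p : P →ₗ[A] M)
    (hp : Surjective p) (v : LinearMap.ker p →ₗ[A] N) :
    ∃ w : P →ₗ[A] N, w ∘ₗ (LinearMap.ker p).subtype = v := by
  let D : Submodule A (N × P) := LinearMap.range (v.prod (-(LinearMap.ker p).subtype))
  let i : N →ₗ[A] (N × P) ⧸ D := D.mkQ ∘ₗ LinearMap.inl A N P
  let q : (N × P) ⧸ D →ₗ[A] M := D.liftQ (p ∘ₗ LinearMap.snd A N P) (by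
    rintro _ ⟨k, rfl⟩
    simp)
  have hi : Injective i := by
    rw [← LinearMap.ker_eq_bot, LinearMap.ker_eq_bot']
    intro n hn
    obtain ⟨k, hk⟩ := (Submodule.Quotient.mk_eq_zero D).mp hn
    have h1 : v k = n := congrArg Prod.fst hk
    have h2 : -(k : P) = 0 := congrArg Prod.snd hk
    have h3 : k = 0 := Subtype.ext (neg_eq_zero.mp h2)
    rw [← h1, h3, map_zero]
  have hq : Surjective q := fun m => by
    obtain ⟨x, rfl⟩ := hp m
    exact ⟨D.mkQ (0, x), rfl⟩
  have hex : Exact i q := by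
    intro y
    obtain ⟨⟨n, x⟩, rfl⟩ := D.mkQ_surjective y
    constructor
    · intro hy
      have hx : p x = 0 := hy
      refine ⟨n + v ⟨x, hx⟩, ?_⟩
      refine (Submodule.Quotient.eq D).mpr ⟨⟨x, hx⟩, ?_⟩
      simp
    · rintro ⟨m, hm⟩
      rw [← hm]
      exact map_zero p
  obtain ⟨s, hs⟩ := h _ i q hi hq hex
  have hs' : ∀ m, q (s m) = m := fun m => LinearMap.congr_fun hs m
  have hret : ∀ y, ∃ n, i n = y - s (q y) := fun y => (hex _).mp (by rw [map_sub, hs', sub_self])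
  choose r hr using hret
  let r' : ((N × P) ⧸ D) →ₗ[A] N :=
    { toFun := r
      map_add' := fun x y => hi (by rw [map_add, hr, hr, hr]; simp only [map_add]; abel)
      map_smul' := fun a x => hi (by
        rw [map_smul, hr, hr]; simp only [map_smul, smul_sub, RingHom.id_apply]) }
  refine ⟨r' ∘ₗ D.mkQ ∘ₗ LinearMap.inr A N P, LinearMap.ext fun k => hi ?_⟩
  change i (r (D.mkQ (0, (k : P)))) = i (v k)
  rw [hr]
  have h1 : q (D.mkQ (0, (k : P))) = 0 := k.2
  rw [h1, map_zero, sub_zero]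
  refine (Submodule.Quotient.eq D).mpr ⟨-k, ?_⟩
  simp

/-- If `Ext¹(M, ker q) = 0` then maps from `M` lift along the surjection `q`. -/
theorem Ext1Vanishes.lift {M N P : Type u} [AddCommGroup M] [Module A M] [AddCommGroup N]
    [Module A N] [AddCommGroup P] [Module A P] (q : P →ₗ[A] N)
    (h : Ext1Vanishes A M (LinearMap.ker q)) (hq : Surjective q) (f : M →ₗ[A] N) :
    ∃ g : M →ₗ[A] P, q ∘ₗ g = f := by
  let E : Submodule A (P × M) := LinearMap.ker (q ∘ₗ LinearMap.fst A P M - f ∘ₗ LinearMap.snd A P M)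
  have hE : ∀ x : E, q x.1.1 = f x.1.2 := fun x => sub_eq_zero.mp x.2
  let i : LinearMap.ker q →ₗ[A] E := LinearMap.codRestrict E
    (LinearMap.inl A P M ∘ₗ (LinearMap.ker q).subtype) fun k => by
      simp [E]
  let p : E →ₗ[A] M := LinearMap.snd A P M ∘ₗ E.subtype
  obtain ⟨s, hs⟩ := h _ i p (fun x y hxy => by
      have := congrArg (fun z : E => z.1.1) hxy
      exact Subtype.ext this)
    (fun m => by
      obtain ⟨x, hx⟩ := hq (f m)
      exact ⟨⟨(x, m), by simp [E, hx]⟩, rfl⟩)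
    (fun y => ⟨fun hy => by
      have h1 : y.1.2 = 0 := hy
      have h2 := hE y
      rw [h1, map_zero] at h2
      exact ⟨⟨y.1.1, h2⟩, Subtype.ext (Prod.ext rfl h1.symm)⟩, by
      rintro ⟨k, rfl⟩; rfl⟩)
  refine ⟨LinearMap.fst A P M ∘ₗ E.subtype ∘ₗ s, LinearMap.ext fun m => ?_⟩
  have := hE (s m)
  have h2 : (s m).1.2 = m := LinearMap.congr_fun hs m
  rw [h2] at this
  exact this

/-- Vanishing of `Ext¹` from a presentation. -/
theorem ext1Vanishes_of_extend {M N P₁ P₀ : Type u} [AddCommGroup M] [Module A M]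
    [AddCommGroup N] [Module A N] [AddCommGroup P₁] [Module A P₁] [AddCommGroup P₀] [Module A P₀]
    [Module.Projective A P₀] (d : P₁ →ₗ[A] P₀) (p : P₀ →ₗ[A] M)
    (hp : Surjective p) (hdp : Exact d p)
    (h : ∀ g : P₁ →ₗ[A] N, ∃ w : P₀ →ₗ[A] N, g = w ∘ₗ d) : Ext1Vanishes A M N := by
  intro E _ _ i π hi hπ hiπ
  obtain ⟨p', hp'⟩ := Module.projective_lifting_property π p hπ
  have hp'' : ∀ x, π (p' x) = p x := fun x => LinearMap.congr_fun hp' x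
  have h1 : ∀ x, ∃ n, i n = p' (d x) := fun x => (hiπ _).mp (by rw [hp'']; exact hdp.apply_apply_eq_zero x)
  choose g hg using h1
  let g' : P₁ →ₗ[A] N :=
    { toFun := g
      map_add' := fun x y => hi (by simp only [map_add, hg])
      map_smul' := fun a x => hi (by simp only [map_smul, hg, RingHom.id_apply]) }
  obtain ⟨w, hw⟩ := h g'
  have hw' : ∀ x, g x = w (d x) := fun x => LinearMap.congr_fun hw x
  have hker : LinearMap.ker p ≤ LinearMap.ker (p' - i ∘ₗ w) := by
    intro x hx
    obtain ⟨y, rfl⟩ := (hdp x).mp hx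
    rw [LinearMap.mem_ker, LinearMap.sub_apply, LinearMap.comp_apply, ← hw', hg, sub_self]
  let e := p.quotKerEquivOfSurjective hp
  refine ⟨(LinearMap.ker p).liftQ (p' - i ∘ₗ w) hker ∘ₗ e.symm.toLinearMap, LinearMap.ext fun m => ?_⟩
  obtain ⟨x, rfl⟩ := hp m
  have h2 : e.symm (p x) = (LinearMap.ker p).mkQ x := by
    rw [LinearEquiv.symm_apply_eq]; rfl
  simp only [LinearMap.comp_apply, LinearEquiv.coe_coe, h2]
  rw [Submodule.mkQ_apply, Submodule.liftQ_apply, LinearMap.sub_apply, map_sub, hp'',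
    LinearMap.comp_apply, hiπ.apply_apply_eq_zero, sub_zero, LinearMap.id_apply]

/-- Maps extend along a presentation with superfluous kernel as soon as `Ext¹` into all quotients
vanishes. -/
theorem extend_of_ext1Vanishes {M N P₁ P₀ : Type u} [AddCommGroup M] [Module A M]
    [AddCommGroup N] [Module A N] [AddCommGroup P₁] [Module A P₁] [AddCommGroup P₀] [Module A P₀]
    [Module.Projective A P₀] [IsArtinian A N] (d : P₁ →ₗ[A] P₀) (p : P₀ →ₗ[A] M)
    (hp : Surjective p) (hdp : Exact d p) (hd : IsSuperfluous A (LinearMap.ker d))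
    (h : ∀ L : Submodule A N, Ext1Vanishes A M (N ⧸ L)) (g : P₁ →ₗ[A] N) :
    ∃ w : P₀ →ₗ[A] N, g = w ∘ₗ d := by
  have key : ∀ (V : Submodule A N) (g : P₁ →ₗ[A] N), LinearMap.range g = V →
      ∃ w : P₀ →ₗ[A] N, g = w ∘ₗ d := by
    intro V
    induction V using IsArtinian.induction with
    | _ V ih =>
      intro g hg
      by_cases h0 : g = 0
      · exact ⟨0, by rw [h0, LinearMap.zero_comp]⟩
      let L := (LinearMap.ker d).map g
      have hL : L < V := by
        rw [← hg]
        exact lt_of_le_not_ge LinearMap.map_le_range fun hle => h0 (superfluous_map_eq hd g hle)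
      have hrange : ∀ k : LinearMap.ker p, ∃ x, d x = k := fun k => (hdp _).mp k.2
      choose t ht using hrange
      have hwd : ∀ x y, d x = d y → L.mkQ (g x) = L.mkQ (g y) := by
        intro x y hxy
        refine (Submodule.Quotient.eq L).mpr ?_
        exact ⟨x - y, by simp [hxy], by simp⟩
      let v : LinearMap.ker p →ₗ[A] N ⧸ L :=
        { toFun := fun k => L.mkQ (g (t k))
          map_add' := fun x y => by
            rw [← map_add, ← map_add]; exact hwd _ _ (by rw [map_add, ht, ht, ht]; rfl)
          map_smul' := fun a x => by
            rw [RingHom.id_apply, ← map_smul, ← map_smul]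
            exact hwd _ _ (by rw [map_smul, ht, ht]; rfl) }
      obtain ⟨w, hw⟩ := (h L).extend p hp v
      obtain ⟨w', hw'⟩ := Module.projective_lifting_property L.mkQ w L.mkQ_surjective
      obtain ⟨w₂, hw₂⟩ := ih (LinearMap.range (g - w' ∘ₗ d)) (lt_of_le_of_lt (by
        rintro _ ⟨x, rfl⟩
        rw [← Submodule.Quotient.mk_eq_zero L, ← Submodule.mkQ_apply, LinearMap.sub_apply, map_sub,
          sub_eq_zero]
        have h1 : L.mkQ (w' (d x)) = w (d x) := LinearMap.congr_fun hw' (d x)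
        have h2 : w (d x) = v ⟨d x, hdp.apply_apply_eq_zero x⟩ :=
          LinearMap.congr_fun hw ⟨d x, _⟩
        rw [LinearMap.comp_apply, h1, h2]
        exact hwd _ _ (ht ⟨d x, hdp.apply_apply_eq_zero x⟩).symm) hL) _ rfl
      exact ⟨w' + w₂, by rw [LinearMap.add_comp, ← hw₂]; abel⟩
  exact key _ g rfl

end Ext

section TauRigid

variable {A : Type u} [Ring A] {K : Type u} [Field K] [Algebra K A]
variable {M : Type u} [AddCommGroup M] [Module A M]

theorem MinPres.toTr_surjective (pr : MinPres A M) : Surjective pr.toTr :=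
  Submodule.Quotient.mk_surjective _

theorem MinPres.toTr_eq_zero (pr : MinPres A M) {φ : pr.P₁ →ₗ[A] A} :
    pr.toTr φ = 0 ↔ ∃ ψ : pr.P₀ →ₗ[A] A, ψ ∘ₗ pr.d = φ :=
  Submodule.Quotient.mk_eq_zero _

theorem MinPres.toTr_smul (pr : MinPres A M) (s : Aᵐᵒᵖ) (φ : pr.P₁ →ₗ[A] A) :
    pr.toTr (s • φ) = s • pr.toTr φ := rfl

theorem MinPres.toTr_sum (pr : MinPres A M) {ι : Type*} (s : Finset ι)
    (φ : ι → pr.P₁ →ₗ[A] A) : pr.toTr (∑ k ∈ s, φ k) = ∑ k ∈ s, pr.toTr (φ k) :=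
  map_sum (LinearMap.range pr.dualMap).mkQ φ s

theorem MinPres.exists_functional (pr : MinPres A M) (L : (pr.P₁ →ₗ[A] A) →ₗ[K] K)
    (hL : ∀ ψ : pr.P₀ →ₗ[A] A, L (ψ ∘ₗ pr.d) = 0) :
    ∃ F : OpDual A K pr.Tr, ∀ φ, OpDual.toL A K pr.Tr F (pr.toTr φ) = L φ := by
  let F : pr.Tr →ₗ[K] K := (Submodule.liftQ ((LinearMap.range pr.dualMap).restrictScalars K) L
    (by rintro _ ⟨ψ, rfl⟩; exact hL ψ)) ∘ₗ
      (Submodule.Quotient.restrictScalarsEquiv K (LinearMap.range pr.dualMap)).symm.toLinearMap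
  exact ⟨F, fun φ => rfl⟩

/-- `Hom(X, τM) = 0` in terms of a minimal presentation of `M`. -/
theorem MinPres.hom_tau_eq_zero_iff' [FiniteDimensional K A] (pr : MinPres A M) {X : Type u}
    [AddCommGroup X] [Module A X] [Module K X] [IsScalarTower K A X] :
    (∀ f : X →ₗ[A] pr.tau K, f = 0) ↔
      ∀ g : pr.P₁ →ₗ[A] X, ∃ h : pr.P₀ →ₗ[A] X, g = h ∘ₗ pr.d := by
  have := pr.fin₁; have := pr.fin₀; have := pr.proj₁; have := pr.proj₀
  obtain ⟨n, p, φ, hpφ⟩ := exists_dualBasis (A := A) pr.P₁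
  obtain ⟨m, q, ψ, hqψ⟩ := exists_dualBasis (A := A) pr.P₀
  constructor
  · intro hf g
    let W : Submodule K (pr.P₁ →ₗ[A] X) :=
      LinearMap.range (LinearMap.lcomp K X pr.d : (pr.P₀ →ₗ[A] X) →ₗ[K] (pr.P₁ →ₗ[A] X))
    by_contra hg
    have hgW : g ∉ W := fun ⟨h, hh⟩ => hg ⟨h, hh.symm⟩
    obtain ⟨B, hBg, hBW⟩ := Submodule.exists_le_ker_of_notMem hgW
    let SR (x : X) : (pr.P₁ →ₗ[A] A) →ₗ[K] (pr.P₁ →ₗ[A] X) :=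
      { toFun := fun φ => φ.smulRight x
        map_add' := fun φ ψ => by ext y; simp [add_smul]
        map_smul' := fun k φ => by ext y; simp }
    have hF : ∀ x : X, ∃ F : OpDual A K pr.Tr,
        ∀ φ, OpDual.toL A K pr.Tr F (pr.toTr φ) = B (φ.smulRight x) := fun x =>
      pr.exists_functional (B ∘ₗ SR x) fun ψ => hBW ⟨ψ.smulRight x, by ext y; simp [SR]⟩
    choose F hF using hF
    have hext : ∀ G H : OpDual A K pr.Tr, (∀ φ, OpDual.toL A K pr.Tr G (pr.toTr φ) =
        OpDual.toL A K pr.Tr H (pr.toTr φ)) → G = H := fun G H h =>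
      OpDual.toL_injective A K pr.Tr (LinearMap.ext fun y => by
        obtain ⟨φ, rfl⟩ := pr.toTr_surjective y; exact h φ)
    let f : X →ₗ[A] pr.tau K :=
      { toFun := F
        map_add' := fun x y => hext _ _ fun φ => by
          change _ = OpDual.toL A K pr.Tr (F x) _ + OpDual.toL A K pr.Tr (F y) _
          rw [hF, hF, hF, ← map_add]
          congr 1; ext z; simp
        map_smul' := fun a x => hext _ _ fun φ => by
          change _ = OpDual.toL A K pr.Tr (F x) (op a • pr.toTr φ)
          rw [← pr.toTr_smul, hF, hF]
          congr 1; ext z; simp [mul_smul] }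
    have h0 : ∀ (x : X) (φ : pr.P₁ →ₗ[A] A), B (φ.smulRight x) = 0 := fun x φ => by
      rw [← hF]
      have : F x = 0 := LinearMap.congr_fun (hf f) x
      rw [this]; rfl
    apply hBg
    have : g = ∑ k, (φ k).smulRight (g (p k)) := by
      ext y
      conv_lhs => rw [hpφ y, map_sum]
      simp
    rw [this, map_sum]
    exact Finset.sum_eq_zero fun k _ => h0 _ _
  · intro h f
    let β (x : X) (φ : pr.P₁ →ₗ[A] A) : K := OpDual.toL A K pr.Tr (f x) (pr.toTr φ)
    have hβs : ∀ a x φ, β (a • x) φ = β x (op a • φ) := fun a x φ => by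
      simp only [β]
      rw [map_smul, pr.toTr_smul]; rfl
    have hβa : ∀ {ι : Type} (s : Finset ι) x (φ : ι → pr.P₁ →ₗ[A] A),
        β x (∑ k ∈ s, φ k) = ∑ k ∈ s, β x (φ k) := fun s x φ => by
      simp only [β]
      rw [pr.toTr_sum, map_sum]
    have hβb : ∀ {ι : Type} (s : Finset ι) (x : ι → X) φ,
        β (∑ k ∈ s, x k) φ = ∑ k ∈ s, β (x k) φ := fun s x φ => by
      classical
      induction s using Finset.induction_on with
      | empty => simp only [β, Finset.sum_empty, map_zero]; rfl
      | insert a s ha ih =>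
        rw [Finset.sum_insert ha, Finset.sum_insert ha, ← ih]
        simp only [β, map_add]; rfl
    have hself : ∀ χ : pr.P₁ →ₗ[A] A, ∑ k, op (χ (p k)) • φ k = χ := fun χ => by
      ext y
      conv_rhs => rw [hpφ y, map_sum]
      simp
    refine LinearMap.ext fun x => OpDual.toL_injective A K pr.Tr (LinearMap.ext fun y => ?_)
    obtain ⟨χ, rfl⟩ := pr.toTr_surjective y
    change β x χ = 0
    obtain ⟨w, hw⟩ := h (χ.smulRight x)
    have h1 : β x χ = ∑ k, β (χ (p k) • x) (φ k) := by
      conv_lhs => rw [← hself χ, hβa]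
      simp only [hβs]
    have h2 : ∀ k, χ (p k) • x = ∑ j, ψ j (pr.d (p k)) • w (q j) := fun k => by
      have := LinearMap.congr_fun hw (p k)
      rw [LinearMap.smulRight_apply, LinearMap.comp_apply, hqψ (pr.d (p k)), map_sum] at this
      simpa using this
    have h3 : ∀ j, ∑ k, β (ψ j (pr.d (p k)) • w (q j)) (φ k) = 0 := fun j => by
      simp only [hβs]
      rw [← hβa]
      have := hself (ψ j ∘ₗ pr.d)
      simp only [LinearMap.comp_apply] at this
      rw [this]
      simp only [β]
      rw [(pr.toTr_eq_zero).mpr ⟨ψ j, rfl⟩, map_zero]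
    rw [h1]
    simp only [h2, hβb]
    rw [Finset.sum_comm]
    exact Finset.sum_eq_zero fun j _ => h3 j

theorem MinPres.hom_tau_eq_zero_iff (K : Type u) [Field K] [Algebra K A] [FiniteDimensional K A]
    (pr : MinPres A M) {X : Type u}
    [AddCommGroup X] [Module A X] :
    (∀ f : X →ₗ[A] pr.tau K, f = 0) ↔
      ∀ g : pr.P₁ →ₗ[A] X, ∃ h : pr.P₀ →ₗ[A] X, g = h ∘ₗ pr.d := by
  let _ : Module K X := Module.compHom X (algebraMap K A)
  have : IsScalarTower K A X := ⟨fun k a x => by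
    rw [Algebra.smul_def, mul_smul]; rfl⟩
  exact pr.hom_tau_eq_zero_iff'

/-- Vanishing of `Ext¹(M, Fac M)`. -/
def ERigid (A : Type u) [Ring A] (M : Type u) [AddCommGroup M] [Module A M] : Prop :=
  ∀ (N : Type u) [AddCommGroup N] [Module A N], FacOf A M N → Ext1Vanishes A M N

theorem extend_pi {P₁ P₀ : Type u} [AddCommGroup P₁] [Module A P₁] [AddCommGroup P₀] [Module A P₀]
    {ι : Type*} {N : ι → Type u} [∀ i, AddCommGroup (N i)] [∀ i, Module A (N i)] (d : P₁ →ₗ[A] P₀)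
    (h : ∀ i (g : P₁ →ₗ[A] N i), ∃ w : P₀ →ₗ[A] N i, g = w ∘ₗ d) (g : P₁ →ₗ[A] ∀ i, N i) :
    ∃ w : P₀ →ₗ[A] ∀ i, N i, g = w ∘ₗ d := by
  choose w hw using fun i => h i (LinearMap.proj i ∘ₗ g)
  exact ⟨LinearMap.pi w, LinearMap.ext fun x => funext fun i => LinearMap.congr_fun (hw i) x⟩

/-- If every map `P₁ → M` extends along `d` then so do all maps to quotients of `M^n`. -/
theorem extend_of_facOf {P₁ P₀ : Type u} [AddCommGroup P₁] [Module A P₁] [AddCommGroup P₀]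
    [Module A P₀] [Module.Projective A P₁] {N : Type u} [AddCommGroup N] [Module A N]
    (d : P₁ →ₗ[A] P₀) (h : ∀ g : P₁ →ₗ[A] M, ∃ w : P₀ →ₗ[A] M, g = w ∘ₗ d) (hN : FacOf A M N)
    (g : P₁ →ₗ[A] N) : ∃ w : P₀ →ₗ[A] N, g = w ∘ₗ d := by
  obtain ⟨n, π, hπ⟩ := hN
  obtain ⟨g', hg'⟩ := Module.projective_lifting_property π g hπ
  obtain ⟨w, hw⟩ := extend_pi d (fun _ => h) g'
  exact ⟨π ∘ₗ w, by rw [← hg', hw, LinearMap.comp_assoc]⟩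

theorem facOf_quotient (L : Submodule A M) : FacOf A M (M ⧸ L) :=
  ⟨1, L.mkQ ∘ₗ LinearMap.proj 0, fun y => by
    obtain ⟨x, rfl⟩ := L.mkQ_surjective y
    exact ⟨fun _ => x, rfl⟩⟩

theorem facOf_self (M : Type u) [AddCommGroup M] [Module A M] : FacOf A M M :=
  ⟨1, LinearMap.proj 0, fun x => ⟨fun _ => x, rfl⟩⟩

theorem tauRigid_iff_eRigid (K : Type u) [Field K] [Algebra K A] [FiniteDimensional K A]
    [Module.Finite A M] : IsTauRigid A K M ↔ ERigid A M := by
  have := IsArtinianRing.of_finite K A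
  constructor
  · intro h N _ _ hN
    obtain ⟨pr⟩ := exists_minPres (A := A) M
    have := pr.proj₀; have := pr.proj₁
    exact ext1Vanishes_of_extend pr.d pr.p pr.surj pr.exact
      (extend_of_facOf pr.d ((pr.hom_tau_eq_zero_iff K).mp (h pr)) hN)
  · intro h pr
    have := pr.proj₀
    exact (pr.hom_tau_eq_zero_iff K).mpr (extend_of_ext1Vanishes pr.d pr.p pr.surj pr.exact pr.min₁
      fun L => h _ (facOf_quotient L))

end TauRigid

section HomDim

variable {A : Type u} [Ring A] (K : Type u) [Field K] [Algebra K A]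

/-- The `K`-structure on a module over a `K`-algebra. -/
@[reducible] def restrictedModule (A : Type u) [Ring A] (K : Type u) [Field K] [Algebra K A]
    (N : Type u) [AddCommGroup N] [Module A N] : Module K N :=
  Module.compHom N (algebraMap K A)

theorem restrictedModule_tower (N : Type u) [AddCommGroup N] [Module A N] :
    let _ := restrictedModule A K N
    IsScalarTower K A N :=
  let _ := restrictedModule A K N
  ⟨fun k a x => by rw [Algebra.smul_def, mul_smul]; rfl⟩

/-- The dimension over `K` of `Hom(X, N)`. -/
noncomputable def hdim (X N : Type u) [AddCommGroup X] [Module A X] [AddCommGroup N]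
    [Module A N] : ℕ :=
  let _ := restrictedModule A K N
  have _ := restrictedModule_tower (A := A) K N
  Module.finrank K (X →ₗ[A] N)

variable {X Y Z N : Type u} [AddCommGroup X] [Module A X] [AddCommGroup N] [Module A N]
  [AddCommGroup Y] [Module A Y] [AddCommGroup Z] [Module A Z]

theorem hdim_congr (e : X ≃ₗ[A] Y) : hdim (A := A) K X N = hdim (A := A) K Y N := by
  let _ := restrictedModule A K N
  have _ := restrictedModule_tower (A := A) K N
  exact (LinearEquiv.congrLeft N K e).finrank_eq

variable [FiniteDimensional K A]

theorem finiteDimensional_hom [Module.Finite A X] [Module.Finite A N] [Module K N]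
    [IsScalarTower K A N] : FiniteDimensional K (X →ₗ[A] N) := by
  have : FiniteDimensional K N := Module.Finite.trans A N
  obtain ⟨n, π, hπ⟩ := Module.Finite.exists_fin' A X
  have h1 : Injective (LinearMap.lcomp K N π : (X →ₗ[A] N) →ₗ[K] ((Fin n → A) →ₗ[A] N)) :=
    fun f g h => LinearMap.ext fun x => by
      obtain ⟨y, rfl⟩ := hπ x
      exact LinearMap.congr_fun h y
  let ev : ((Fin n → A) →ₗ[A] N) →ₗ[K] (Fin n → N) :=
    { toFun := fun f i => f (Pi.single i 1)
      map_add' := fun f g => rfl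
      map_smul' := fun f g => rfl }
  have h2 : Injective ev := fun f g h => by
    refine LinearMap.pi_ext fun i x => ?_
    have h3 : f (Pi.single i 1) = g (Pi.single i 1) := congrFun h i
    have h4 : (Pi.single i x : Fin n → A) = x • Pi.single i 1 := by
      rw [← Pi.single_smul, smul_eq_mul, mul_one]
    rw [h4, map_smul, map_smul, h3]
  exact FiniteDimensional.of_injective (ev ∘ₗ LinearMap.lcomp K N π) (h2.comp h1)

theorem hdim_pi {ι : Type} [Fintype ι] (X : ι → ModuleCat.{u} A) [∀ i, Module.Finite A (X i)]
    [Module.Finite A N] :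
    hdim (A := A) K (∀ i, X i) N = ∑ i, hdim (A := A) K (X i) N := by
  let _ := restrictedModule A K N
  have _ := restrictedModule_tower (A := A) K N
  have := fun i => finiteDimensional_hom (A := A) K (X := X i) (N := N)
  classical
  exact ((LinearMap.lsum A (fun i => (X i : Type u)) K (M := N)).finrank_eq).symm.trans
    (Module.finrank_pi_fintype K)

theorem hdim_eq_zero_iff [Module.Finite A X] [Module.Finite A N] :
    hdim (A := A) K X N = 0 ↔ ∀ f : X →ₗ[A] N, f = 0 := by
  let _ := restrictedModule A K N
  have _ := restrictedModule_tower (A := A) K N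
  have := finiteDimensional_hom (A := A) K (X := X) (N := N)
  exact Module.finrank_zero_iff.trans ⟨fun h f => Subsingleton.elim _ _, fun h =>
    ⟨fun f g => (h f).trans (h g).symm⟩⟩

/-- Additivity of `hdim` along a presentation along which all maps extend. -/
theorem hdim_add_of_extend [Module.Finite A Y] [Module.Finite A N] (d : X →ₗ[A] Y)
    (p : Y →ₗ[A] Z) (hp : Surjective p) (hdp : Exact d p)
    (h : ∀ g : X →ₗ[A] N, ∃ w : Y →ₗ[A] N, g = w ∘ₗ d) :
    hdim (A := A) K Z N + hdim (A := A) K X N = hdim (A := A) K Y N := by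
  let _ := restrictedModule A K N
  have _ := restrictedModule_tower (A := A) K N
  have := finiteDimensional_hom (A := A) K (X := Y) (N := N)
  let D : (Y →ₗ[A] N) →ₗ[K] (X →ₗ[A] N) := LinearMap.lcomp K N d
  let Q : (Z →ₗ[A] N) →ₗ[K] (Y →ₗ[A] N) := LinearMap.lcomp K N p
  have hQ : Injective Q := fun f g h => LinearMap.ext fun x => by
    obtain ⟨y, rfl⟩ := hp x
    exact LinearMap.congr_fun h y
  have h1 : LinearMap.range Q = LinearMap.ker D := by
    ext f
    constructor
    · rintro ⟨g, rfl⟩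
      exact LinearMap.ext fun x => by
        change g (p (d x)) = 0
        rw [hdp.apply_apply_eq_zero, map_zero]
    · intro hf
      have hf' : ∀ x, f (d x) = 0 := fun x => LinearMap.congr_fun hf x
      have hle : LinearMap.ker p ≤ LinearMap.ker f := by
        intro y hy
        obtain ⟨x, rfl⟩ := (hdp y).mp hy
        exact hf' x
      refine ⟨(LinearMap.ker p).liftQ f hle ∘ₗ
        (p.quotKerEquivOfSurjective hp).symm.toLinearMap, LinearMap.ext fun y => ?_⟩
      have h2 : (p.quotKerEquivOfSurjective hp).symm (p y) = (LinearMap.ker p).mkQ y := by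
        rw [LinearEquiv.symm_apply_eq]; rfl
      change (LinearMap.ker p).liftQ f hle ((p.quotKerEquivOfSurjective hp).symm (p y)) = f y
      rw [h2]; rfl
  have h2 := LinearMap.finrank_range_add_finrank_ker D
  have h3 : LinearMap.range D = ⊤ := LinearMap.range_eq_top.mpr fun g =>
    let ⟨w, hw⟩ := h g; ⟨w, hw.symm⟩
  rw [h3, finrank_top, ← h1, LinearMap.finrank_range_of_inj hQ, add_comm] at h2
  exact h2

/-- Additivity of `hdim` in the second variable on projectives. -/
theorem hdim_add_quotient [Module.Projective A X] [Module.Finite A X] [Module.Finite A N]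
    (L : Submodule A N) :
    hdim (A := A) K X L + hdim (A := A) K X (N ⧸ L) = hdim (A := A) K X N := by
  let _ := restrictedModule A K N
  have _ := restrictedModule_tower (A := A) K N
  have := finiteDimensional_hom (A := A) K (X := X) (N := N)
  let _ := restrictedModule A K L
  have _ := restrictedModule_tower (A := A) K L
  let _ := restrictedModule A K (N ⧸ L)
  have _ := restrictedModule_tower (A := A) K (N ⧸ L)
  let Q : (X →ₗ[A] N) →ₗ[K] (X →ₗ[A] N ⧸ L) :=
    { toFun := fun f => L.mkQ ∘ₗ f
      map_add' := fun f g => LinearMap.comp_add _ _ _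
      map_smul' := fun k f => rfl }
  let I : (X →ₗ[A] L) →ₗ[K] (X →ₗ[A] N) :=
    { toFun := fun f => L.subtype ∘ₗ f
      map_add' := fun f g => LinearMap.comp_add _ _ _
      map_smul' := fun k f => rfl }
  have hI : Injective I := fun f g h => LinearMap.ext fun x =>
    Subtype.ext (LinearMap.congr_fun h x)
  have h1 : LinearMap.range I = LinearMap.ker Q := by
    ext f
    constructor
    · rintro ⟨g, rfl⟩
      exact LinearMap.ext fun x => (Submodule.Quotient.mk_eq_zero L).mpr (g x).2
    · intro hf
      exact ⟨f.codRestrict L fun x =>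
        (Submodule.Quotient.mk_eq_zero L).mp (LinearMap.congr_fun hf x), rfl⟩
  have h2 := LinearMap.finrank_range_add_finrank_ker Q
  have h3 : LinearMap.range Q = ⊤ := LinearMap.range_eq_top.mpr fun g =>
    Module.projective_lifting_property _ g L.mkQ_surjective
  rw [h3, finrank_top, ← h1, LinearMap.finrank_range_of_inj hI, add_comm] at h2
  exact h2

end HomDim

section Fac

variable {A : Type u} [Ring A] {M X Y : Type u} [AddCommGroup M] [Module A M]
  [AddCommGroup X] [Module A X] [AddCommGroup Y] [Module A Y]

theorem FacOf.of_surjective (h : FacOf A M X) (f : X →ₗ[A] Y) (hf : Surjective f) :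
    FacOf A M Y := by
  obtain ⟨n, p, hp⟩ := h
  exact ⟨n, f ∘ₗ p, hf.comp hp⟩

theorem FacOf.range (h : FacOf A M X) (f : X →ₗ[A] Y) : FacOf A M (LinearMap.range f) :=
  h.of_surjective f.rangeRestrict f.surjective_rangeRestrict

theorem FacOf.finite [Module.Finite A M] (h : FacOf A M X) : Module.Finite A X := by
  obtain ⟨n, p, hp⟩ := h
  exact Module.Finite.of_surjective p hp

theorem FacOf.iSup_range_eq_top (h : FacOf A M X) :
    ⨆ g : M →ₗ[A] X, LinearMap.range g = ⊤ := by
  obtain ⟨n, p, hp⟩ := h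
  rw [eq_top_iff]
  rintro x -
  obtain ⟨y, rfl⟩ := hp x
  rw [← Finset.univ_sum_single y, map_sum]
  exact Submodule.sum_mem _ fun i _ => Submodule.mem_iSup_of_mem
    (p ∘ₗ LinearMap.single A (fun _ => M) i) ⟨y i, rfl⟩

theorem facOf_of_iSup_range_eq_top [IsNoetherian A X]
    (h : ⨆ g : M →ₗ[A] X, LinearMap.range g = ⊤) : FacOf A M X := by
  have hc := (Submodule.fg_iff_compact (⊤ : Submodule A X)).mp (IsNoetherian.noetherian ⊤)
  obtain ⟨s, hs⟩ := CompleteLattice.IsCompactElement.exists_finset_of_le_iSup _ hc _ h.ge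
  refine ⟨s.card, ∑ k, (s.equivFin.symm k).1 ∘ₗ LinearMap.proj k, ?_⟩
  rw [← LinearMap.range_eq_top, eq_top_iff]
  refine hs.trans (iSup₂_le fun g hg => ?_)
  rintro _ ⟨m, rfl⟩
  refine ⟨Pi.single (s.equivFin ⟨g, hg⟩) m, ?_⟩
  rw [LinearMap.sum_apply, Finset.sum_eq_single (s.equivFin ⟨g, hg⟩)]
  · simp
  · intro b _ hb
    simp [hb]
  · simp

theorem facOf_iSup_range [IsNoetherian A Y] {ι : Type*} {X : ι → Type u}
    [∀ i, AddCommGroup (X i)] [∀ i, Module A (X i)] (hX : ∀ i, FacOf A M (X i))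
    (f : ∀ i, X i →ₗ[A] Y) : FacOf A M ↥(⨆ i, LinearMap.range (f i)) := by
  set L := ⨆ i, LinearMap.range (f i) with hL
  apply facOf_of_iSup_range_eq_top
  have hinj : Injective (Submodule.map L.subtype) :=
    Submodule.map_injective_of_injective L.injective_subtype
  apply hinj
  rw [Submodule.map_top, Submodule.range_subtype]
  refine le_antisymm (Submodule.map_subtype_le _ _) ?_
  conv_lhs => rw [hL]
  refine iSup_le fun i => ?_
  have hle : ∀ x, f i x ∈ L := fun x => Submodule.mem_iSup_of_mem i ⟨x, rfl⟩
  have h1 : LinearMap.range (f i) = (LinearMap.range ((f i).codRestrict L hle)).map L.subtype := by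
    rw [← LinearMap.range_comp, LinearMap.subtype_comp_codRestrict]
  rw [h1]
  refine Submodule.map_mono ?_
  rw [LinearMap.range_eq_map, ← (hX i).iSup_range_eq_top, Submodule.map_iSup]
  refine iSup_le fun g => ?_
  rw [← LinearMap.range_comp]
  exact le_iSup (fun g : M →ₗ[A] L => LinearMap.range g) _

theorem FacOf.pi {ι : Type} [Finite ι] {X : ι → Type u} [∀ i, AddCommGroup (X i)]
    [∀ i, Module A (X i)] [∀ i, IsNoetherian A (X i)] (hX : ∀ i, FacOf A M (X i)) :
    FacOf A M (∀ i, X i) := by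
  classical
  cases nonempty_fintype ι
  have h := facOf_iSup_range hX fun i => LinearMap.single A X i
  have htop : ⨆ i, LinearMap.range (LinearMap.single A X i) = ⊤ := by
    rw [eq_top_iff]
    rintro x -
    rw [← Finset.univ_sum_single x]
    exact Submodule.sum_mem _ fun i _ => Submodule.mem_iSup_of_mem i ⟨x i, rfl⟩
  rw [htop] at h
  exact h.of_surjective Submodule.topEquiv.toLinearMap Submodule.topEquiv.surjective

theorem FacOf.trans [IsNoetherian A X] (h : FacOf A M X) (h' : FacOf A X Y) : FacOf A M Y := by
  obtain ⟨n, p, hp⟩ := h'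
  exact (FacOf.pi fun _ : Fin n => h).of_surjective p hp

theorem FacOf.of_equiv_left {M' : Type u} [AddCommGroup M'] [Module A M'] (e : M ≃ₗ[A] M')
    (h : FacOf A M X) : FacOf A M' X := by
  obtain ⟨n, p, hp⟩ := h
  exact ⟨n, p ∘ₗ (LinearEquiv.piCongrRight fun _ => e.symm).toLinearMap,
    hp.comp (LinearEquiv.surjective _)⟩

theorem facOf_of_isDirectSummand (h : IsDirectSummand A X M) : FacOf A M X := by
  obtain ⟨i, p, h⟩ := h
  exact (facOf_self M).of_surjective p fun x => ⟨i x, LinearMap.congr_fun h x⟩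

theorem Ext1Vanishes.of_equiv_right {Y' : Type u} [AddCommGroup Y'] [Module A Y'] (e : Y ≃ₗ[A] Y')
    (h : Ext1Vanishes A X Y) : Ext1Vanishes A X Y' := by
  intro E _ _ i p hi hp hip
  refine h E (i ∘ₗ e.toLinearMap) p (hi.comp e.injective) hp fun y => (hip y).trans ?_
  exact ⟨fun ⟨z, hz⟩ => ⟨e.symm z, by simp [hz]⟩, fun ⟨z, hz⟩ => ⟨e z, hz⟩⟩

theorem Ext1Vanishes.of_isDirectSummand (hs : IsDirectSummand A X M) (h : Ext1Vanishes A M Y) :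
    Ext1Vanishes A X Y := by
  intro E _ _ i q hi hq hiq
  obtain ⟨j, p, hjp⟩ := hs
  have hk : LinearMap.range i = LinearMap.ker q := (LinearMap.exact_iff.mp hiq).symm
  obtain ⟨g, hg⟩ := (h.of_equiv_right ((LinearEquiv.ofInjective i hi).trans
    (LinearEquiv.ofEq _ _ hk))).lift q hq p
  exact ⟨g ∘ₗ j, by rw [← LinearMap.comp_assoc, hg, hjp]⟩

/-- `X` is Ext-projective in `Fac M`. -/
def ExtProjIn (A : Type u) [Ring A] (M X : Type u) [AddCommGroup M] [Module A M]
    [AddCommGroup X] [Module A X] : Prop :=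
  FacOf A M X ∧ ∀ (N : Type u) [AddCommGroup N] [Module A N], FacOf A M N → Ext1Vanishes A X N

theorem ExtProjIn.of_isDirectSummand {Z : Type u} [AddCommGroup Z] [Module A Z]
    (h : ExtProjIn A M X) (hs : IsDirectSummand A Z X) : ExtProjIn A M Z := by
  refine ⟨?_, fun N _ _ hN => (h.2 N hN).of_isDirectSummand hs⟩
  obtain ⟨j, p, hjp⟩ := hs
  exact h.1.of_surjective p fun x => ⟨j x, LinearMap.congr_fun hjp x⟩

theorem ERigid.extProjIn (h : ERigid A M) : ExtProjIn A M M := ⟨facOf_self M, h⟩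

end Fac

section Radical

variable {A : Type u} [Ring A]

theorem not_bijective_comp {X Y : Type u} [AddCommGroup X] [Module A X] [AddCommGroup Y]
    [Module A Y] [IsNoetherian A Y] (hX : IsIndec A X) (hY : IsIndec A Y)
    (f : Y →ₗ[A] X) (g : X →ₗ[A] Y) (hf : ¬ Bijective f) : ¬ Bijective (f ∘ₗ g) := by
  intro h
  apply hf
  have hsurj : Surjective f := Surjective.of_comp (g := g) h.2
  have := hX.1
  let e := LinearEquiv.ofBijective _ h
  obtain ⟨e'⟩ := equiv_of_isDirectSummand_indec hY (X := X) ⟨g, e.symm.toLinearMap ∘ₗ f,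
    LinearMap.ext fun x => e.symm_apply_apply x⟩
  refine ⟨?_, hsurj⟩
  have h1 : Injective (e'.toLinearMap ∘ₗ f) :=
    IsNoetherian.injective_of_surjective_endomorphism _ (e'.surjective.comp hsurj)
  exact Injective.of_comp (f := e'.toLinearMap) h1

/-- Some member of a finite family of indecomposable modules is not generated by the radical
maps from members of the family. -/
theorem exists_iSup_range_ne_top (K : Type u) [Field K] [Algebra K A] [FiniteDimensional K A]
    {ι : Type} [Fintype ι] [Nonempty ι] (X : ι → ModuleCat.{u} A) (hX : ∀ i, IsIndec A (X i))
    [∀ i, Module.Finite A (X i)] :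
    ∃ i, (⨆ s : Σ j, {f : X j →ₗ[A] X i // ¬ Bijective f}, LinearMap.range s.2.1) ≠ ⊤ := by
  classical
  have := IsArtinianRing.of_finite K A
  by_contra! htop
  let W := ∀ i, X i
  let _ := restrictedModule A K W
  have _ := restrictedModule_tower (A := A) K W
  have := finiteDimensional_hom (A := A) K (X := W) (N := W)
  have : IsArtinianRing (Module.End A W) := IsArtinianRing.of_finite K _
  let J : Ideal (Module.End A W) := (⊥ : Ideal (Module.End A W)).jacobson
  have hJ : ∀ i j (f : X j →ₗ[A] X i), ¬ Bijective f →
      ((LinearMap.single A (fun i => (X i : Type u)) i ∘ₗ f ∘ₗ LinearMap.proj j :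
        Module.End A W)) ∈ J := by
    intro i j f hf
    rw [Ideal.mem_jacobson_iff]
    intro y
    let a : X i →ₗ[A] W := y ∘ₗ LinearMap.single A (fun i => (X i : Type u)) i
    let b : W →ₗ[A] X i := f ∘ₗ LinearMap.proj j
    have hc : IsNilpotent (b ∘ₗ a : Module.End A (X i)) :=
      (nilpotent_or_bijective_of_isIndec (hX i) _).resolve_right
        (not_bijective_comp (hX i) (hX j) f (LinearMap.proj j ∘ₗ a) hf)
    obtain ⟨n, hn⟩ := hc
    have hpow : ∀ k : ℕ, ((a ∘ₗ b : Module.End A W)) ^ (k + 1) = a ∘ₗ ((b ∘ₗ a) ^ k) ∘ₗ b := by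
      intro k
      induction k with
      | zero => rw [zero_add, pow_one, pow_zero]; rfl
      | succ k ih => rw [pow_succ, ih, pow_succ (b ∘ₗ a)]; rfl
    have hnil : IsNilpotent (a ∘ₗ b : Module.End A W) :=
      ⟨n + 1, by rw [hpow, hn]; exact LinearMap.ext fun x => map_zero a⟩
    obtain ⟨v, hv⟩ := hnil.isUnit_one_add
    refine ⟨(v⁻¹ : (Module.End A W)ˣ), ?_⟩
    rw [Ideal.mem_bot, mul_assoc]
    have h1 : (y * (LinearMap.single A (fun i => (X i : Type u)) i ∘ₗ f ∘ₗ LinearMap.proj j :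
        Module.End A W)) = (a ∘ₗ b : Module.End A W) := rfl
    rw [h1, sub_eq_zero]
    have h2 : ((v⁻¹ : (Module.End A W)ˣ) : Module.End A W) * (1 + (a ∘ₗ b : Module.End A W)) = 1 := by
      rw [← hv, Units.inv_mul]
    rw [mul_add, mul_one, add_comm] at h2
    exact h2
  have hJtop : J • (⊤ : Submodule (Module.End A W) W) = ⊤ := by
    rw [eq_top_iff]
    rintro x -
    rw [← Finset.univ_sum_single x]
    refine Submodule.sum_mem _ fun i _ => ?_
    have hx : x i ∈ ⨆ s : Σ j, {f : X j →ₗ[A] X i // ¬ Bijective f}, LinearMap.range s.2.1 := by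
      rw [htop i]; trivial
    generalize x i = w at hx
    induction hx using Submodule.iSup_induction' with
    | mem s y hy =>
      obtain ⟨z, rfl⟩ := hy
      have h1 := Submodule.smul_mem_smul (hJ i s.1 s.2.1 s.2.2)
        (show (Pi.single s.1 z : W) ∈ (⊤ : Submodule (Module.End A W) W) from trivial)
      have h2 : ((LinearMap.single A (fun i => (X i : Type u)) i ∘ₗ s.2.1 ∘ₗ LinearMap.proj s.1 :
        Module.End A W)) • (Pi.single s.1 z : W) = Pi.single i (s.2.1 z) := by
        simp only [Module.End.smul_def, LinearMap.comp_apply, LinearMap.proj_apply,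
          Pi.single_eq_same]
        rfl
      rw [h2] at h1
      exact h1
    | zero => rw [Pi.single_zero]; exact Submodule.zero_mem _
    | add y z _ _ hy hz => rw [Pi.single_add]; exact Submodule.add_mem _ hy hz
  have hpow : ∀ n : ℕ, (J ^ n) • (⊤ : Submodule (Module.End A W) W) = ⊤ := by
    intro n
    induction n with
    | zero => rw [Submodule.pow_zero, Ideal.one_eq_top, Submodule.top_smul]
    | succ n ih => rw [Submodule.pow_succ, Submodule.mul_smul, hJtop, ih]
  obtain ⟨n, hn⟩ := IsArtinianRing.isNilpotent_jacobson_bot (R := Module.End A W)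
  have h0 := hpow n
  change (J ^ n) = 0 at hn
  rw [hn, Ideal.zero_eq_bot, Submodule.bot_smul] at h0
  have hnt : Nontrivial W := by
    have := fun i => (hX i).1
    let _ : Inhabited ι := Classical.inhabited_of_nonempty inferInstance
    exact Pi.nontrivial (f := fun i => (X i : Type u))
  exact bot_ne_top h0

end Radical

section ProjFam

variable {A : Type u} [Ring A]

theorem projective_of_isDirectSummand {X M : Type u} [AddCommGroup X] [Module A X]
    [AddCommGroup M] [Module A M] [Module.Projective A M] (h : IsDirectSummand A X M) :
    Module.Projective A X := by
  obtain ⟨i, p, h⟩ := h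
  exact Module.Projective.of_split i p h

/-- A proper submodule of an indecomposable finitely generated projective module is superfluous. -/
theorem IsIndec.isSuperfluous {P : Type u} [AddCommGroup P] [Module A P] [IsNoetherian A P]
    [IsArtinian A P] [Module.Projective A P] (h : IsIndec A P) {V : Submodule A P} (hV : V ≠ ⊤) :
    IsSuperfluous A V := by
  intro W hW
  have hs : Surjective (V.mkQ ∘ₗ W.subtype) := by
    rw [← LinearMap.range_eq_top, LinearMap.range_comp, Submodule.range_subtype,
      Submodule.map_mkQ_eq_top]
    exact hW
  obtain ⟨s, hs⟩ := Module.projective_lifting_property _ V.mkQ hs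
  rcases nilpotent_or_bijective_of_isIndec h (W.subtype ∘ₗ s : Module.End A P) with ⟨k, hk⟩ | hb
  · exfalso
    have key : ∀ k : ℕ, V.mkQ ∘ₗ ((W.subtype ∘ₗ s : Module.End A P) ^ k) = V.mkQ := by
      intro k
      induction k with
      | zero => rfl
      | succ k ih =>
        rw [pow_succ']
        change V.mkQ ∘ₗ (W.subtype ∘ₗ s) ∘ₗ _ = _
        rw [← LinearMap.comp_assoc, ← LinearMap.comp_assoc, hs, ih]
    apply hV
    have h1 := key k
    rw [hk] at h1
    rw [← V.ker_mkQ, ← h1]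
    exact LinearMap.ker_eq_top.mpr (LinearMap.ext fun x => map_zero V.mkQ)
  · rw [eq_top_iff]
    rintro x -
    obtain ⟨y, rfl⟩ := hb.2 x
    exact (s y).2

/-- A complete irredundant family of indecomposable finitely generated projective modules. -/
structure ProjFam {n : ℕ} (P : Fin n → ModuleCat.{u} A) : Prop where
  indec : IndecFam P
  finite : ∀ l, Module.Finite A (P l)
  projective : ∀ l, Module.Projective A (P l)
  complete : ∀ (Q : Type u) [AddCommGroup Q] [Module A Q], Module.Finite A Q →
    Module.Projective A Q → IsIndec A Q → ∃ l, Nonempty (Q ≃ₗ[A] P l)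

theorem Skel.projFam [IsArtinianRing A] {n : ℕ} {P : Fin n → ModuleCat.{u} A}
    (h : Skel (A := A) A P) : ProjFam P where
  indec := h.1
  finite l := finite_of_isDirectSummand (h.isDirectSummand l)
  projective l := projective_of_isDirectSummand (h.isDirectSummand l)
  complete Q _ _ hf hp hQ := by
    obtain ⟨k, f, hf, g, hg⟩ : ∃ (k : ℕ) (f : (Fin k → A) →ₗ[A] Q), Surjective f ∧
        ∃ g, f ∘ₗ g = LinearMap.id := by
      obtain ⟨k, f, hf⟩ := Module.Finite.exists_fin' A Q
      exact ⟨k, f, hf, Module.projective_lifting_property _ LinearMap.id hf⟩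
    obtain ⟨i, hi⟩ := isDirectSummand_of_pi hQ (fun _ : Fin k => ModuleCat.of A A)
      (LinearEquiv.refl A (Fin k → A)) g f hg
    exact h.exists_equiv hQ hi

theorem exists_projFam [IsArtinianRing A] :
    ∃ (n : ℕ) (P : Fin n → ModuleCat.{u} A), ProjFam P := by
  obtain ⟨n, P, h⟩ := exists_skel (A := A) A
  exact ⟨n, P, h.projFam⟩

theorem ProjFam.exists_equiv {m n : ℕ} {P : Fin m → ModuleCat.{u} A} {Q : Fin n → ModuleCat.{u} A}
    (hP : ProjFam P) (hQ : ProjFam Q) : ∃ e : Fin m ≃ Fin n, ∀ i, Nonempty (P i ≃ₗ[A] Q (e i)) :=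
  hP.indec.equiv_of_forall hQ.indec
    (fun i => hQ.complete _ (hP.finite i) (hP.projective i) (hP.indec.1 i))
    fun i => hP.complete _ (hQ.finite i) (hQ.projective i) (hQ.indec.1 i)

theorem ProjFam.numIndec [IsArtinianRing A] {n : ℕ} {P : Fin n → ModuleCat.{u} A}
    (h : ProjFam P) : NumIndec A A n := by
  obtain ⟨m, Q, hQ⟩ := exists_skel (A := A) A
  obtain ⟨e, -⟩ := h.exists_equiv hQ.projFam
  have : n = m := Fin.equiv_iff_eq.mp ⟨e⟩
  subst this
  exact numIndec_iff.mpr ⟨Q, hQ⟩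

/-- Every finitely generated projective module is a direct sum of members of the family. -/
theorem ProjFam.exists_pi [IsArtinianRing A] {n : ℕ} {P : Fin n → ModuleCat.{u} A}
    (h : ProjFam P) (Q : Type u) [AddCommGroup Q] [Module A Q] [Module.Finite A Q]
    [Module.Projective A Q] : ∃ (k : ℕ) (c : Fin k → Fin n), Nonempty (Q ≃ₗ[A] ∀ j, P (c j)) := by
  obtain ⟨k, X, hX, ⟨e⟩⟩ := exists_decomp (A := A) Q
  have hs : ∀ i, IsDirectSummand A (X i) Q := isDirectSummand_pi X e
  choose c hc using fun i => h.complete (X i) (finite_of_isDirectSummand (hs i))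
    (projective_of_isDirectSummand (hs i)) (hX i)
  exact ⟨k, c, ⟨e.trans (LinearEquiv.piCongrRight fun i => (hc i).some)⟩⟩

open Classical in
/-- The support of a module with respect to a family of modules. -/
noncomputable def supp {n : ℕ} (P : Fin n → ModuleCat.{u} A) (M : Type u) [AddCommGroup M]
    [Module A M] : Finset (Fin n) :=
  {l | ∃ f : P l →ₗ[A] M, f ≠ 0}

theorem mem_supp {n : ℕ} {P : Fin n → ModuleCat.{u} A} {M : Type u} [AddCommGroup M]
    [Module A M] {l : Fin n} : l ∈ supp P M ↔ ∃ f : P l →ₗ[A] M, f ≠ 0 := by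
  simp [supp]

theorem hom_eq_zero_of_facOf {X M N : Type u} [AddCommGroup X] [Module A X] [AddCommGroup M]
    [Module A M] [AddCommGroup N] [Module A N] [Module.Projective A X]
    (h : ∀ f : X →ₗ[A] M, f = 0) (hN : FacOf A M N) (f : X →ₗ[A] N) : f = 0 := by
  obtain ⟨n, p, hp⟩ := hN
  obtain ⟨g, rfl⟩ := Module.projective_lifting_property p f hp
  have : g = 0 := LinearMap.ext fun x => funext fun i =>
    LinearMap.congr_fun (h (LinearMap.proj i ∘ₗ g)) x
  rw [this, LinearMap.comp_zero]

end ProjFam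

section Count

variable {A : Type u} [Ring A] (K : Type u) [Field K] [Algebra K A]

/-- The finitely generated modules in `Fac M`. -/
def FacTest (A : Type u) [Ring A] (M : Type u) [AddCommGroup M] [Module A M] : Type (u + 1) :=
  {N : ModuleCat.{u} A // Module.Finite A N ∧ FacOf A M N}

/-- The function `N ↦ dim Hom(X, N)` on `Fac M`. -/
noncomputable def hvec (M X : Type u) [AddCommGroup M] [Module A M] [AddCommGroup X]
    [Module A X] : FacTest A M → ℚ := fun N => hdim (A := A) K X N.1

variable {M : Type u} [AddCommGroup M] [Module A M]

theorem sum_mul_hdim_eq_zero {ι : Type} [Fintype ι] {X : ι → ModuleCat.{u} A} {a : ι → ℚ}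
    (h : ∑ i, a i • hvec (A := A) K M (X i) = 0) (N : Type u) [AddCommGroup N] [Module A N]
    (hf : Module.Finite A N) (hN : FacOf A M N) :
    ∑ i, a i * (hdim (A := A) K (X i) N : ℚ) = 0 := by
  have h1 := congr_fun h (show FacTest A M from ⟨ModuleCat.of A N, hf, hN⟩)
  rwa [Finset.sum_apply] at h1

variable [FiniteDimensional K A]

theorem linearIndependent_hvec [Module.Finite A M] {ι : Type} [Fintype ι]
    {X : ι → ModuleCat.{u} A} (hX : IndecFam X) (hE : ∀ i, ExtProjIn A M (X i)) :
    LinearIndependent ℚ fun i => hvec (A := A) K M (X i) := by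
  classical
  have := IsArtinianRing.of_finite K A
  have hfin : ∀ i, Module.Finite A (X i) := fun i => (hE i).1.finite
  rw [Fintype.linearIndependent_iff]
  intro a ha
  by_contra! hne
  obtain ⟨i₀, hi₀⟩ := hne
  let I := {i // a i ≠ 0}
  have : Nonempty I := ⟨⟨i₀, hi₀⟩⟩
  obtain ⟨i, hi⟩ := exists_iSup_range_ne_top K (fun i : I => X i.1) fun i => hX.1 i.1
  set L := ⨆ s : Σ j : I, {f : X j.1 →ₗ[A] X i.1 // ¬ Bijective f}, LinearMap.range s.2.1 with hL
  have hLM : FacOf A M L := facOf_iSup_range (fun s : Σ j : I, {f : X j.1 →ₗ[A] X i.1 //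
    ¬ Bijective f} => (hE s.1.1).1) fun s => s.2.1
  have hNM : FacOf A M (X i.1 ⧸ L) := (hE i.1).1.of_surjective L.mkQ L.mkQ_surjective
  have h1 := sum_mul_hdim_eq_zero K ha (X i.1 ⧸ L) inferInstance hNM
  rw [Finset.sum_eq_single i.1] at h1
  · rw [mul_eq_zero, or_iff_right i.2] at h1
    have h2 : hdim (A := A) K (X i.1) (X i.1 ⧸ L) = 0 := by exact_mod_cast h1
    rw [hdim_eq_zero_iff] at h2
    apply hi
    rw [← L.ker_mkQ, h2 L.mkQ, LinearMap.ker_zero]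
  · intro j _ hji
    by_cases hj : a j = 0
    · rw [hj, zero_mul]
    have h2 : hdim (A := A) K (X j) (X i.1 ⧸ L) = 0 := by
      rw [hdim_eq_zero_iff]
      intro f
      have hext : Ext1Vanishes A (X j) (LinearMap.ker L.mkQ) := by
        rw [L.ker_mkQ]
        exact (hE j).2 L hLM
      obtain ⟨g, rfl⟩ := hext.lift L.mkQ L.mkQ_surjective f
      have hg : ¬ Bijective g := fun hb => hji (hX.2 _ _ ⟨LinearEquiv.ofBijective g hb⟩)
      ext x
      change L.mkQ (g x) = 0
      rw [← LinearMap.mem_ker, L.ker_mkQ]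
      exact Submodule.mem_iSup_of_mem (p := fun s : Σ j : I, {f : X j.1 →ₗ[A] X i.1 //
        ¬ Bijective f} => LinearMap.range s.2.1) ⟨⟨j, hj⟩, g, hg⟩ ⟨x, rfl⟩
    rw [h2, Nat.cast_zero, mul_zero]
  · simp

theorem hvec_pi {ι : Type} [Fintype ι] (X : ι → ModuleCat.{u} A) [∀ i, Module.Finite A (X i)]
    {U : Type u} [AddCommGroup U] [Module A U] (e : U ≃ₗ[A] ∀ i, X i) :
    hvec (A := A) K M U = ∑ i, hvec (A := A) K M (X i) := by
  ext N
  have := N.2.1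
  rw [Finset.sum_apply]
  change ((hdim (A := A) K U N.1 : ℕ) : ℚ) = ∑ i, ((hdim (A := A) K (X i) N.1 : ℕ) : ℚ)
  rw [hdim_congr K e, hdim_pi, Nat.cast_sum]

theorem hvec_add {X Y Z : Type u} [AddCommGroup X] [Module A X] [AddCommGroup Y] [Module A Y]
    [AddCommGroup Z] [Module A Z] [Module.Finite A Y] (d : X →ₗ[A] Y)
    (p : Y →ₗ[A] Z) (hp : Surjective p) (hdp : Exact d p)
    (h : ∀ (N : Type u) [AddCommGroup N] [Module A N], Module.Finite A N → FacOf A M N →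
      ∀ g : X →ₗ[A] N, ∃ w : Y →ₗ[A] N, g = w ∘ₗ d) :
    hvec (A := A) K M Z + hvec (A := A) K M X = hvec (A := A) K M Y := by
  ext N
  have := N.2.1
  have h1 := hdim_add_of_extend K d p hp hdp (h N.1 N.2.1 N.2.2)
  change ((hdim (A := A) K Z N.1 : ℕ) : ℚ) + (hdim (A := A) K X N.1 : ℕ) =
    (hdim (A := A) K Y N.1 : ℕ)
  exact_mod_cast h1

variable {n : ℕ} {P : Fin n → ModuleCat.{u} A}

theorem ProjFam.hvec_mem_span (hP : ProjFam P) (Q : Type u) [AddCommGroup Q] [Module A Q]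
    [Module.Finite A Q] [Module.Projective A Q] : hvec (A := A) K M Q ∈
      Submodule.span ℚ (Set.range fun l : supp P M => hvec (A := A) K M (P l.1)) := by
  have := IsArtinianRing.of_finite K A
  obtain ⟨k, c, ⟨e⟩⟩ := hP.exists_pi Q
  have := fun j => hP.finite (c j)
  rw [hvec_pi K (fun j => P (c j)) e]
  refine Submodule.sum_mem _ fun j _ => ?_
  by_cases hj : c j ∈ supp P M
  · exact Submodule.subset_span ⟨⟨c j, hj⟩, rfl⟩
  · convert Submodule.zero_mem _
    ext N
    have := N.2.1
    have := hP.projective (c j)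
    change ((hdim (A := A) K (P (c j)) N.1 : ℕ) : ℚ) = 0
    rw [Nat.cast_eq_zero, hdim_eq_zero_iff]
    rw [mem_supp] at hj
    push Not at hj
    exact hom_eq_zero_of_facOf hj N.2.2

theorem ExtProjIn.hvec_mem_span (hP : ProjFam P) [Module.Finite A M] {X : Type u}
    [AddCommGroup X] [Module A X] (hX : ExtProjIn A M X) : hvec (A := A) K M X ∈
      Submodule.span ℚ (Set.range fun l : supp P M => hvec (A := A) K M (P l.1)) := by
  have := IsArtinianRing.of_finite K A
  have := hX.1.finite
  obtain ⟨pr⟩ := exists_minPres (A := A) X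
  have := pr.fin₀
  have := pr.fin₁
  have := pr.proj₀
  have := pr.proj₁
  have h := hvec_add (M := M) K pr.d pr.p pr.surj pr.exact fun N _ _ _ hN g =>
    extend_of_ext1Vanishes pr.d pr.p pr.surj pr.exact pr.min₁
      (fun L => hX.2 _ (hN.of_surjective L.mkQ L.mkQ_surjective)) g
  rw [← eq_sub_iff_add_eq] at h
  rw [h]
  exact Submodule.sub_mem _ (hP.hvec_mem_span K pr.P₀) (hP.hvec_mem_span K pr.P₁)

theorem card_le_of_mem_span {ι κ V : Type*} [Fintype ι] [Fintype κ] [AddCommGroup V] [Module ℚ V]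
    {v : ι → V} (hv : LinearIndependent ℚ v) {w : κ → V}
    (h : ∀ i, v i ∈ Submodule.span ℚ (Set.range w)) : Fintype.card ι ≤ Fintype.card κ := by
  have h1 : LinearIndependent ℚ fun i => (⟨v i, h i⟩ : Submodule.span ℚ (Set.range w)) :=
    LinearIndependent.of_comp (Submodule.span ℚ (Set.range w)).subtype hv
  have : FiniteDimensional ℚ (Submodule.span ℚ (Set.range w)) :=
    FiniteDimensional.span_of_finite ℚ (Set.finite_range w)
  exact h1.fintype_card_le_finrank.trans (finrank_range_le_card w)

/-- The number of indecomposable Ext-projective modules in `Fac M` is bounded by the size of the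
support of `M`. -/
theorem ProjFam.card_le (K : Type u) [Field K] [Algebra K A]
    [FiniteDimensional K A] (hP : ProjFam P) [Module.Finite A M] {ι : Type} [Fintype ι]
    {X : ι → ModuleCat.{u} A} (hX : IndecFam X) (hE : ∀ i, ExtProjIn A M (X i)) :
    Fintype.card ι ≤ (supp P M).card := by
  have h := card_le_of_mem_span (linearIndependent_hvec K hX hE)
    fun i => (hE i).hvec_mem_span K hP
  rwa [Fintype.card_coe] at h

theorem ProjFam.exists_equiv_of_card (K : Type u) [Field K] [Algebra K A]
    [FiniteDimensional K A] (hP : ProjFam P) [Module.Finite A M] {m : ℕ}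
    {X : Fin m → ModuleCat.{u} A} (hX : IndecFam X) (hE : ∀ i, ExtProjIn A M (X i))
    (hm : (supp P M).card ≤ m) {Y : Type u} [AddCommGroup Y] [Module A Y] (hY : IsIndec A Y)
    (hYE : ExtProjIn A M Y) : ∃ i, Nonempty (Y ≃ₗ[A] X i) := by
  by_contra! hne
  let X' : Option (Fin m) → ModuleCat.{u} A := fun o => o.elim (ModuleCat.of A Y) X
  have h := hP.card_le K (X := X') (M := M) ⟨?_, ?_⟩ ?_
  · rw [Fintype.card_option, Fintype.card_fin] at h
    omega
  · rintro (_ | i)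
    exacts [hY, hX.1 i]
  · rintro (_ | i) (_ | j) ⟨e⟩
    · rfl
    · exact ((hne j).false e).elim
    · exact ((hne i).false e.symm).elim
    · rw [hX.2 i j ⟨e⟩]
  · rintro (_ | i)
    exacts [hYE, hE i]

theorem ProjFam.linearIndependent_hvec (hP : ProjFam P) [Module.Finite A M] :
    LinearIndependent ℚ fun l : supp P M => hvec (A := A) K M (P l.1) := by
  have := IsArtinianRing.of_finite K A
  have := hP.finite
  have := hP.projective
  rw [Fintype.linearIndependent_iff]
  intro a ha l
  obtain ⟨f, hf⟩ := mem_supp.mp l.2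
  have : Nontrivial (P l.1) := (hP.indec.1 l.1).1
  obtain ⟨U, hU, -⟩ := (eq_top_or_exists_le_coatom (⊥ : Submodule A (P l.1))).resolve_left
    bot_ne_top
  have hsup := (hP.indec.1 l.1).isSuperfluous hU.1
  let f' := (U.map f).mkQ ∘ₗ f
  have hf' : f' ≠ 0 := fun h => hf (superfluous_map_eq hsup f (by
    rw [LinearMap.range_le_iff_comap, eq_top_iff]
    intro x _
    have := LinearMap.congr_fun h x
    change (U.map f).mkQ (f x) = 0 at this
    rw [← LinearMap.mem_ker, Submodule.ker_mkQ] at this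
    exact this))
  have hker : LinearMap.ker f' = U := by
    refine ((hU.le_iff.mp ?_).resolve_left fun h => hf' (LinearMap.ker_eq_top.mp h))
    intro x hx
    change (U.map f).mkQ (f x) = 0
    rw [← LinearMap.mem_ker, Submodule.ker_mkQ]
    exact ⟨x, hx, rfl⟩
  set L := LinearMap.range f' with hL
  have hMq : FacOf A M (M ⧸ U.map f) := facOf_quotient _
  have h1 := sum_mul_hdim_eq_zero K ha (M ⧸ U.map f) inferInstance hMq
  have h2 := sum_mul_hdim_eq_zero K ha ((M ⧸ U.map f) ⧸ L) inferInstance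
    (hMq.of_surjective L.mkQ L.mkQ_surjective)
  have h3 : ∑ j : supp P M, a j * (hdim (A := A) K (P j.1) L : ℚ) = 0 := by
    rw [← sub_eq_zero.mpr (h1.trans h2.symm), ← Finset.sum_sub_distrib]
    refine Finset.sum_congr rfl fun j _ => ?_
    rw [← hdim_add_quotient K L]
    push_cast
    ring
  rw [Finset.sum_eq_single l] at h3
  · refine (mul_eq_zero.mp h3).resolve_right ?_
    rw [Nat.cast_eq_zero, hdim_eq_zero_iff]
    intro h
    apply hf'
    ext x
    exact congr_arg Subtype.val (LinearMap.congr_fun (h f'.rangeRestrict) x)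
  · intro j _ hj
    rw [mul_eq_zero, Nat.cast_eq_zero, hdim_eq_zero_iff]
    right
    intro g
    by_contra hg
    have hsg : Surjective g := by
      have hsimple : IsSimpleModule A L := by
        have e := f'.quotKerEquivRange
        have : IsSimpleModule A (P l.1 ⧸ LinearMap.ker f') := by
          rw [isSimpleModule_iff_isCoatom, hker]
          exact hU
        exact IsSimpleModule.congr e.symm
      exact LinearMap.surjective_of_ne_zero hg
    obtain ⟨v, hv⟩ := Module.projective_lifting_property g f'.rangeRestrict hsg
    have hgk : LinearMap.ker g ≠ ⊤ := fun h => hg (LinearMap.ker_eq_top.mp h)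
    have hv2 : LinearMap.range v = ⊤ := by
      apply (hP.indec.1 j.1).isSuperfluous hgk
      rw [eq_top_iff]
      intro x _
      obtain ⟨y, hy⟩ := f'.surjective_rangeRestrict (g x)
      rw [← hv] at hy
      rw [← sub_add_cancel x (v y)]
      refine Submodule.add_mem_sup ?_ ⟨y, rfl⟩
      rw [LinearMap.mem_ker, map_sub, ← hy]
      exact sub_self _
    obtain ⟨s, hs⟩ := Module.projective_lifting_property v LinearMap.id
      (LinearMap.range_eq_top.mp hv2)
    have := (hP.indec.1 j.1).1
    obtain ⟨e⟩ := equiv_of_isDirectSummand_indec (hP.indec.1 l.1) (X := P j.1) ⟨s, v, hs⟩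
    exact hj (Subtype.ext (hP.indec.2 _ _ ⟨e⟩))
  · simp

theorem ProjFam.card_supp_le (hP : ProjFam P) [Module.Finite A M] {ι : Type} [Fintype ι]
    {X : ι → ModuleCat.{u} A}
    (h : ∀ l ∈ supp P M, hvec (A := A) K M (P l) ∈
      Submodule.span ℚ (Set.range fun i => hvec (A := A) K M (X i))) :
    (supp P M).card ≤ Fintype.card ι := by
  have h := card_le_of_mem_span (hP.linearIndependent_hvec K (M := M)) fun l => h l.1 l.2
  rwa [Fintype.card_coe] at h

end Count

section Add

variable {A : Type u} [Ring A]

/-- `Z` is a finite direct sum of members of the family `X`. -/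
def IsSumOf {ι : Type} (X : ι → ModuleCat.{u} A) (Z : Type u) [AddCommGroup Z] [Module A Z] : Prop :=
  ∃ (k : ℕ) (c : Fin k → ι), Nonempty (Z ≃ₗ[A] ∀ j, X (c j))

theorem isSumOf_of_subsingleton {ι : Type} (X : ι → ModuleCat.{u} A) (Z : Type u) [AddCommGroup Z]
    [Module A Z] [Subsingleton Z] : IsSumOf X Z :=
  ⟨0, Fin.elim0, ⟨LinearEquiv.ofSubsingleton _ _⟩⟩

theorem isDirectSummand_of_inAdd {M Z : Type u} [AddCommGroup M] [Module A M] [AddCommGroup Z]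
    [Module A Z] [IsNoetherian A Z] [IsArtinian A Z] (hZ : IsIndec A Z) (h : InAdd A M Z) :
    IsDirectSummand A Z M := by
  obtain ⟨n, i, p, hip⟩ := h
  obtain ⟨_, h⟩ := isDirectSummand_of_pi hZ (fun _ : Fin n => ModuleCat.of A M)
    (LinearEquiv.refl A (Fin n → M)) i p hip
  exact h

theorem InAdd.of_isDirectSummand {M Z W : Type u} [AddCommGroup M] [Module A M] [AddCommGroup Z]
    [Module A Z] [AddCommGroup W] [Module A W] (h : InAdd A M Z) (hW : IsDirectSummand A W Z) :
    InAdd A M W := by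
  obtain ⟨n, i, p, hip⟩ := h
  exact ⟨n, IsDirectSummand.trans hW ⟨i, p, hip⟩⟩

theorem inAdd_of_isDirectSummand {M Z : Type u} [AddCommGroup M] [Module A M] [AddCommGroup Z]
    [Module A Z] (h : IsDirectSummand A Z M) : InAdd A M Z :=
  ⟨1, h.trans ⟨LinearMap.pi fun _ => LinearMap.id, LinearMap.proj 0, rfl⟩⟩

theorem inAdd_pi {M : Type u} [AddCommGroup M] [Module A M] {k : ℕ} (Z : Fin k → ModuleCat.{u} A)
    (h : ∀ i, IsDirectSummand A (Z i) M) : InAdd A M (∀ i, Z i) := by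
  choose i p hip using h
  exact ⟨k, LinearMap.pi fun j => i j ∘ₗ LinearMap.proj j,
    LinearMap.pi fun j => p j ∘ₗ LinearMap.proj j, LinearMap.ext fun x => funext fun j =>
      LinearMap.congr_fun (hip j) (x j)⟩

theorem IsSumOf.inAdd {M Z : Type u} [AddCommGroup M] [Module A M] [AddCommGroup Z]
    [Module A Z] {m : ℕ} {X : Fin m → ModuleCat.{u} A} (h : IsSumOf X Z)
    (hX : ∀ i, IsDirectSummand A (X i) M) : InAdd A M Z := by
  obtain ⟨k, c, ⟨e⟩⟩ := h
  exact (inAdd_pi (fun j => X (c j)) fun j => hX _).of_isDirectSummand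
    (isDirectSummand_of_equiv e)

theorem isSumOf_of_forall [IsArtinianRing A] {ι : Type} {X : ι → ModuleCat.{u} A} {Z : Type u}
    [AddCommGroup Z] [Module A Z] [Module.Finite A Z]
    (h : ∀ (Y : Type u) [AddCommGroup Y] [Module A Y], IsIndec A Y → IsDirectSummand A Y Z →
      ∃ i, Nonempty (Y ≃ₗ[A] X i)) : IsSumOf X Z := by
  obtain ⟨k, Y, hY, ⟨e⟩⟩ := exists_decomp (A := A) Z
  choose c hc using fun i => h (Y i) (hY i) (isDirectSummand_pi Y e i)
  exact ⟨k, c, ⟨e.trans (LinearEquiv.piCongrRight fun i => (hc i).some)⟩⟩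

theorem Skel.isSumOf [IsArtinianRing A] {M Z : Type u} [AddCommGroup M] [Module A M]
    [AddCommGroup Z] [Module A Z] {k : ℕ} {X : Fin k → ModuleCat.{u} A} (h : Skel M X)
    [Module.Finite A Z] (hZ : InAdd A M Z) : IsSumOf X Z := by
  refine isSumOf_of_forall fun Y _ _ hY hs => ?_
  have := finite_of_isDirectSummand hs
  exact h.exists_equiv hY (isDirectSummand_of_inAdd hY (hZ.of_isDirectSummand hs))

theorem inAdd_ring (Q : Type u) [AddCommGroup Q] [Module A Q] [Module.Finite A Q]
    [Module.Projective A Q] : InAdd A A Q := by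
  obtain ⟨k, f, hf⟩ := Module.Finite.exists_fin' A Q
  obtain ⟨g, hg⟩ := Module.projective_lifting_property f LinearMap.id hf
  exact ⟨k, g, f, hg⟩

variable (K : Type u) [Field K] [Algebra K A] [FiniteDimensional K A]

theorem IsSumOf.hvec_mem_span {M Z : Type u} [AddCommGroup M] [Module A M] [AddCommGroup Z]
    [Module A Z] {ι : Type} [Fintype ι] {X : ι → ModuleCat.{u} A} (hX : ∀ i, Module.Finite A (X i))
    (h : IsSumOf X Z) : hvec (A := A) K M Z ∈
      Submodule.span ℚ (Set.range fun i => hvec (A := A) K M (X i)) := by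
  obtain ⟨k, c, ⟨e⟩⟩ := h
  rw [hvec_pi K (fun j => X (c j)) e]
  exact Submodule.sum_mem _ fun j _ => Submodule.subset_span ⟨c j, rfl⟩

theorem hvec_mem_span_of_exact {M Q U V : Type u} [AddCommGroup M] [Module A M] [AddCommGroup Q]
    [Module A Q] [AddCommGroup U] [Module A U] [Module.Finite A U] [AddCommGroup V] [Module A V]
    {ι : Type} [Fintype ι] {X : ι → ModuleCat.{u} A} (hX : ∀ i, Module.Finite A (X i))
    (hU : IsSumOf X U) (hV : IsSumOf X V) (d : Q →ₗ[A] U) (p : U →ₗ[A] V) (hp : Surjective p)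
    (hdp : Exact d p)
    (h : ∀ (N : Type u) [AddCommGroup N] [Module A N], Module.Finite A N → FacOf A M N →
      ∀ g : Q →ₗ[A] N, ∃ w : U →ₗ[A] N, g = w ∘ₗ d) :
    hvec (A := A) K M Q ∈ Submodule.span ℚ (Set.range fun i => hvec (A := A) K M (X i)) := by
  rw [eq_sub_of_add_eq' (hvec_add (M := M) K d p hp hdp h)]
  exact Submodule.sub_mem _ (hU.hvec_mem_span K hX) (hV.hvec_mem_span K hX)

end Add

section CF

variable {A : Type u} [Ring A]

/-- A basic finitely generated τ-rigid module with as many indecomposable summands as possible,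
given its support. -/
def CF (A : Type u) [Ring A] (M : Type u) [AddCommGroup M] [Module A M] : Prop :=
  Module.Finite A M ∧ ERigid A M ∧ ∃ (m n : ℕ) (X : Fin m → ModuleCat.{u} A)
    (P : Fin n → ModuleCat.{u} A), IndecFam X ∧ Nonempty (M ≃ₗ[A] ∀ i, X i) ∧ ProjFam P ∧
    (supp P M).card ≤ m

theorem supp_subset_of_facOf {n : ℕ} {P : Fin n → ModuleCat.{u} A} (hP : ProjFam P)
    {M N : Type u} [AddCommGroup M] [Module A M] [AddCommGroup N] [Module A N]
    (h : FacOf A M N) : supp P N ⊆ supp P M := by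
  intro l hl
  rw [mem_supp] at hl ⊢
  obtain ⟨f, hf⟩ := hl
  by_contra! hne
  have := hP.projective l
  exact hf (hom_eq_zero_of_facOf hne h f)

end CF

section Semi

variable {A S : Type u} [Ring A] [Ring S]

/-- An additive equivalence is linear along a ring homomorphism. -/
def IsSemi (φ : A →+* S) {M M' : Type u} [AddCommGroup M] [Module A M] [AddCommGroup M']
    [Module S M'] (e : M ≃+ M') : Prop := ∀ r m, e (r • m) = φ r • e m

variable {φ : A →+* S} {M M' N N' : Type u} [AddCommGroup M] [Module A M] [AddCommGroup M']
  [Module S M'] [AddCommGroup N] [Module A N] [AddCommGroup N'] [Module S N']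

theorem IsSemi.symm_smul {e : M ≃+ M'} (h : IsSemi φ e) (r : A) (m : M') :
    e.symm (φ r • m) = r • e.symm m := by
  rw [AddEquiv.symm_apply_eq, h, AddEquiv.apply_symm_apply]

/-- Transport of linear maps along semilinear equivalences. -/
def IsSemi.hom (hφ : Surjective φ) {e : M ≃+ M'} (he : IsSemi φ e) {g : N ≃+ N'}
    (hg : IsSemi φ g) (f : M →ₗ[A] N) : M' →ₗ[S] N' where
  toFun x := g (f (e.symm x))
  map_add' x y := by simp
  map_smul' s x := by
    obtain ⟨r, rfl⟩ := hφ s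
    rw [he.symm_smul, map_smul, hg, RingHom.id_apply]

/-- Transport of linear maps along semilinear equivalences. -/
def IsSemi.homSymm {e : M ≃+ M'} (he : IsSemi φ e) {g : N ≃+ N'}
    (hg : IsSemi φ g) (f : M' →ₗ[S] N') : M →ₗ[A] N where
  toFun x := g.symm (f (e x))
  map_add' x y := by simp
  map_smul' r x := by rw [he, map_smul, hg.symm_smul, RingHom.id_apply]

theorem IsSemi.nonempty_equiv_iff (hφ : Surjective φ) {e : M ≃+ M'} (he : IsSemi φ e)
    {g : N ≃+ N'} (hg : IsSemi φ g) : Nonempty (M ≃ₗ[A] N) ↔ Nonempty (M' ≃ₗ[S] N') := by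
  constructor
  · rintro ⟨f⟩
    exact ⟨LinearEquiv.ofBijective (he.hom hφ hg f.toLinearMap)
      (g.bijective.comp (f.bijective.comp e.symm.bijective))⟩
  · rintro ⟨f⟩
    exact ⟨LinearEquiv.ofBijective (he.homSymm hg f.toLinearMap)
      (g.symm.bijective.comp (f.bijective.comp e.bijective))⟩

/-- The isomorphism of submodule lattices induced by a semilinear equivalence. -/
def IsSemi.subIso (hφ : Surjective φ) {e : M ≃+ M'} (he : IsSemi φ e) :
    Submodule A M ≃o Submodule S M' where
  toFun L := { L.toAddSubgroup.map e.toAddMonoidHom with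
    smul_mem' := by
      rintro s _ ⟨x, hx, rfl⟩
      obtain ⟨r, rfl⟩ := hφ s
      exact ⟨r • x, L.smul_mem r hx, he r x⟩ }
  invFun L := { L.toAddSubgroup.comap e.toAddMonoidHom with
    smul_mem' := by
      intro r x hx
      change e (r • x) ∈ L
      rw [he]
      exact L.smul_mem _ hx }
  left_inv L := by
    ext x
    change (∃ y ∈ L, e y = e x) ↔ x ∈ L
    simp
  right_inv L := by
    ext x
    change (∃ y, e y ∈ L ∧ e y = x) ↔ x ∈ L
    exact ⟨fun ⟨y, hy, h⟩ => h ▸ hy, fun h => ⟨e.symm x, by simpa using h, by simp⟩⟩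
  map_rel_iff' := by
    intro L L'
    constructor
    · intro h x hx
      obtain ⟨y, hy, hxy⟩ := h (show e x ∈ _ from ⟨x, hx, rfl⟩)
      rwa [← e.injective hxy]
    · rintro h _ ⟨x, hx, rfl⟩
      exact ⟨x, h hx, rfl⟩

theorem IsSemi.mem_subIso (hφ : Surjective φ) {e : M ≃+ M'} (he : IsSemi φ e)
    {L : Submodule A M} {x : M} : e x ∈ he.subIso hφ L ↔ x ∈ L := by
  change (∃ y ∈ L, e y = e x) ↔ x ∈ L
  simp

/-- The restriction of a semilinear equivalence to a submodule. -/
def IsSemi.subEquiv (hφ : Surjective φ) {e : M ≃+ M'} (he : IsSemi φ e)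
    (L : Submodule A M) : L ≃+ he.subIso hφ L where
  toFun x := ⟨e x, (he.mem_subIso hφ).mpr x.2⟩
  invFun x := ⟨e.symm x, by rw [← he.mem_subIso hφ, AddEquiv.apply_symm_apply]; exact x.2⟩
  left_inv x := by simp
  right_inv x := by simp
  map_add' x y := by ext; simp

theorem IsSemi.isSemi_subEquiv (hφ : Surjective φ) {e : M ≃+ M'} (he : IsSemi φ e)
    (L : Submodule A M) : IsSemi φ (he.subEquiv hφ L) := fun r x => Subtype.ext (he r x)

theorem IsSemi.isIndec_iff (hφ : Surjective φ) {e : M ≃+ M'} (he : IsSemi φ e) :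
    IsIndec A M ↔ IsIndec S M' := by
  refine and_congr e.toEquiv.nontrivial_congr ⟨fun h L L' hL => ?_, fun h L L' hL => ?_⟩
  · have := h ((he.subIso hφ).symm L) ((he.subIso hφ).symm L')
      ((he.subIso hφ).symm.isCompl_iff.mp hL)
    rwa [map_eq_bot_iff, map_eq_bot_iff] at this
  · have := h (he.subIso hφ L) (he.subIso hφ L') ((he.subIso hφ).isCompl_iff.mp hL)
    rwa [map_eq_bot_iff, map_eq_bot_iff] at this

theorem IsSemi.isInternal_iff (hφ : Surjective φ) {e : M ≃+ M'} (he : IsSemi φ e) {n : ℕ}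
    (L : Fin n → Submodule A M) :
    DirectSum.IsInternal L ↔ DirectSum.IsInternal fun i => he.subIso hφ (L i) := by
  rw [DirectSum.isInternal_submodule_iff_iSupIndep_and_iSup_eq_top,
    DirectSum.isInternal_submodule_iff_iSupIndep_and_iSup_eq_top, ← map_iSup, map_eq_top_iff]
  exact and_congr_left' (iSupIndep_map_orderIso_iff (he.subIso hφ)).symm

theorem IsSemi.numIndec (hφ : Surjective φ) {e : M ≃+ M'} (he : IsSemi φ e) {k : ℕ}
    (h : NumIndec A M k) : NumIndec S M' k := by
  obtain ⟨n, L, hL, hI, c, hc, hcL⟩ := h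
  exact ⟨n, fun i => he.subIso hφ (L i), (he.isInternal_iff hφ L).mp hL,
    fun i => ((he.isSemi_subEquiv hφ (L i)).isIndec_iff hφ).mp (hI i), c, hc, fun i j =>
    (hcL i j).trans ((he.isSemi_subEquiv hφ (L i)).nonempty_equiv_iff hφ
      (he.isSemi_subEquiv hφ (L j)))⟩

theorem IsSemi.isBasic (hφ : Surjective φ) {e : M ≃+ M'} (he : IsSemi φ e)
    (h : IsBasic A M) : IsBasic S M' := by
  obtain ⟨n, L, hL, hI, hne⟩ := h
  exact ⟨n, fun i => he.subIso hφ (L i), (he.isInternal_iff hφ L).mp hL,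
    fun i => ((he.isSemi_subEquiv hφ (L i)).isIndec_iff hφ).mp (hI i), fun i j hij h =>
    hne i j hij (((he.isSemi_subEquiv hφ (L i)).nonempty_equiv_iff hφ
      (he.isSemi_subEquiv hφ (L j))).mpr h)⟩

theorem IsSemi.numIndec_symm (hφ : Surjective φ) {e : M ≃+ M'} (he : IsSemi φ e) {k : ℕ}
    (h : NumIndec S M' k) : NumIndec A M k := by
  obtain ⟨n, L, hL, hI, c, hc, hcL⟩ := h
  obtain ⟨L, rfl⟩ : ∃ L' : Fin n → Submodule A M, L = fun i => he.subIso hφ (L' i) :=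
    ⟨fun i => (he.subIso hφ).symm (L i), by simp⟩
  exact ⟨n, L, (he.isInternal_iff hφ L).mpr hL,
    fun i => ((he.isSemi_subEquiv hφ (L i)).isIndec_iff hφ).mpr (hI i), c, hc, fun i j =>
    (hcL i j).trans ((he.isSemi_subEquiv hφ (L i)).nonempty_equiv_iff hφ
      (he.isSemi_subEquiv hφ (L j))).symm⟩

theorem IsSemi.pi {ι : Type*} {X X' : ι → Type u} [∀ i, AddCommGroup (X i)]
    [∀ i, AddCommGroup (X' i)] [∀ i, Module A (X i)] [∀ i, Module S (X' i)] {e : ∀ i, X i ≃+ X' i}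
    (h : ∀ i, IsSemi φ (e i)) (r : A) (x : ∀ i, X i) :
    AddEquiv.piCongrRight e (r • x) = φ r • AddEquiv.piCongrRight e x :=
  funext fun i => h i r (x i)

theorem IsSemi.facOf_iff (hφ : Surjective φ) {e : M ≃+ M'} (he : IsSemi φ e)
    {g : N ≃+ N'} (hg : IsSemi φ g) : FacOf A M N ↔ FacOf S M' N' := by
  refine exists_congr fun n => ?_
  have hp : IsSemi φ (AddEquiv.piCongrRight fun _ : Fin n => e) := IsSemi.pi fun _ => he
  exact ⟨fun ⟨p, h⟩ => ⟨hp.hom hφ hg p, g.surjective.comp (h.comp (AddEquiv.surjective _))⟩,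
    fun ⟨p, h⟩ => ⟨hp.homSymm hg p, g.symm.surjective.comp (h.comp (AddEquiv.surjective _))⟩⟩

theorem IsSemi.finite {e : M ≃+ M'} (he : IsSemi φ e) [Module.Finite A M] :
    Module.Finite S M' := by
  let _ : Module A M' := Module.compHom M' φ
  let f : M →ₗ[A] M' := { e.toAddMonoidHom with map_smul' := he }
  have h1 : Module.Finite A M' := Module.Finite.of_surjective f e.surjective
  obtain ⟨s, hs⟩ := h1
  refine ⟨s, ?_⟩
  rw [eq_top_iff]
  rintro x -
  have hx : x ∈ Submodule.span A (s : Set M') := hs ▸ Submodule.mem_top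
  induction hx using Submodule.span_induction with
  | mem x hx => exact Submodule.subset_span hx
  | zero => exact Submodule.zero_mem _
  | add x y _ _ hx hy => exact Submodule.add_mem _ hx hy
  | smul r x _ hx => exact Submodule.smul_mem _ (φ r) hx

theorem IsSemi.finite_symm {e : M ≃+ M'} (hφ : Surjective φ) (he : IsSemi φ e)
    [Module.Finite S M'] : Module.Finite A M := by
  obtain ⟨n, p, hp⟩ := Module.Finite.exists_fin' S M'
  let _ : Module A S := Module.compHom S φ
  let f : (Fin n → A) →ₗ[A] M := 
    { toFun := fun x => e.symm (p fun i => φ (x i))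
      map_add' := fun x y => by
        rw [← map_add, ← map_add]
        congr 2
        ext i
        exact map_add φ _ _
      map_smul' := fun r x => by
        rw [RingHom.id_apply, ← he.symm_smul, ← map_smul]
        congr 2
        ext i
        exact map_mul φ _ _ }
  refine Module.Finite.of_surjective f fun m => ?_
  obtain ⟨y, hy⟩ := hp (e m)
  choose x hx using fun i => hφ (y i)
  refine ⟨x, ?_⟩
  change e.symm (p fun i => φ (x i)) = m
  rw [AddEquiv.symm_apply_eq, ← hy]
  congr 1
  exact funext hx

end Semi

section Quotient

variable {A S : Type u} [Ring A] [Ring S] {φ : A →+* S} {M M' : Type u} [AddCommGroup M]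
  [Module A M] [AddCommGroup M'] [Module S M']

theorem IsSemi.eRigid (hφ : Surjective φ) {e : M ≃+ M'} (he : IsSemi φ e) (h : ERigid A M) :
    ERigid S M' := by
  intro N _ _ hN E _ _ i p hi hp hip
  let _ : Module A N := Module.compHom N φ
  let _ : Module A E := Module.compHom E φ
  have hN' : IsSemi φ (AddEquiv.refl N) := fun _ _ => rfl
  have hE' : IsSemi φ (AddEquiv.refl E) := fun _ _ => rfl
  obtain ⟨s, hs⟩ := h N ((he.facOf_iff hφ hN').mpr hN) E (hN'.homSymm hE' i) (hE'.homSymm he p)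
    hi (e.symm.surjective.comp hp) (fun x => (e.symm.map_eq_zero_iff (x := p x)).trans (hip x))
  refine ⟨he.hom hφ hE' s, LinearMap.ext fun x => ?_⟩
  have := LinearMap.congr_fun hs (e.symm x)
  exact e.symm.injective this

theorem IsQuotientByIdem.exists_module {a : A} (h : IsQuotientByIdem A a S φ)
    (hM : ∀ m : M, a • m = 0) : ∃ _ : Module S M, ∀ (r : A) (m : M), φ r • m = r • m := by
  obtain ⟨χ, hχ⟩ := h.2.2 (AddMonoid.End M) inferInstance (Module.toAddMonoidEnd A M)
    (AddMonoidHom.ext hM)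
  refine ⟨Module.compHom M χ, fun r m => ?_⟩
  exact DFunLike.congr_fun (RingHom.congr_fun hχ r) m

theorem smul_eq_zero_of_exact {a : A} (ha : IsIdempotentElem a) {N E : Type u} [AddCommGroup N]
    [Module A N] [AddCommGroup E] [Module A E] (hM : ∀ m : M, a • m = 0) (hN : ∀ m : N, a • m = 0)
    (i : N →ₗ[A] E) (p : E →ₗ[A] M) (hip : Exact i p) (x : E) : a • x = 0 := by
  obtain ⟨y, hy⟩ := (hip (a • x)).mp (by rw [map_smul, hM])
  rw [← ha.eq, mul_smul, ← hy, ← map_smul, hN, map_zero]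

theorem FacOf.smul_eq_zero {a : A} {N : Type u} [AddCommGroup N] [Module A N] (h : FacOf A M N)
    (hM : ∀ m : M, a • m = 0) (x : N) : a • x = 0 := by
  obtain ⟨n, p, hp⟩ := h
  obtain ⟨y, rfl⟩ := hp x
  rw [← map_smul, show a • y = 0 from funext fun i => hM _, map_zero]

theorem IsSemi.smul_eq_zero {a : A} (ha : φ a = 0) {e : M ≃+ M'} (he : IsSemi φ e) (m : M) :
    a • m = 0 := e.injective (by rw [he, ha, zero_smul, map_zero])

theorem IsSemi.eRigid_symm {a : A} (ha : IsIdempotentElem a) (hφ : IsQuotientByIdem A a S φ)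
    {e : M ≃+ M'} (he : IsSemi φ e) (h : ERigid S M') : ERigid A M := by
  intro N _ _ hN E _ _ i p hi hp hip
  have hM0 := he.smul_eq_zero hφ.2.1
  have hN0 := hN.smul_eq_zero hM0
  have hE0 := smul_eq_zero_of_exact ha hM0 hN0 i p hip
  obtain ⟨_, hN1⟩ := hφ.exists_module hN0
  obtain ⟨_, hE1⟩ := hφ.exists_module hE0
  have hN' : IsSemi φ (AddEquiv.refl N) := fun r m => (hN1 r m).symm
  have hE' : IsSemi φ (AddEquiv.refl E) := fun r m => (hE1 r m).symm
  obtain ⟨s, hs⟩ := h N ((he.facOf_iff hφ.1 hN').mp hN) E (hN'.hom hφ.1 hE' i) (hE'.hom hφ.1 he p)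
    hi (e.surjective.comp hp) (fun x => (e.map_eq_zero_iff (x := p x)).trans (hip x))
  refine ⟨he.homSymm hE' s, LinearMap.ext fun x => ?_⟩
  exact e.injective (LinearMap.congr_fun hs (e x))

theorem finiteDimensional_of_surjective (K : Type u) [Field K] [Algebra K A] [Algebra K S]
    [FiniteDimensional K A] (hφ : Surjective φ)
    (hK : ∀ k : K, φ (algebraMap K A k) = algebraMap K S k) : FiniteDimensional K S :=
  Module.Finite.of_surjective ({ φ with commutes' := hK } : A →ₐ[K] S).toLinearMap hφ

theorem exists_quotient (K : Type u) [Field K] [Algebra K A] (a : A) :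
    ∃ (S : Type u) (_ : Ring S) (_ : Algebra K S) (φ : A →+* S),
      (∀ k : K, φ (algebraMap K A k) = algebraMap K S k) ∧ IsQuotientByIdem A a S φ := by
  let c : RingCon A := (TwoSidedIdeal.span {a}).ringCon
  refine ⟨c.Quotient, inferInstance, inferInstance, c.mk', fun k => rfl, c.mk'_surjective, ?_,
    fun S' _ ψ hψ => ?_⟩
  · have h : a ∈ TwoSidedIdeal.span {a} := TwoSidedIdeal.subset_span rfl
    rw [TwoSidedIdeal.mem_iff] at h
    exact (RingCon.eq c).mpr h
  · have h : TwoSidedIdeal.span {a} ≤ TwoSidedIdeal.ker ψ :=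
      TwoSidedIdeal.span_le.mpr (by simpa using (TwoSidedIdeal.mem_ker ψ).mpr hψ)
    have hc : c ≤ RingCon.ker ψ := fun {x y} hxy => by
      have := (TwoSidedIdeal.mem_ker ψ).mp (h ((TwoSidedIdeal.rel_iff _ _ _).mp hxy))
      rwa [map_sub, sub_eq_zero] at this
    exact ⟨c.lift ψ hc, RingHom.ext fun x => rfl⟩

/-- The support of the quotient algebra is at most its number of indecomposable summands. -/
theorem card_supp_quotient_le (K : Type u) [Field K] [Algebra K A] [FiniteDimensional K A] {n : ℕ}
    {P : Fin n → ModuleCat.{u} A} (hP : ProjFam P) [Module A S]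
    (hS : IsSemi φ (AddEquiv.refl S)) (hφ : Surjective φ) {l : ℕ} (hl : NumIndec A S l) :
    (supp P S).card ≤ l := by
  have := IsArtinianRing.of_finite K A
  have hfS : Module.Finite A S := hS.finite_symm hφ
  have hsm : ∀ (r : A) (s : S), r • s = φ r * s := hS
  obtain ⟨X, hX⟩ := numIndec_iff.mp hl
  have hXf i : Module.Finite A (X i) := finite_of_isDirectSummand (hX.isDirectSummand i)
  refine (hP.card_supp_le (X := X) K fun j _ => ?_).trans (Fintype.card_fin l).le
  have := hP.finite j; have := hP.projective j
  obtain ⟨i, p, hip⟩ := isDirectSummand_of_inAdd (hP.indec.1 j) (inAdd_ring (A := A) (P j))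
  have hpi x : p (i x) = x := LinearMap.congr_fun hip x
  have hpa (a : A) : p a = a • p 1 := by rw [← map_smul, smul_eq_mul, mul_one]
  have hia x : i x = i x * i (p 1) := by
    rw [← smul_eq_mul, ← map_smul, ← map_smul, smul_eq_mul, mul_one, hpi]
  let R : S →ₗ[A] S :=
    { toFun := fun s => s * φ (i (p 1))
      map_add' := fun x y => add_mul _ _ _
      map_smul' := fun r x => by rw [hsm, hsm, RingHom.id_apply, mul_assoc] }
  have hR (s : S) : R s = s * φ (i (p 1)) := rfl
  let q : P j →ₗ[A] LinearMap.range R :=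
    { toFun := fun x => ⟨φ (i x), φ (i x), by rw [hR, ← map_mul, ← hia]⟩
      map_add' := fun x y => Subtype.ext (by simp)
      map_smul' := fun r x => Subtype.ext (by simp [hsm]) }
  have hq : Surjective q := by
    rintro ⟨_, s, rfl⟩
    obtain ⟨r, rfl⟩ := hφ s
    refine ⟨r • p 1, Subtype.ext ?_⟩
    change φ (i (r • p 1)) = φ r * φ (i (p 1))
    rw [map_smul, smul_eq_mul, map_mul]
  have hY : IsSumOf X (LinearMap.range R) := by
    refine hX.isSumOf (inAdd_of_isDirectSummand ⟨(LinearMap.range R).subtype, R.rangeRestrict,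
      LinearMap.ext ?_⟩)
    rintro ⟨_, s, rfl⟩
    refine Subtype.ext ?_
    change R (R s) = R s
    rw [hR, hR, mul_assoc, ← map_mul, ← hia]
  refine hvec_mem_span_of_exact K hXf hY (isSumOf_of_subsingleton X PUnit.{u + 1}) q 0
    (fun _ => ⟨0, rfl⟩) (fun y => ⟨fun _ => hq y, fun _ => rfl⟩) ?_
  rintro N _ _ - ⟨k, f, hf⟩ g
  obtain ⟨v, hv⟩ := hf (g (p 1))
  refine ⟨{ toFun := fun y => f fun t => (y : S) * v t
            map_add' := fun y z => by
              rw [← map_add]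
              congr 1
              ext t
              exact add_mul _ _ _
            map_smul' := fun r y => by
              rw [RingHom.id_apply, ← map_smul]
              congr 1
              ext t
              simp [hsm, mul_assoc] }, LinearMap.ext fun x => ?_⟩
  change g x = f fun t => φ (i x) * v t
  have h1 : (fun t => φ (i x) * v t) = i x • v := funext fun t => (hsm _ _).symm
  rw [h1, map_smul, hv, ← map_smul, ← hpa, hpi]

theorem cf_of_isSuppTauTilting (K : Type u) [Field K] [Algebra K A] [FiniteDimensional K A]
    [Module.Finite A M] (hb : IsBasic A M) (h : IsSuppTauTilting A K M) : CF A M := by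
  have := IsArtinianRing.of_finite K A
  obtain ⟨a, ha, S, _, _, φ, hK, hq, _, hM, hr, m, l, hm, hl, rfl⟩ := h
  have := finiteDimensional_of_surjective K hq.1 hK
  have he : IsSemi φ (AddEquiv.refl M) := fun r m => (hM r m).symm
  have : Module.Finite S M := he.finite
  obtain ⟨k, X, hX, ⟨e⟩⟩ := isBasic_iff.mp hb
  obtain ⟨n, P, hP⟩ := exists_projFam (A := A)
  refine ⟨inferInstance, he.eRigid_symm ha hq ((tauRigid_iff_eRigid K).mp hr), k, n, X, P, hX, ⟨e⟩,
    hP, ?_⟩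
  let _ : Module A S := Module.compHom S φ
  have hS : IsSemi φ (AddEquiv.refl S) := fun _ _ => rfl
  have hk : k = m := NumIndec.unique (A := A) (M := M) (numIndec_iff.mpr ⟨X, hX.skel e⟩)
    (he.numIndec_symm hq.1 hm)
  rw [hk]
  refine le_trans (Finset.card_le_card (supp_subset_of_facOf hP ?_))
    (card_supp_quotient_le K hP hS hq.1 (hS.numIndec_symm hq.1 hl))
  rw [hS.facOf_iff hq.1 he]
  exact Module.Finite.exists_fin' S M

theorem CF.exists_idem (K : Type u) [Field K] [Algebra K A] [FiniteDimensional K A]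
    (h : CF A M) : ∃ a : A, IsIdempotentElem a ∧ (∀ m : M, a • m = 0) ∧
      ∀ (S : Type u) [Ring S] [Algebra K S] (φ : A →+* S),
        (∀ k : K, φ (algebraMap K A k) = algebraMap K S k) → IsQuotientByIdem A a S φ →
        ∀ (M' : Type u) [AddCommGroup M'] [Module S M'] (e : M ≃+ M'), IsSemi φ e →
          IsTauTilting S K M' := by
  classical
  have := IsArtinianRing.of_finite K A
  obtain ⟨_, hr, m, n, X, P, hX, ⟨eX⟩, hP, hm⟩ := h
  obtain ⟨k, c, ⟨E⟩⟩ := hP.exists_pi A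
  have hcard : (supp P M).card = m := by
    refine hm.antisymm ?_
    simpa using hP.card_le K hX fun i => hr.extProjIn.of_isDirectSummand (isDirectSummand_pi X eX i)
  let mask : (∀ j, P (c j)) →ₗ[A] ∀ j, P (c j) :=
    LinearMap.pi fun j => if c j ∈ supp P M then 0 else LinearMap.proj j
  have hmask (x : ∀ j, P (c j)) (j) : mask x j = if c j ∈ supp P M then 0 else x j := by
    change (if c j ∈ supp P M then (0 : (∀ j, P (c j)) →ₗ[A] P (c j)) else LinearMap.proj j) x = _
    split_ifs <;> rfl
  let a : A := E.symm (mask (E 1))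
  have hmul (x : A) : x * a = E.symm (mask (E x)) := by
    rw [← smul_eq_mul, ← map_smul, ← map_smul, ← map_smul, smul_eq_mul, mul_one]
  have hz : ∀ j, c j ∉ supp P M → ∀ (f : P (c j) →ₗ[A] M) (x), f x = 0 := by
    intro j hj f x
    rw [mem_supp] at hj
    push Not at hj
    rw [hj f, LinearMap.zero_apply]
  have ha : IsIdempotentElem a := by
    change a * a = a
    rw [hmul]
    change E.symm (mask (E (E.symm (mask (E 1))))) = E.symm (mask (E 1))
    rw [E.apply_symm_apply]
    congr 1
    ext j
    rw [hmask, hmask]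
    split_ifs <;> rfl
  refine ⟨a, ha, fun x => ?_, ?_⟩
  · let f : (∀ j, P (c j)) →ₗ[A] M := LinearMap.toSpanSingleton A M x ∘ₗ E.symm.toLinearMap
    change f (mask (E 1)) = 0
    rw [← LinearMap.sum_single_apply (fun j => P (c j)) (mask (E 1)), map_sum]
    refine Finset.sum_eq_zero fun j _ => ?_
    rw [hmask]
    split_ifs with hj
    · rw [Pi.single_zero, map_zero]
    · exact hz j hj (f ∘ₗ LinearMap.single A (fun j => P (c j)) j) _
  · intro S _ _ φ hK hq M' _ _ e he
    have := finiteDimensional_of_surjective K hq.1 hK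
    have : Module.Finite S M' := he.finite
    refine ⟨(tauRigid_iff_eRigid K).mpr (he.eRigid hq.1 hr), m, m,
      he.numIndec hq.1 (numIndec_iff.mpr ⟨X, hX.skel eX⟩), ?_, rfl⟩
    let _ : Module A S := Module.compHom S φ
    have hS : IsSemi φ (AddEquiv.refl S) := fun _ _ => rfl
    have : Module.Finite A S := hS.finite_symm hq.1
    obtain ⟨l, Y, hY⟩ := exists_skel (A := A) S
    have hl : NumIndec A S l := numIndec_iff.mpr ⟨Y, hY⟩
    have hSr : ERigid A S := hS.eRigid_symm ha hq fun N _ _ _ E _ _ i p _ hp _ =>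
      Module.projective_lifting_property p LinearMap.id hp
    have h1 : l ≤ (supp P S).card := by
      simpa using hP.card_le K hY.1 fun i => hSr.extProjIn.of_isDirectSummand (hY.isDirectSummand i)
    have h2 := card_supp_quotient_le K hP hS hq.1 hl
    have h3 : supp P M ⊆ supp P S := supp_subset_of_facOf hP (by
      rw [hS.facOf_iff hq.1 he]
      exact Module.Finite.exists_fin' S M')
    have h4 : supp P S ⊆ supp P M := by
      intro t ht
      by_contra hn
      have := hP.finite t; have := hP.projective t
      obtain ⟨j, ⟨g⟩⟩ := exists_equiv_of_isDirectSummand_pi (hP.indec.1 t) (fun j => P (c j))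
        (fun j => hP.indec.1 _) E
        (isDirectSummand_of_inAdd (hP.indec.1 t) (inAdd_ring (A := A) (P t)))
      obtain rfl := hP.indec.2 _ _ ⟨g⟩
      obtain ⟨f, hf⟩ := mem_supp.mp ht
      refine hf (LinearMap.ext fun x => ?_)
      let f' : A →ₗ[A] S := f ∘ₗ LinearMap.proj j ∘ₗ E.toLinearMap
      have hf' (r : A) : f' r = φ r * f' 1 := by
        rw [← mul_one r, ← smul_eq_mul, map_smul, smul_eq_mul, mul_one]
        rfl
      let y := E.symm (Pi.single j x)
      have hy : y * a = y := by
        rw [hmul, E.apply_symm_apply]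
        congr 1
        ext i
        rw [hmask]
        split_ifs with hi
        · rw [Pi.single_eq_of_ne]
          rintro rfl
          exact hn hi
        · rfl
      have h5 : f' y = f x := by
        change f (E (E.symm (Pi.single j x)) j) = f x
        rw [E.apply_symm_apply, Pi.single_eq_same]
      rw [← h5, ← hy, hf', map_mul, hq.2.1, mul_zero, zero_mul, LinearMap.zero_apply]
    have h5 : l = m := by
      rw [← hcard, h3.antisymm h4]
      exact h1.antisymm h2
    exact h5 ▸ hS.numIndec hq.1 hl

theorem CF.isSuppTauTilting (K : Type u) [Field K] [Algebra K A] [FiniteDimensional K A]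
    (h : CF A M) : IsSuppTauTilting A K M := by
  obtain ⟨a, ha, haM, H⟩ := h.exists_idem K
  obtain ⟨S, _, _, φ, hK, hq⟩ := exists_quotient (A := A) K a
  obtain ⟨_, hM⟩ := hq.exists_module haM
  exact ⟨a, ha, S, _, _, φ, hK, hq, _, hM, H S φ hK hq M (AddEquiv.refl M) fun r m => (hM r m).symm⟩

theorem CF.isBasic (h : CF A M) : IsBasic A M := by
  obtain ⟨_, _, m, _, X, _, hX, e, _⟩ := h
  exact isBasic_iff.mpr ⟨m, X, hX, e⟩

theorem gpsttMod_iff (K : Type u) [Field K] [Algebra K A] [FiniteDimensional K A]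
    (X : ModuleCat.{u} A) : GPSTTmod K A X ↔ CF A X ∧ IsGP A X :=
  ⟨fun ⟨_, h2, h3, h4⟩ => ⟨cf_of_isSuppTauTilting K h2 h4, h3⟩,
    fun ⟨h1, h2⟩ => ⟨h1.1, h1.isBasic, h2, h1.isSuppTauTilting K⟩⟩

end Quotient

section FacPair

variable {A : Type u} [Ring A]

/-- The class of finitely generated modules generated by `M`. -/
def FacClass (A : Type u) [Ring A] (M : Type u) [AddCommGroup M] [Module A M] :
    ModuleCat.{u} A → Prop := fun Y => Module.Finite A Y ∧ FacOf A M Y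

/-- The class of finitely generated modules receiving no nonzero map from `M`. -/
def PerpClass (A : Type u) [Ring A] (M : Type u) [AddCommGroup M] [Module A M] :
    ModuleCat.{u} A → Prop := fun Y => Module.Finite A Y ∧ ∀ f : M →ₗ[A] Y, f = 0

variable {M X Y : Type u} [AddCommGroup M] [Module A M] [AddCommGroup X] [Module A X]
  [AddCommGroup Y] [Module A Y]

theorem FacOf.hom_eq_zero (hX : FacOf A M X) (h : ∀ f : M →ₗ[A] Y, f = 0) (f : X →ₗ[A] Y) :
    f = 0 := by
  rw [← LinearMap.range_eq_bot, ← Submodule.map_top, ← hX.iSup_range_eq_top, Submodule.map_iSup]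
  simp_rw [← LinearMap.range_comp, h, LinearMap.range_zero, iSup_bot]

theorem FacOf.range_le_trace (hX : FacOf A M X) (f : X →ₗ[A] Y) :
    LinearMap.range f ≤ ⨆ g : M →ₗ[A] Y, LinearMap.range g := by
  rw [← Submodule.map_top, ← hX.iSup_range_eq_top, Submodule.map_iSup]
  refine iSup_le fun g => ?_
  rw [← LinearMap.range_comp]
  exact le_iSup (fun g : M →ₗ[A] Y => LinearMap.range g) (f ∘ₗ g)

theorem facOf_trace [IsNoetherian A Y] :
    FacOf A M ↥(⨆ g : M →ₗ[A] Y, LinearMap.range g) :=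
  facOf_iSup_range (fun _ => facOf_self M) fun g => g

theorem ERigid.hom_quotient_trace_eq_zero [IsNoetherian A Y] (h : ERigid A M)
    (f : M →ₗ[A] Y ⧸ (⨆ g : M →ₗ[A] Y, LinearMap.range g)) : f = 0 := by
  obtain ⟨g, hg⟩ := Ext1Vanishes.lift (Submodule.mkQ _) (h _ (by
    rw [Submodule.ker_mkQ]; exact facOf_trace)) (Submodule.mkQ_surjective _) f
  rw [← hg]
  refine LinearMap.ext fun x => ?_
  rw [LinearMap.comp_apply, LinearMap.zero_apply, Submodule.mkQ_apply,
    Submodule.Quotient.mk_eq_zero]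
  exact le_iSup (fun g : M →ₗ[A] Y => LinearMap.range g) g ⟨x, rfl⟩

theorem ERigid.isTorsionPair [IsNoetherianRing A] (h : ERigid A M) :
    IsTorsionPair A (FacClass A M) (PerpClass A M) := by
  refine ⟨?_, ?_, fun X h => h.1, fun X h => h.1, fun X Y hX hY => hX.2.hom_eq_zero hY.2,
    fun X hX => ⟨⨆ g : M →ₗ[A] X, LinearMap.range g, ⟨?_, facOf_trace⟩, ⟨?_, fun f => ?_⟩⟩⟩
  · rintro X Y ⟨e⟩ ⟨_, hX⟩
    exact ⟨Module.Finite.equiv e, hX.of_surjective e.toLinearMap e.surjective⟩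
  · rintro X Y ⟨e⟩ ⟨_, hX⟩
    refine ⟨Module.Finite.equiv e, fun f => LinearMap.ext fun x => e.symm.injective ?_⟩
    rw [LinearMap.zero_apply, map_zero]
    exact LinearMap.congr_fun (hX (e.symm.toLinearMap ∘ₗ f)) x
  · exact inferInstanceAs (Module.Finite A ↥(⨆ g : M →ₗ[A] X, LinearMap.range g))
  · exact inferInstanceAs (Module.Finite A (X ⧸ (⨆ g : M →ₗ[A] X, LinearMap.range g)))
  · exact h.hom_quotient_trace_eq_zero f

theorem contravariantlyFinite_facClass [IsNoetherianRing A] :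
    ContravariantlyFinite A (FacClass A M) := by
  intro X hX
  let t := ⨆ g : M →ₗ[A] X, LinearMap.range g
  exact ⟨ModuleCat.of A t, t.subtype, ⟨inferInstanceAs (Module.Finite A t), facOf_trace⟩,
    fun M' g hM' => ⟨LinearMap.codRestrict t g fun x => hM'.2.range_le_trace g ⟨x, rfl⟩, rfl⟩⟩

/-- Left `add M`-approximations exist. -/
theorem exists_left_approx (K : Type u) [Field K] [Algebra K A] [FiniteDimensional K A]
    (M X : Type u) [AddCommGroup M] [Module A M] [AddCommGroup X] [Module A X] [Module.Finite A M]
    [Module.Finite A X] : ∃ (k : ℕ) (f : X →ₗ[A] (Fin k → M)), ∀ g : X →ₗ[A] M,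
      ∃ h : (Fin k → M) →ₗ[A] M, h ∘ₗ f = g := by
  let _ := restrictedModule A K M
  have _ := restrictedModule_tower (A := A) K M
  have := finiteDimensional_hom (A := A) K (X := X) (N := M)
  let b := Module.finBasis K (X →ₗ[A] M)
  refine ⟨_, LinearMap.pi fun i => b i, fun g => ⟨∑ i, b.repr g i • LinearMap.proj i, ?_⟩⟩
  refine LinearMap.ext fun x => ?_
  have h := LinearMap.congr_fun (b.sum_repr g) x
  rw [LinearMap.sum_apply] at h
  refine Eq.trans ?_ h
  simp

theorem covariantlyFinite_facClass (K : Type u) [Field K] [Algebra K A] [FiniteDimensional K A]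
    [Module.Finite A M] : CovariantlyFinite A (FacClass A M) := by
  have := IsArtinianRing.of_finite K A
  intro X hX
  obtain ⟨n, p, hp⟩ := Module.Finite.exists_fin' A X
  obtain ⟨k, f, hf⟩ := exists_left_approx (A := A) K M (Fin n → A)
  let L : Submodule A (Fin k → M) := (LinearMap.ker p).map f
  have hL : LinearMap.ker p ≤ LinearMap.ker (L.mkQ ∘ₗ f) := fun x hx => by
    rw [LinearMap.mem_ker, LinearMap.comp_apply, Submodule.mkQ_apply,
      Submodule.Quotient.mk_eq_zero]
    exact ⟨x, hx, rfl⟩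
  let g : X →ₗ[A] (Fin k → M) ⧸ L :=
    (LinearMap.ker p).liftQ (L.mkQ ∘ₗ f) hL ∘ₗ (p.quotKerEquivOfSurjective hp).symm.toLinearMap
  have hg : g ∘ₗ p = L.mkQ ∘ₗ f := LinearMap.ext fun x => by
    have : (p.quotKerEquivOfSurjective hp).symm (p x) = Submodule.Quotient.mk x := by
      rw [LinearEquiv.symm_apply_eq]
      rfl
    change (LinearMap.ker p).liftQ (L.mkQ ∘ₗ f) hL ((p.quotKerEquivOfSurjective hp).symm (p x)) = _
    rw [this]
    rfl
  refine ⟨ModuleCat.of A ((Fin k → M) ⧸ L), g, ⟨inferInstanceAs (Module.Finite A (_ ⧸ L)),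
    k, L.mkQ, L.mkQ_surjective⟩, ?_⟩
  rintro N w ⟨_, s, q, hq⟩
  obtain ⟨v, hv⟩ := Module.projective_lifting_property q (w ∘ₗ p) hq
  choose h hh using fun i => hf (LinearMap.proj i ∘ₗ v)
  let H : (Fin k → M) →ₗ[A] N := q ∘ₗ LinearMap.pi h
  have hH : H ∘ₗ f = w ∘ₗ p := by
    rw [← hv]
    refine LinearMap.ext fun x => congrArg q (funext fun i => ?_)
    exact LinearMap.congr_fun (hh i) x
  refine ⟨L.liftQ H ?_, ?_⟩
  · rintro _ ⟨x, hx, rfl⟩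
    refine (LinearMap.congr_fun hH x).trans ?_
    rw [LinearMap.comp_apply, LinearMap.mem_ker.mp hx, map_zero]
  · rw [← LinearMap.cancel_right hp]
    refine Eq.trans ?_ hH
    rw [LinearMap.comp_assoc, hg]
    rfl

theorem equiv_of_inAdd [IsArtinianRing A] {M N : Type u} [AddCommGroup M] [Module A M]
    [AddCommGroup N] [Module A N] [Module.Finite A M] [Module.Finite A N] (hM : IsBasic A M)
    (hN : IsBasic A N) (h : InAdd A M N) (h' : InAdd A N M) : Nonempty (M ≃ₗ[A] N) := by
  obtain ⟨m, X, hX, ⟨e⟩⟩ := isBasic_iff.mp hM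
  obtain ⟨n, Y, hY, ⟨f⟩⟩ := isBasic_iff.mp hN
  have key {M N : Type u} [AddCommGroup M] [Module A M] [AddCommGroup N] [Module A N]
      [Module.Finite A M] [Module.Finite A N] {m n : ℕ} {X : Fin m → ModuleCat.{u} A}
      {Y : Fin n → ModuleCat.{u} A} (hX : IndecFam X) (hY : IndecFam Y) (e : M ≃ₗ[A] ∀ i, X i)
      (f : N ≃ₗ[A] ∀ i, Y i) (h' : InAdd A N M) (i) : ∃ j, Nonempty (X i ≃ₗ[A] Y j) := by
    have hi := isDirectSummand_pi X e i
    have := finite_of_isDirectSummand hi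
    exact (hY.skel f).exists_equiv (hX.1 i)
      (isDirectSummand_of_inAdd (hX.1 i) (h'.of_isDirectSummand hi))
  obtain ⟨g⟩ := pi_equiv_of_forall hX hY (key hX hY e f h') (key hY hX f e h)
  exact ⟨(e.trans g).trans f.symm⟩

theorem CF.isBasicExtProjGen (K : Type u) [Field K] [Algebra K A] [FiniteDimensional K A]
    {M : ModuleCat.{u} A} (h : CF A M) : IsBasicExtProjGen A (FacClass A M) M := by
  have := IsArtinianRing.of_finite K A
  have hb := h.isBasic
  obtain ⟨_, hr, m, n, X, P, hX, ⟨e⟩, hP, hm⟩ := h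
  refine ⟨⟨inferInstance, facOf_self M⟩, hb, fun X hX => hr X hX.2, fun _ => Iff.rfl,
    fun Z hZ hZE => ?_⟩
  have := hZ.1
  have hZ' : ExtProjIn A M Z := ⟨hZ.2, fun N _ _ hN => hZE (ModuleCat.of A N) ⟨hN.finite, hN⟩⟩
  refine IsSumOf.inAdd (isSumOf_of_forall fun Y _ _ hY hYZ => ?_) fun i => isDirectSummand_pi X e i
  have := finite_of_isDirectSummand hYZ
  exact hP.exists_equiv_of_card K hX (fun i => hr.extProjIn.of_isDirectSummand
    (isDirectSummand_pi X e i)) hm hY (hZ'.of_isDirectSummand hYZ)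

theorem IsBasicExtProjGen.equiv [IsArtinianRing A] {T : ModuleCat.{u} A → Prop}
    {G G' : ModuleCat.{u} A} (h : IsBasicExtProjGen A T G) (h' : IsBasicExtProjGen A T G') :
    Nonempty (G ≃ₗ[A] G') := by
  obtain ⟨h1, h2, h3, h4, h5⟩ := h
  obtain ⟨h1', h2', h3', h4', h5'⟩ := h'
  have := ((h4 G).mp h1).1
  have := ((h4 G').mp h1').1
  exact equiv_of_inAdd h2 h2' (h5 G' h1' h3') (h5' G h1 h3)

theorem IsGP.of_equiv (e : X ≃ₗ[A] Y) (h : IsGP A X) : IsGP A Y := by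
  obtain ⟨P, i1, i2, d, h1, h2, h3, h4, ⟨f⟩⟩ := h
  exact ⟨P, i1, i2, d, h1, h2, h3, h4, ⟨e.symm.trans f⟩⟩

theorem CF.isGorensteinTP (K : Type u) [Field K] [Algebra K A] [FiniteDimensional K A]
    {M : ModuleCat.{u} A} (h : CF A M) (hG : IsGP A M) :
    IsGorensteinTP A (FacClass A M) (PerpClass A M) := by
  have := IsArtinianRing.of_finite K A
  have := h.1
  exact ⟨h.2.1.isTorsionPair, ⟨covariantlyFinite_facClass K, contravariantlyFinite_facClass⟩,
    fun G hG' => hG.of_equiv ((h.isBasicExtProjGen K).equiv hG').some⟩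

end FacPair

section TorsionPair

variable {A : Type u} [Ring A] {T F F' : ModuleCat.{u} A → Prop}

theorem IsTorsionPair.tors_iff [IsNoetherianRing A] (h : IsTorsionPair A T F)
    (X : ModuleCat.{u} A) :
    T X ↔ Module.Finite A X ∧ ∀ Y, F Y → ∀ f : X →ₗ[A] Y, f = 0 := by
  obtain ⟨hT, _, hTf, _, h0, hex⟩ := h
  refine ⟨fun hX => ⟨hTf X hX, fun Y hY => h0 X Y hX hY⟩, fun ⟨hX, h⟩ => ?_⟩
  obtain ⟨t, ht, hF⟩ := hex X hX
  have h1 : t = ⊤ := by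
    rw [← Submodule.ker_mkQ t, h _ hF t.mkQ, LinearMap.ker_zero]
  exact hT _ _ ⟨LinearEquiv.ofTop t h1⟩ ht

theorem IsTorsionPair.free_iff [IsNoetherianRing A] (h : IsTorsionPair A T F)
    (X : ModuleCat.{u} A) :
    F X ↔ Module.Finite A X ∧ ∀ Y, T Y → ∀ f : Y →ₗ[A] X, f = 0 := by
  obtain ⟨_, hF, _, hFf, h0, hex⟩ := h
  refine ⟨fun hX => ⟨hFf X hX, fun Y hY => h0 Y X hY hX⟩, fun ⟨hX, h⟩ => ?_⟩
  obtain ⟨t, ht, hFt⟩ := hex X hX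
  have h1 : t = ⊥ := by
    rw [← Submodule.range_subtype t, h _ ht t.subtype, LinearMap.range_zero]
  exact hF _ _ ⟨Submodule.quotEquivOfEqBot t h1⟩ hFt

theorem IsTorsionPair.unique [IsNoetherianRing A] (h : IsTorsionPair A T F)
    (h' : IsTorsionPair A T F') : F = F' :=
  funext fun X => propext ((h.free_iff X).trans (h'.free_iff X).symm)

theorem IsTorsionPair.of_surjective [IsNoetherianRing A] (h : IsTorsionPair A T F)
    {X Y : Type u} [AddCommGroup X] [Module A X] [AddCommGroup Y] [Module A Y]
    (hX : T (ModuleCat.of A X)) (f : X →ₗ[A] Y) (hf : Surjective f) : T (ModuleCat.of A Y) := by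
  rw [h.tors_iff] at hX ⊢
  have := hX.1
  refine ⟨Module.Finite.of_surjective f hf, fun Z hZ g => ?_⟩
  rw [← LinearMap.cancel_right hf, LinearMap.zero_comp]
  exact hX.2 Z hZ (g ∘ₗ f)

theorem IsTorsionPair.of_exact [IsNoetherianRing A] (h : IsTorsionPair A T F)
    {X Y E : Type u} [AddCommGroup X] [Module A X] [AddCommGroup Y] [Module A Y]
    [AddCommGroup E] [Module A E]
    (hX : T (ModuleCat.of A X)) (hY : T (ModuleCat.of A Y)) (i : X →ₗ[A] E) (p : E →ₗ[A] Y)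
    (hp : Surjective p) (hip : Exact i p) : T (ModuleCat.of A E) := by
  rw [h.tors_iff] at hX hY ⊢
  have : Module.Finite A X := hX.1
  have : Module.Finite A Y := hY.1
  have : IsNoetherian A E := isNoetherian_of_range_eq_ker i p (hip.linearMap_ker_eq.symm)
  refine ⟨inferInstanceAs (Module.Finite A E), fun Z hZ g => ?_⟩
  have h1 : g ∘ₗ i = 0 := hX.2 Z hZ _
  have h2 : LinearMap.ker p ≤ LinearMap.ker g := fun x hx => by
    obtain ⟨y, rfl⟩ := (hip x).mp hx
    exact LinearMap.congr_fun h1 y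
  have h3 := hY.2 Z hZ ((LinearMap.ker p).liftQ g h2 ∘ₗ
    (p.quotKerEquivOfSurjective hp).symm.toLinearMap)
  refine LinearMap.ext fun x => ?_
  have h4 := LinearMap.congr_fun h3 (p x)
  have : (p.quotKerEquivOfSurjective hp).symm (p x) = Submodule.Quotient.mk x := by
    rw [LinearEquiv.symm_apply_eq]
    rfl
  rw [LinearMap.comp_apply, LinearEquiv.coe_coe, this] at h4
  exact h4

theorem IsTorsionPair.of_pi [IsNoetherianRing A] (h : IsTorsionPair A T F) {ι : Type} [Finite ι]
    (X : ι → Type u) [∀ i, AddCommGroup (X i)] [∀ i, Module A (X i)]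
    (hX : ∀ i, T (ModuleCat.of A (X i))) : T (ModuleCat.of A (∀ i, X i)) := by
  classical
  have := Fintype.ofFinite ι
  simp_rw [h.tors_iff] at hX ⊢
  have := fun i => (hX i).1
  refine ⟨Module.Finite.pi (M := X), fun Z hZ g => ?_⟩
  refine LinearMap.pi_ext' fun i => ?_
  rw [LinearMap.zero_comp]
  exact (hX i).2 Z hZ _

theorem IsTorsionPair.of_facOf [IsNoetherianRing A] (h : IsTorsionPair A T F)
    {X Y : Type u} [AddCommGroup X] [Module A X] [AddCommGroup Y] [Module A Y]
    (hX : T (ModuleCat.of A X)) (hY : FacOf A X Y) : T (ModuleCat.of A Y) := by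
  obtain ⟨n, p, hp⟩ := hY
  exact h.of_surjective (h.of_pi (fun _ : Fin n => X) fun _ => hX) p hp

/-- A left approximation of `A` with every endomorphism under `A` invertible. -/
theorem IsTorsionPair.exists_min_approx [IsArtinianRing A] (h : IsTorsionPair A T F)
    (hc : CovariantlyFinite A T) : ∃ (M : ModuleCat.{u} A) (f : A →ₗ[A] M), T M ∧
      (∀ (M' : ModuleCat.{u} A) (g : A →ₗ[A] M'), T M' → ∃ w : M →ₗ[A] M', w ∘ₗ f = g) ∧
      ∀ v : M →ₗ[A] M, v ∘ₗ f = f → Bijective v := by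
  let S : Set ℕ∞ := {k | ∃ (M : ModuleCat.{u} A) (f : A →ₗ[A] M), T M ∧
      (∀ (M' : ModuleCat.{u} A) (g : A →ₗ[A] M'), T M' → ∃ w : M →ₗ[A] M', w ∘ₗ f = g) ∧
      Module.length A M = k}
  have hS : S.Nonempty := by
    obtain ⟨M, f, h1, h2⟩ := hc (ModuleCat.of A A) (inferInstanceAs (Module.Finite A A))
    exact ⟨_, M, f, h1, h2, rfl⟩
  obtain ⟨k, ⟨M, f, h1, h2, rfl⟩, hk⟩ := wellFounded_lt.has_min S hS
  refine ⟨M, f, h1, h2, fun v hv => ?_⟩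
  have := ((h.tors_iff M).mp h1).1
  have hsurj : Surjective v := by
    rw [← LinearMap.range_eq_top]
    by_contra hne
    refine hk _ ⟨ModuleCat.of A (LinearMap.range v), LinearMap.codRestrict _ f fun x => ⟨f x, ?_⟩,
      h.of_surjective h1 v.rangeRestrict v.surjective_rangeRestrict, fun M' g hM' => ?_, rfl⟩
      (Submodule.length_lt hne)
    · exact LinearMap.congr_fun hv x
    · obtain ⟨w, hw⟩ := h2 M' g hM'
      exact ⟨w ∘ₗ (LinearMap.range v).subtype, hw⟩
  exact ⟨IsNoetherian.injective_of_surjective_endomorphism v hsurj, hsurj⟩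

theorem IsTorsionPair.ext1Vanishes_approx [IsNoetherianRing A] (h : IsTorsionPair A T F)
    {M : ModuleCat.{u} A} {f : A →ₗ[A] M} (hM : T M)
    (hf : ∀ (M' : ModuleCat.{u} A) (g : A →ₗ[A] M'), T M' → ∃ w : M →ₗ[A] M', w ∘ₗ f = g)
    (hb : ∀ v : M →ₗ[A] M, v ∘ₗ f = f → Bijective v) (N : Type u) [AddCommGroup N] [Module A N]
    (hN : T (ModuleCat.of A N)) : Ext1Vanishes A M N := by
  intro E _ _ i p hi hp hip
  obtain ⟨g, hg⟩ := Module.projective_lifting_property p f hp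
  obtain ⟨w, hw⟩ := hf (ModuleCat.of A E) g (h.of_exact hN hM i p hp hip)
  have hbij := hb (p ∘ₗ w) (by rw [LinearMap.comp_assoc, hw, hg])
  let e := LinearEquiv.ofBijective _ hbij
  exact ⟨w ∘ₗ e.symm.toLinearMap, LinearMap.ext fun x => e.apply_symm_apply x⟩

theorem Ext1Vanishes.coker {P M N : Type u} [AddCommGroup P] [Module A P] [AddCommGroup M]
    [Module A M] [AddCommGroup N] [Module A N] (h : Ext1Vanishes A M N) (f : P →ₗ[A] M)
    (hf : ∀ g : P →ₗ[A] N, ∃ w : M →ₗ[A] N, w ∘ₗ f = g) :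
    Ext1Vanishes A (M ⧸ LinearMap.range f) N := by
  intro E _ _ i p hi hp hip
  let e : N ≃ₗ[A] LinearMap.ker p :=
    (LinearEquiv.ofInjective i hi).trans (LinearEquiv.ofEq _ _ hip.linearMap_ker_eq.symm)
  have he (x : N) : (e x : E) = i x := rfl
  obtain ⟨s, hs⟩ := Ext1Vanishes.lift p (h.of_equiv_right e) hp (LinearMap.range f).mkQ
  have hker (x : P) : s (f x) ∈ LinearMap.ker p := by
    have := LinearMap.congr_fun hs (f x)
    rw [LinearMap.comp_apply] at this
    rw [LinearMap.mem_ker, this, Submodule.mkQ_apply, Submodule.Quotient.mk_eq_zero]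
    exact ⟨x, rfl⟩
  obtain ⟨w, hw⟩ := hf (e.symm.toLinearMap ∘ₗ LinearMap.codRestrict _ (s ∘ₗ f) hker)
  have hiw (x : P) : i (w (f x)) = s (f x) := by
    have := LinearMap.congr_fun hw x
    rw [LinearMap.comp_apply] at this
    rw [this, ← he]
    simp
  refine ⟨(LinearMap.range f).liftQ (s - i ∘ₗ w) ?_, ?_⟩
  · rintro _ ⟨x, rfl⟩
    rw [LinearMap.mem_ker, LinearMap.sub_apply, LinearMap.comp_apply, hiw, sub_self]
  · refine Submodule.linearMap_qext _ (LinearMap.ext fun x => ?_)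
    change p (s x - i (w x)) = _
    rw [map_sub, hip.apply_apply_eq_zero, sub_zero]
    exact LinearMap.congr_fun hs x

theorem Ext1Vanishes.pi {N : Type u} [AddCommGroup N] [Module A N] {ι : Type} [Finite ι]
    (X : ι → ModuleCat.{u} A) (h : ∀ i, Ext1Vanishes A (X i) N) : Ext1Vanishes A (∀ i, X i) N := by
  classical
  have := Fintype.ofFinite ι
  intro E _ _ i p hi hp hip
  let e : N ≃ₗ[A] LinearMap.ker p :=
    (LinearEquiv.ofInjective i hi).trans (LinearEquiv.ofEq _ _ hip.linearMap_ker_eq.symm)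
  choose g hg using fun j => Ext1Vanishes.lift p ((h j).of_equiv_right e) hp
    (LinearMap.single A (fun i => X i) j)
  refine ⟨∑ j, g j ∘ₗ LinearMap.proj j, LinearMap.pi_ext' fun k => LinearMap.ext fun x => ?_⟩
  refine Eq.trans ?_ (LinearMap.congr_fun (hg k) x)
  rw [LinearMap.comp_apply, LinearMap.comp_apply, LinearMap.sum_apply, LinearMap.comp_apply]
  congr 1
  refine (Finset.sum_eq_single k (fun j _ hj => ?_) (by simp)).trans (by simp)
  simp [hj]

theorem IsTorsionPair.exists_cf (K : Type u) [Field K] [Algebra K A] [FiniteDimensional K A]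
    (h : IsTorsionPair A T F) (hc : CovariantlyFinite A T) :
    ∃ G : ModuleCat.{u} A, CF A G ∧ T = FacClass A G := by
  have := IsArtinianRing.of_finite K A
  obtain ⟨M, f, hM, hf, hb⟩ := h.exists_min_approx hc
  have := ((h.tors_iff M).mp hM).1
  have hE := fun N [AddCommGroup N] [Module A N] => h.ext1Vanishes_approx hM hf hb N
  obtain ⟨n, P, hP⟩ := exists_projFam (A := A)
  have hPA (l) : IsDirectSummand A (P l) A := by
    have := hP.finite l; have := hP.projective l
    exact isDirectSummand_of_inAdd (hP.indec.1 l) (inAdd_ring (A := A) (P l))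
  choose ι ρ hιρ using hPA
  have hfl (l) (N : Type u) [AddCommGroup N] [Module A N] (hN : T (ModuleCat.of A N))
      (g : P l →ₗ[A] N) : ∃ w : M →ₗ[A] N, w ∘ₗ f ∘ₗ ι l = g := by
    obtain ⟨w, hw⟩ := hf (ModuleCat.of A N) (g ∘ₗ ρ l) hN
    exact ⟨w, by rw [← LinearMap.comp_assoc, hw, LinearMap.comp_assoc, hιρ, LinearMap.comp_id]⟩
  let W : Option (Fin n) → ModuleCat.{u} A := fun o =>
    o.elim M fun l => ModuleCat.of A (M ⧸ LinearMap.range (f ∘ₗ ι l))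
  have hWT (o) : T (W o) := by
    cases o with
    | none => exact hM
    | some l => exact h.of_surjective hM (Submodule.mkQ _) (Submodule.mkQ_surjective _)
  have hWE (o) (N : Type u) [AddCommGroup N] [Module A N] (hN : T (ModuleCat.of A N)) :
      Ext1Vanishes A (W o) N := by
    cases o with
    | none => exact hE N hN
    | some l => exact (hE N hN).coker _ (hfl l N hN)
  have hWf (o) : Module.Finite A (W o) := ((h.tors_iff _).mp (hWT o)).1
  obtain ⟨m, X, hX⟩ := exists_skel (A := A) (∀ o, W o)
  let G : ModuleCat.{u} A := ModuleCat.of A (∀ i, X i)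
  have hGX : Skel G X := hX.1.skel (LinearEquiv.refl A _)
  have hXT (i) : T (X i) := by
    obtain ⟨_, p, hp⟩ := hX.isDirectSummand i
    exact h.of_surjective (h.of_pi (fun o => W o) hWT) p fun x => ⟨_, LinearMap.congr_fun hp x⟩
  have hXE (i) (N : Type u) [AddCommGroup N] [Module A N] (hN : T (ModuleCat.of A N)) :
      Ext1Vanishes A (X i) N := by
    have := finite_of_isDirectSummand (hX.isDirectSummand i)
    obtain ⟨q, p, hqp⟩ := hX.isDirectSummand i
    obtain ⟨o, ho⟩ := isDirectSummand_of_pi (hX.1.1 i) W (LinearEquiv.refl A _) q p hqp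
    exact (hWE o N hN).of_isDirectSummand ho
  have hXf (i) : Module.Finite A (X i) := ((h.tors_iff _).mp (hXT i)).1
  have hG : Module.Finite A (∀ i, X i) := Module.Finite.pi
  have hGT : T G := h.of_pi _ hXT
  have hsum (o) : IsSumOf X (W o) := hX.isSumOf (inAdd_of_isDirectSummand
    (isDirectSummand_pi W (LinearEquiv.refl A _) o))
  have hGM : FacOf A G M := by
    obtain ⟨k, c, ⟨e⟩⟩ := hsum none
    exact (FacOf.pi fun j => facOf_of_isDirectSummand (hGX.isDirectSummand (c j))).of_surjective
      e.symm.toLinearMap e.symm.surjective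
  have hT : T = FacClass A G := by
    refine funext fun N => propext ⟨fun hN => ?_, fun hN => h.of_facOf hGT hN.2⟩
    have hNf : Module.Finite A N := ((h.tors_iff N).mp hN).1
    refine ⟨hNf, hGM.trans (facOf_of_iSup_range_eq_top ?_)⟩
    rw [eq_top_iff]
    rintro x -
    obtain ⟨w, hw⟩ := hf N (LinearMap.toSpanSingleton A N x) hN
    refine Submodule.mem_iSup_of_mem w ⟨f 1, ?_⟩
    rw [← LinearMap.comp_apply, hw, LinearMap.toSpanSingleton_apply, one_smul]
  refine ⟨G, ⟨hG, fun N _ _ hN => Ext1Vanishes.pi X fun i => hXE i N (h.of_facOf hGT hN), m, n, X, P,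
    hX.1, ⟨LinearEquiv.refl A _⟩, hP, ?_⟩, hT⟩
  refine (hP.card_supp_le K fun l _ => hvec_mem_span_of_exact K hXf (hsum none) (hsum (some l))
    (f ∘ₗ ι l) (Submodule.mkQ _) (Submodule.mkQ_surjective _) (LinearMap.exact_map_mkQ_range _)
    fun N _ _ _ hN g => ?_).trans_eq (Fintype.card_fin m)
  obtain ⟨w, hw⟩ := hfl l N (h.of_facOf hGT hN) g
  exact ⟨w, hw.symm⟩

/-- The bijection sending a module to the torsion pair it generates. -/
theorem exists_equiv_gorensteinTP (K : Type u) [Field K] [Algebra K A] [FiniteDimensional K A] :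
    ∃ e : Quotient (modSetoid A (GPSTTmod K A)) ≃
        {TF : (ModuleCat.{u} A → Prop) × (ModuleCat.{u} A → Prop) //
          IsGorensteinTP A TF.1 TF.2},
      ∀ x : {X : ModuleCat.{u} A // GPSTTmod K A X},
        (e (Quotient.mk _ x)).1.1 =
          fun Y : ModuleCat.{u} A => Module.Finite A Y ∧ FacOf A x.1 Y := by
  have := IsArtinianRing.of_finite K A
  let φ (x : {X : ModuleCat.{u} A // GPSTTmod K A X}) :
      {TF : (ModuleCat.{u} A → Prop) × (ModuleCat.{u} A → Prop) // IsGorensteinTP A TF.1 TF.2} :=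
    ⟨(FacClass A x.1, PerpClass A x.1),
      ((gpsttMod_iff K x.1).mp x.2).1.isGorensteinTP K ((gpsttMod_iff K x.1).mp x.2).2⟩
  have hφ (x y) (hxy : (modSetoid A (GPSTTmod K A)).r x y) : φ x = φ y := by
    obtain ⟨e⟩ := hxy
    have h1 : FacClass A x.1 = FacClass A y.1 := funext fun Y => propext
      ⟨fun h => ⟨h.1, h.2.of_equiv_left e⟩, fun h => ⟨h.1, h.2.of_equiv_left e.symm⟩⟩
    have h2 := (φ x).2.1
    change IsTorsionPair A (FacClass A x.1) _ at h2
    rw [h1] at h2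
    exact Subtype.ext (Prod.ext h1 (h2.unique (φ y).2.1))
  refine ⟨Equiv.ofBijective (Quotient.lift φ hφ) ⟨?_, ?_⟩, fun x => rfl⟩
  · rintro ⟨x⟩ ⟨y⟩ hxy
    have h1 : FacClass A x.1 = FacClass A y.1 := congrArg (fun z => z.1.1) hxy
    have h2 := ((gpsttMod_iff K x.1).mp x.2).1.isBasicExtProjGen K
    rw [h1] at h2
    exact Quotient.sound (h2.equiv (((gpsttMod_iff K y.1).mp y.2).1.isBasicExtProjGen K))
  · rintro ⟨⟨T, F⟩, h1, h2, h3⟩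
    obtain ⟨G, hG, rfl⟩ := h1.exists_cf K h2.1
    exact ⟨Quotient.mk _ ⟨G, (gpsttMod_iff K G).mpr ⟨hG, h3 G (hG.isBasicExtProjGen K)⟩⟩,
      Subtype.ext (Prod.ext rfl (hG.2.1.isTorsionPair.unique h1))⟩

end TorsionPair

section Syzygy

variable {A : Type u} [Ring A]

/-- `Z` is a syzygy of `Y` whose linear functionals extend to the projective module. -/
def SyzStep (A : Type u) [Ring A] (Z Y : Type u) [AddCommGroup Z] [Module A Z] [AddCommGroup Y]
    [Module A Y] : Prop :=
  ∃ (P : ModuleCat.{u} A) (i : Z →ₗ[A] P) (p : P →ₗ[A] Y), Module.Finite A P ∧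
    Module.Projective A P ∧ Injective i ∧ Surjective p ∧ Exact i p ∧
    ∀ g : Z →ₗ[A] A, ∃ h : P →ₗ[A] A, h ∘ₗ i = g

/-- A class of finitely generated modules closed under syzygies, with functionals on syzygies
extending. -/
def SyzClosed (L : ModuleCat.{u} A → Prop) : Prop :=
  ∀ Y, L Y → Module.Finite A Y ∧ ∀ (P : Type u) [AddCommGroup P] [Module A P],
    Module.Finite A P → Module.Projective A P → ∀ p : P →ₗ[A] Y, Surjective p →
      (∀ g : LinearMap.ker p →ₗ[A] A, ∃ h : P →ₗ[A] A, h ∘ₗ (LinearMap.ker p).subtype = g) ∧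
        L (ModuleCat.of A (LinearMap.ker p))

/-- All iterated syzygies of `X` have extendable functionals; this is `Extⁱ(X, A) = 0` for
`i > 0`. -/
def SyzGood (A : Type u) [Ring A] (X : Type u) [AddCommGroup X] [Module A X] : Prop :=
  ∃ L : ModuleCat.{u} A → Prop, SyzClosed L ∧ L (ModuleCat.of A X)

/-- The identity of `Z` factors through `W` up to a map factoring through a projective. -/
def StSummand (A : Type u) [Ring A] (Z W : Type u) [AddCommGroup Z] [Module A Z] [AddCommGroup W]
    [Module A W] : Prop :=
  ∃ (Q : ModuleCat.{u} A) (α : Z →ₗ[A] W) (β : W →ₗ[A] Z) (s : Z →ₗ[A] Q) (v : Q →ₗ[A] Z),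
    Module.Projective A Q ∧ β ∘ₗ α + v ∘ₗ s = LinearMap.id

theorem StSummand.refl (Z : Type u) [AddCommGroup Z] [Module A Z] : StSummand A Z Z :=
  ⟨ModuleCat.of A PUnit.{u + 1}, LinearMap.id, LinearMap.id, 0, 0,
    inferInstanceAs (Module.Projective A PUnit.{u + 1}), by simp⟩

theorem StSummand.ker {Z W V : Type u} [AddCommGroup Z] [Module A Z] [AddCommGroup W] [Module A W]
    [AddCommGroup V] [Module A V] (h : StSummand A Z W) (hVW : SyzStep A V W) {P : Type u}
    [AddCommGroup P] [Module A P] [Module.Projective A P] (p : P →ₗ[A] Z) (hp : Surjective p) :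
    (∀ g : LinearMap.ker p →ₗ[A] A, ∃ h : P →ₗ[A] A, h ∘ₗ (LinearMap.ker p).subtype = g) ∧
      StSummand A (LinearMap.ker p) V := by
  obtain ⟨Q, α, β, s, v, hQ, hid⟩ := h
  obtain ⟨Q₁, i, q, _, hQ₁, hi, hq, hiq, hext⟩ := hVW
  obtain ⟨α', hα⟩ := Module.projective_lifting_property q (α ∘ₗ p) hq
  obtain ⟨β', hβ⟩ := Module.projective_lifting_property p (β ∘ₗ q) hp
  obtain ⟨v', hv⟩ := Module.projective_lifting_property p v hp
  replace hα (x) : q (α' x) = α (p x) := LinearMap.congr_fun hα x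
  replace hβ (x) : p (β' x) = β (q x) := LinearMap.congr_fun hβ x
  replace hv (x) : p (v' x) = v x := LinearMap.congr_fun hv x
  replace hid (x) : β (α x) + v (s x) = x := LinearMap.congr_fun hid x
  let θ : P →ₗ[A] LinearMap.ker p :=
    LinearMap.codRestrict _ (LinearMap.id - β' ∘ₗ α' - v' ∘ₗ s ∘ₗ p) fun x => by
      simp only [LinearMap.mem_ker, LinearMap.sub_apply, LinearMap.comp_apply, map_sub, hβ, hα, hv,
        LinearMap.id_apply]
      rw [sub_sub, hid, sub_self]
  have hθ (x) (hx : x ∈ LinearMap.ker p) : β' (α' x) + (θ x : P) = x := by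
    change β' (α' x) + (x - β' (α' x) - v' (s (p x))) = x
    rw [LinearMap.mem_ker.mp hx]
    simp
  let e := LinearEquiv.ofInjective i hi
  let αk : LinearMap.ker p →ₗ[A] V := e.symm.toLinearMap ∘ₗ
    LinearMap.codRestrict _ (α' ∘ₗ (LinearMap.ker p).subtype) fun x => by
      rw [LinearMap.mem_range]
      refine (hiq _).mp ?_
      rw [LinearMap.comp_apply, hα, Submodule.subtype_apply, LinearMap.mem_ker.mp x.2, map_zero]
  have hαk (x) : i (αk x) = α' x := congrArg Subtype.val (e.apply_symm_apply _)
  let βk : V →ₗ[A] LinearMap.ker p := LinearMap.codRestrict _ (β' ∘ₗ i) fun x => by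
    rw [LinearMap.mem_ker, LinearMap.comp_apply, hβ, hiq.apply_apply_eq_zero, map_zero]
  have hk (x : LinearMap.ker p) : βk (αk x) + θ x = x := Subtype.ext <| by
    change β' (i (αk x)) + (θ x : P) = x
    rw [hαk, hθ x x.2]
  refine ⟨fun g => ?_, ModuleCat.of A P, αk, βk, (LinearMap.ker p).subtype, θ,
    inferInstanceAs (Module.Projective A P), LinearMap.ext hk⟩
  obtain ⟨G, hG⟩ := hext (g ∘ₗ βk)
  refine ⟨G ∘ₗ α' + g ∘ₗ θ, LinearMap.ext fun x => ?_⟩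
  change G (α' x) + g (θ x) = g x
  have := LinearMap.congr_fun hG (αk x)
  rw [LinearMap.comp_apply, hαk, LinearMap.comp_apply] at this
  rw [this, ← map_add, hk]

theorem SyzGood.finite {X : Type u} [AddCommGroup X] [Module A X] (h : SyzGood A X) :
    Module.Finite A X := by
  obtain ⟨L, hL, hX⟩ := h
  exact (hL _ hX).1

theorem SyzGood.extend {X P : Type u} [AddCommGroup X] [Module A X] [AddCommGroup P] [Module A P]
    [Module.Finite A P] [Module.Projective A P] (h : SyzGood A X) (p : P →ₗ[A] X)
    (hp : Surjective p) (g : LinearMap.ker p →ₗ[A] A) :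
    ∃ h : P →ₗ[A] A, h ∘ₗ (LinearMap.ker p).subtype = g := by
  obtain ⟨L, hL, hX⟩ := h
  exact ((hL _ hX).2 P inferInstance inferInstance p hp).1 g

theorem SyzGood.ker {X P : Type u} [AddCommGroup X] [Module A X] [AddCommGroup P] [Module A P]
    [Module.Finite A P] [Module.Projective A P] (h : SyzGood A X) (p : P →ₗ[A] X)
    (hp : Surjective p) : SyzGood A (LinearMap.ker p) := by
  obtain ⟨L, hL, hX⟩ := h
  exact ⟨L, hL, ((hL _ hX).2 P inferInstance inferInstance p hp).2⟩

theorem SyzGood.exists_step {X : Type u} [AddCommGroup X] [Module A X] (h : SyzGood A X) :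
    ∃ Z : ModuleCat.{u} A, SyzGood A Z ∧ SyzStep A Z X := by
  have := h.finite
  obtain ⟨n, p, hp⟩ := Module.Finite.exists_fin' A X
  exact ⟨ModuleCat.of A (LinearMap.ker p), h.ker p hp, ModuleCat.of A (Fin n → A),
    (LinearMap.ker p).subtype, p, inferInstanceAs (Module.Finite A (Fin n → A)),
    inferInstanceAs (Module.Projective A (Fin n → A)), Submodule.subtype_injective _, hp,
    LinearMap.exact_subtype_ker_map p, fun g => h.extend p hp g⟩

/-- A class closed under some syzygies consists of modules all of whose syzygies are good. -/
theorem syzGood_of_forall [IsNoetherianRing A] (L : ModuleCat.{u} A → Prop)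
    (h : ∀ Y, L Y → ∃ Z, L Z ∧ SyzStep A Z Y) (X : Type u) [AddCommGroup X] [Module A X]
    [Module.Finite A X] (hX : L (ModuleCat.of A X)) : SyzGood A X := by
  refine ⟨fun Z => Module.Finite A Z ∧ ∃ W, L W ∧ StSummand A Z W, ?_,
    inferInstanceAs (Module.Finite A X), _, hX, StSummand.refl _⟩
  rintro Y ⟨hY, W, hW, hYW⟩
  refine ⟨hY, fun P _ _ hP hP' p hp => ?_⟩
  obtain ⟨V, hV, hVW⟩ := h W hW
  have := hYW.ker hVW p hp
  exact ⟨this.1, inferInstanceAs (Module.Finite A (LinearMap.ker p)), V, hV, this.2⟩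

theorem SyzStep.of_equiv_right {Z X Y : Type u} [AddCommGroup Z] [Module A Z] [AddCommGroup Y]
    [Module A Y] [AddCommGroup X] [Module A X] (e : X ≃ₗ[A] Y) (h : SyzStep A Z X) :
    SyzStep A Z Y := by
  obtain ⟨P, i, p, h1, h2, h3, h4, h5, h6⟩ := h
  refine ⟨P, i, e.toLinearMap ∘ₗ p, h1, h2, h3, e.surjective.comp h4, fun x => ?_, h6⟩
  rw [← h5 x]
  exact e.map_eq_zero_iff

theorem SyzStep.of_equiv_left {Z X Y : Type u} [AddCommGroup Z] [Module A Z] [AddCommGroup Y]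
    [Module A Y] [AddCommGroup X] [Module A X] (e : X ≃ₗ[A] Y) (h : SyzStep A X Z) :
    SyzStep A Y Z := by
  obtain ⟨P, i, p, h1, h2, h3, h4, h5, h6⟩ := h
  refine ⟨P, i ∘ₗ e.symm.toLinearMap, p, h1, h2, h3.comp e.symm.injective, h4, fun x => ?_,
    fun g => ?_⟩
  · rw [h5 x]
    exact ⟨fun ⟨y, hy⟩ => ⟨e y, by simp [hy]⟩, fun ⟨y, hy⟩ => ⟨e.symm y, hy⟩⟩
  · obtain ⟨w, hw⟩ := h6 (g ∘ₗ e.toLinearMap)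
    exact ⟨w, by rw [← LinearMap.comp_assoc, hw, LinearMap.comp_assoc]; simp⟩

theorem SyzGood.of_equiv [IsNoetherianRing A] {X Y : Type u} [AddCommGroup X] [Module A X]
    [AddCommGroup Y] [Module A Y] (h : SyzGood A X) (e : X ≃ₗ[A] Y) : SyzGood A Y := by
  have := h.finite
  have := Module.Finite.equiv e
  refine syzGood_of_forall (fun Z => SyzGood A Z ∨ Nonempty (X ≃ₗ[A] Z)) ?_ Y (.inr ⟨e⟩)
  rintro Z (hZ | ⟨⟨f⟩⟩)
  · obtain ⟨W, hW, hWZ⟩ := hZ.exists_step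
    exact ⟨W, .inl hW, hWZ⟩
  · obtain ⟨W, hW, hWX⟩ := h.exists_step
    exact ⟨W, .inl hW, hWX.of_equiv_right f⟩

theorem SyzGood.of_step [IsNoetherianRing A] {X Y : Type u} [AddCommGroup X] [Module A X]
    [AddCommGroup Y] [Module A Y] (h : SyzGood A X) (hXY : SyzStep A X Y) : SyzGood A Y := by
  have : Module.Finite A Y := by
    obtain ⟨P, i, p, h1, h2, h3, h4, h5, h6⟩ := hXY
    exact Module.Finite.of_surjective p h4
  refine syzGood_of_forall (fun Z => SyzGood A Z ∨ SyzStep A X Z) ?_ Y (.inr hXY)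
  rintro Z (hZ | hZ)
  · obtain ⟨W, hW, hWZ⟩ := hZ.exists_step
    exact ⟨W, .inl hW, hWZ⟩
  · exact ⟨ModuleCat.of A X, .inl h, hZ⟩

end Syzygy

section Chain

theorem exists_int_chain {α : Type*} (r : α → α → Prop) (h : ∀ x, ∃ y, r x y)
    (h' : ∀ x, ∃ y, r y x) (x : α) : ∃ f : ℤ → α, f 0 = x ∧ ∀ n, r (f n) (f (n + 1)) := by
  choose s hs using h
  choose t ht using h'
  refine ⟨fun n => Int.casesOn n (fun k => s^[k] x) fun k => t^[k + 1] x, rfl, fun n => ?_⟩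
  match n with
  | .ofNat k =>
    change r (s^[k] x) (s^[k + 1] x)
    rw [iterate_succ_apply']
    exact hs _
  | .negSucc 0 => exact ht x
  | .negSucc (k + 1) =>
    change r (t^[k + 1 + 1] x) (t^[k + 1] x)
    rw [iterate_succ_apply' t (k + 1)]
    exact ht _

variable {A : Type u} [Ring A]

theorem isGP_of_class (C : ModuleCat.{u} A → Prop) (h : ∀ X, C X → ∃ Y, C Y ∧ SyzStep A X Y)
    (h' : ∀ X, C X → ∃ Y, C Y ∧ SyzStep A Y X) (X : Type u) [AddCommGroup X] [Module A X]
    (hX : C (ModuleCat.of A X)) : IsGP A X := by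
  obtain ⟨f, hf0, hf⟩ := exists_int_chain (α := {X // C X}) (fun X Y => SyzStep A X.1 Y.1)
    (fun X => by obtain ⟨Y, hY, hXY⟩ := h X.1 X.2; exact ⟨⟨Y, hY⟩, hXY⟩)
    (fun X => by obtain ⟨Y, hY, hXY⟩ := h' X.1 X.2; exact ⟨⟨Y, hY⟩, hXY⟩) ⟨_, hX⟩
  choose P i p h1 h2 h3 h4 h5 h6 using hf
  refine ⟨fun n => P n, inferInstance, inferInstance, fun n => i (n + 1) ∘ₗ p n, h1, h2,
    fun n x => ?_, fun n g => ?_, ?_⟩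
  · rw [LinearMap.comp_apply, map_eq_zero_iff _ (h3 _), h5]
    constructor
    · rintro ⟨y, rfl⟩
      obtain ⟨z, rfl⟩ := h4 _ y
      exact ⟨z, rfl⟩
    · rintro ⟨z, rfl⟩
      exact ⟨_, rfl⟩
  · constructor
    · intro hg
      have hg0 : g ∘ₗ i (n + 1) = 0 := by
        rw [← LinearMap.cancel_right (h4 n), LinearMap.zero_comp, ← hg, LinearMap.comp_assoc]
      have hk : LinearMap.ker (p (n + 1)) ≤ LinearMap.ker g := fun x hx => by
        obtain ⟨y, rfl⟩ := (h5 _ x).mp hx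
        exact LinearMap.congr_fun hg0 y
      obtain ⟨w, hw⟩ := h6 (n + 1 + 1) ((LinearMap.ker (p (n + 1))).liftQ g hk ∘ₗ
        ((p (n + 1)).quotKerEquivOfSurjective (h4 _)).symm.toLinearMap)
      refine ⟨w, LinearMap.ext fun x => ?_⟩
      refine (LinearMap.congr_fun hw (p (n + 1) x)).trans ?_
      have : ((p (n + 1)).quotKerEquivOfSurjective (h4 _)).symm (p (n + 1) x) =
          Submodule.Quotient.mk x := by
        rw [LinearEquiv.symm_apply_eq]
        rfl
      rw [LinearMap.comp_apply, LinearEquiv.coe_coe, this]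
      rfl
    · rintro ⟨w, rfl⟩
      refine LinearMap.ext fun x => ?_
      change w (i _ (p _ (i _ (p _ x)))) = 0
      rw [(h5 (n + 1)).apply_apply_eq_zero]
      simp
  · have e0 : Nonempty (X ≃ₗ[A] (f 0).1) := by
      rw [hf0]
      exact ⟨LinearEquiv.refl A X⟩
    have hr : LinearMap.range (i (-1 + 1) ∘ₗ p (-1)) = LinearMap.range (i (-1 + 1)) :=
      LinearMap.range_comp_of_range_eq_top _ (LinearMap.range_eq_top.mpr (h4 _))
    exact ⟨e0.some.trans ((LinearEquiv.ofInjective (i (-1 + 1)) (h3 _)).trans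
      (LinearEquiv.ofEq _ _ hr.symm))⟩

theorem IsGP.exists_class {X : Type u} [AddCommGroup X] [Module A X] (h : IsGP A X) :
    ∃ C : ModuleCat.{u} A → Prop, (∀ X Y : ModuleCat.{u} A, Nonempty (X ≃ₗ[A] Y) → C X → C Y) ∧
      (∀ X, C X → ∃ Y, C Y ∧ SyzStep A X Y) ∧ (∀ X, C X → ∃ Y, C Y ∧ SyzStep A Y X) ∧
      C (ModuleCat.of A X) := by
  obtain ⟨P, _, _, d, h1, h2, h3, h4, ⟨e⟩⟩ := h
  let I (n : ℤ) : ModuleCat.{u} A := ModuleCat.of A (LinearMap.range (d (n + 1)))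
  have hs (n : ℤ) : SyzStep A (I n) (I (n + 1)) := by
    refine ⟨ModuleCat.of A (P (n + 1 + 1)), (LinearMap.range (d (n + 1))).subtype,
      (d (n + 1 + 1)).rangeRestrict, h1 _, h2 _, Submodule.subtype_injective _,
      LinearMap.surjective_rangeRestrict _, fun x => ?_, fun g => ?_⟩
    · rw [← LinearMap.mem_ker, LinearMap.ker_rangeRestrict, LinearMap.mem_ker, h3 (n + 1)]
      exact ⟨fun hx => ⟨⟨x, hx⟩, rfl⟩, fun ⟨y, hy⟩ => hy ▸ y.2⟩
    · obtain ⟨w, hw⟩ := (h4 n (g ∘ₗ (d (n + 1)).rangeRestrict)).mp (LinearMap.ext fun x => by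
        have : (d (n + 1)).rangeRestrict (d n x) = 0 := Subtype.ext ((h3 n).apply_apply_eq_zero x)
        rw [LinearMap.comp_apply, LinearMap.comp_apply, this, map_zero, LinearMap.zero_apply])
      refine ⟨w, ?_⟩
      rw [← LinearMap.cancel_right (d (n + 1)).surjective_rangeRestrict, ← hw]
      rfl
  refine ⟨fun Y => ∃ n, Nonempty (I n ≃ₗ[A] Y), ?_, ?_, ?_, ?_⟩
  · rintro X Y ⟨e⟩ ⟨n, ⟨f⟩⟩
    exact ⟨n, ⟨f.trans e⟩⟩
  · rintro X ⟨n, ⟨f⟩⟩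
    exact ⟨I (n + 1), ⟨_, ⟨LinearEquiv.refl A _⟩⟩, (hs n).of_equiv_left f⟩
  · rintro X ⟨n, ⟨f⟩⟩
    obtain ⟨m, rfl⟩ : ∃ m, n = m + 1 := ⟨n - 1, by ring⟩
    exact ⟨I m, ⟨_, ⟨LinearEquiv.refl A _⟩⟩, (hs m).of_equiv_right f⟩
  · have hk (k : ℤ) (f : X ≃ₗ[A] LinearMap.range (d k)) : ∃ n, Nonempty (I n ≃ₗ[A] X) := by
      obtain ⟨m, rfl⟩ : ∃ m, k = m + 1 := ⟨k - 1, by ring⟩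
      exact ⟨m, ⟨f.symm⟩⟩
    exact hk _ e

end Chain

/-- An anti-isomorphism of rings. -/
structure AntiIso (A B : Type u) [Ring A] [Ring B] where
  e : A ≃+ B
  anti : ∀ x y, e (x * y) = e y * e x

section Pairing

variable {A B : Type u} [Ring A] [Ring B]

/-- The inverse anti-isomorphism. -/
def AntiIso.symm (σ : AntiIso A B) : AntiIso B A where
  e := σ.e.symm
  anti x y := by rw [AddEquiv.symm_apply_eq, σ.anti]; simp

theorem AntiIso.map_one (σ : AntiIso A B) : σ.e 1 = 1 := by
  have h := σ.anti (σ.e.symm 1) 1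
  rw [mul_one, AddEquiv.apply_symm_apply, mul_one] at h
  exact h.symm

/-- The canonical anti-isomorphism to the opposite ring. -/
def AntiIso.op (A : Type u) [Ring A] : AntiIso A Aᵐᵒᵖ where
  e := opAddEquiv
  anti _ _ := rfl

/-- A perfect pairing between a finitely generated projective `A`-module and a finitely generated
projective `B`-module. -/
structure Perf (σ : AntiIso A B) (P Q : Type u) [AddCommGroup P] [Module A P] [AddCommGroup Q]
    [Module B Q] where
  b : P →+ Q →+ A
  smul_left : ∀ a p q, b (a • p) q = a * b p q
  smul_right : ∀ p β q, b p (β • q) = b p q * σ.e.symm β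
  exists_dual : ∃ (n : ℕ) (p : Fin n → P) (q : Fin n → Q), (∀ x, x = ∑ k, b x (q k) • p k) ∧
    ∀ y, y = ∑ k, σ.e (b (p k) y) • q k

variable {σ : AntiIso A B}

section Basics

variable {P Q : Type u} [AddCommGroup P] [Module A P] [AddCommGroup Q] [Module B Q]

/-- The flipped pairing. -/
def Perf.symm (β : Perf σ P Q) : Perf σ.symm Q P where
  b := AddMonoidHom.mk' (fun q => AddMonoidHom.mk' (fun p => σ.e (β.b p q)) fun x y => by simp)
    fun x y => by ext; simp
  smul_left a q p := by
    change σ.e (β.b p (a • q)) = a * σ.e (β.b p q)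
    rw [β.smul_right, σ.anti, AddEquiv.apply_symm_apply]
  smul_right q a p := by
    change σ.e (β.b (a • p) q) = σ.e (β.b p q) * σ.e a
    rw [β.smul_left, σ.anti]
  exists_dual := by
    obtain ⟨n, p, q, hp, hq⟩ := β.exists_dual
    refine ⟨n, q, p, hq, fun x => (hp x).trans (Finset.sum_congr rfl fun k _ => ?_)⟩
    exact congrArg (· • p k) (σ.e.symm_apply_apply _).symm

theorem Perf.symm_b (β : Perf σ P Q) (p : P) (q : Q) : β.symm.b q p = σ.e (β.b p q) := rfl

/-- The functional given by an element of the dual. -/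
def Perf.functional (β : Perf σ P Q) (q : Q) : P →ₗ[A] A where
  toFun p := β.b p q
  map_add' x y := by simp
  map_smul' a x := β.smul_left a x q

theorem Perf.functional_apply (β : Perf σ P Q) (q : Q) (p : P) : β.functional q p = β.b p q := rfl

theorem Perf.exists_functional (β : Perf σ P Q) (f : P →ₗ[A] A) : ∃ q, β.functional q = f := by
  obtain ⟨n, p, q, hp, -⟩ := β.exists_dual
  refine ⟨∑ k, σ.e (f (p k)) • q k, LinearMap.ext fun x => ?_⟩
  conv_rhs => rw [hp x]
  simp [Perf.functional_apply, β.smul_right]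

theorem Perf.finite (β : Perf σ P Q) : Module.Finite A P := by
  obtain ⟨n, p, q, hp, -⟩ := β.exists_dual
  exact Module.Finite.of_surjective (Fintype.linearCombination A p)
    fun x => ⟨fun k => β.b x (q k), (hp x).symm⟩

theorem Perf.projective (β : Perf σ P Q) : Module.Projective A P := by
  obtain ⟨n, p, q, hp, -⟩ := β.exists_dual
  exact Module.Projective.of_split (LinearMap.pi fun k => β.functional (q k))
    (Fintype.linearCombination A p) (LinearMap.ext fun x => (hp x).symm)

theorem Perf.eq_zero_right (β : Perf σ P Q) {q : Q} (h : ∀ p, β.b p q = 0) : q = 0 := by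
  obtain ⟨n, p', q', -, hq⟩ := β.exists_dual
  rw [hq q]
  simp [h]

theorem Perf.eq_zero_left (β : Perf σ P Q) {p : P} (h : ∀ q, β.b p q = 0) : p = 0 :=
  β.symm.eq_zero_right fun q => by rw [Perf.symm_b, h, map_zero]

theorem Perf.eq_right (β : Perf σ P Q) {q q' : Q} (h : ∀ p, β.b p q = β.b p q') : q = q' :=
  sub_eq_zero.mp (β.eq_zero_right fun p => by rw [map_sub, h, sub_self])

theorem Perf.exists_adj {P' Q' : Type u} [AddCommGroup P'] [Module A P'] [AddCommGroup Q']
    [Module B Q'] (β : Perf σ P Q) (β' : Perf σ P' Q') (d : P →ₗ[A] P') :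
    ∃ d' : Q' →ₗ[B] Q, ∀ p q, β.b p (d' q) = β'.b (d p) q := by
  choose f hf using fun q => β.exists_functional (β'.functional q ∘ₗ d)
  replace hf (p q) : β.b p (f q) = β'.b (d p) q := LinearMap.congr_fun (hf q) p
  refine ⟨{ toFun := f, map_add' := fun x y => ?_, map_smul' := fun b x => ?_ }, hf⟩
  · exact β.eq_right fun p => by simp [hf]
  · exact β.eq_right fun p => by simp [hf, Perf.smul_right]

end Basics

/-- The dual of an `A`-module, as a `B`-module. -/
def DualMod (_ : AntiIso A B) (P : Type u) [AddCommGroup P] [Module A P] : Type u := P →ₗ[A] A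

variable (σ) (P : Type u) [AddCommGroup P] [Module A P]

instance : AddCommGroup (DualMod σ P) := inferInstanceAs (AddCommGroup (P →ₗ[A] A))

/-- Read an element of the dual as a functional. -/
def DualMod.toHom (f : DualMod σ P) : P →ₗ[A] A := f

instance : SMul B (DualMod σ P) :=
  ⟨fun b f => (LinearMap.toSpanSingleton A A (σ.e.symm b)).comp (DualMod.toHom σ P f)⟩

theorem DualMod.smul_apply (b : B) (f : DualMod σ P) (x : P) :
    DualMod.toHom σ P (b • f) x = DualMod.toHom σ P f x * σ.e.symm b := rfl

theorem DualMod.add_apply (f g : DualMod σ P) (x : P) :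
    DualMod.toHom σ P (f + g) x = DualMod.toHom σ P f x + DualMod.toHom σ P g x := rfl

theorem DualMod.ext {f g : DualMod σ P} (h : ∀ x, DualMod.toHom σ P f x = DualMod.toHom σ P g x) :
    f = g := LinearMap.ext h

instance : Module B (DualMod σ P) where
  one_smul f := DualMod.ext σ P fun x => by
    rw [DualMod.smul_apply]
    exact (congrArg _ σ.symm.map_one).trans (mul_one _)
  mul_smul a b f := DualMod.ext σ P fun x => by
    simp only [DualMod.smul_apply]
    exact (congrArg _ (σ.symm.anti a b)).trans (mul_assoc _ _ _).symm
  smul_zero b := DualMod.ext σ P fun x => by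
    rw [DualMod.smul_apply]
    exact zero_mul _
  smul_add b f g := DualMod.ext σ P fun x => by
    simp only [DualMod.smul_apply, DualMod.add_apply, add_mul]
  add_smul a b f := DualMod.ext σ P fun x => by
    simp only [DualMod.smul_apply, DualMod.add_apply, map_add, mul_add]
  zero_smul f := DualMod.ext σ P fun x => by
    rw [DualMod.smul_apply, map_zero, mul_zero]
    rfl

/-- The evaluation pairing. -/
def evalPerf [Module.Finite A P] [Module.Projective A P] : Perf σ P (DualMod σ P) where
  b := AddMonoidHom.mk' (fun p => AddMonoidHom.mk' (fun f => DualMod.toHom σ P f p)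
    fun f g => DualMod.add_apply σ P f g p) fun x y => by
      ext f
      exact map_add (DualMod.toHom σ P f) x y
  smul_left a p f := map_smul (DualMod.toHom σ P f) a p
  smul_right p b f := DualMod.smul_apply σ P b f p
  exists_dual := by
    obtain ⟨n, f, hf⟩ := Module.Finite.exists_fin' A P
    obtain ⟨g, hg⟩ := Module.projective_lifting_property f LinearMap.id hf
    have hx (x : P) : x = ∑ k, g x k • f (Pi.single k 1) := by
      have h := LinearMap.congr_fun hg x
      rw [LinearMap.comp_apply, LinearMap.id_apply] at h
      conv_lhs => rw [← h, pi_eq_sum_univ (g x)]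
      rw [map_sum]
      refine Finset.sum_congr rfl fun k _ => ?_
      rw [map_smul]
      congr 2
      ext j
      simp [Pi.single_apply, eq_comm]
    let q : Fin n → DualMod σ P := fun k => (LinearMap.proj k ∘ₗ g : P →ₗ[A] A)
    refine ⟨n, fun k => f (Pi.single k 1), q, fun x => hx x, fun y => DualMod.ext σ P fun x => ?_⟩
    let ev : DualMod σ P →+ A := AddMonoidHom.mk' (fun f => DualMod.toHom σ P f x)
      fun f g => DualMod.add_apply σ P f g x
    change DualMod.toHom σ P y x = ev _
    rw [map_sum]
    conv_lhs => rw [hx x, map_sum]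
    refine Finset.sum_congr rfl fun k _ => ?_
    rw [map_smul]
    refine Eq.trans ?_ (DualMod.smul_apply σ P _ _ x).symm
    rw [AddEquiv.symm_apply_apply]
    rfl

end Pairing

/-- A map of finitely generated projective modules together with its dual. -/
structure DPres {A B : Type u} [Ring A] [Ring B] (σ : AntiIso A B) : Type (u + 1) where
  P₁ : ModuleCat.{u} A
  P₀ : ModuleCat.{u} A
  Q₁ : ModuleCat.{u} B
  Q₀ : ModuleCat.{u} B
  b₁ : Perf σ P₁ Q₁
  b₀ : Perf σ P₀ Q₀
  d : P₁ →ₗ[A] P₀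
  d' : Q₀ →ₗ[B] Q₁
  adj : ∀ p q, b₁.b p (d' q) = b₀.b (d p) q

section DPres

variable {A B : Type u} [Ring A] [Ring B] {σ : AntiIso A B}

/-- The dual map together with the original one. -/
def DPres.swap (c : DPres σ) : DPres σ.symm where
  P₁ := c.Q₀
  P₀ := c.Q₁
  Q₁ := c.P₀
  Q₀ := c.P₁
  b₁ := c.b₀.symm
  b₀ := c.b₁.symm
  d := c.d'
  d' := c.d
  adj q p := congrArg σ.e (c.adj p q).symm

/-- The cokernel of the map. -/
abbrev DPres.coker (c : DPres σ) : Type u := c.P₀ ⧸ LinearMap.range c.d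

/-- A map of finitely generated projective modules, with the canonical dual. -/
theorem exists_dPres (σ : AntiIso A B) {P₁ P₀ : Type u} [AddCommGroup P₁] [Module A P₁]
    [AddCommGroup P₀] [Module A P₀] [Module.Finite A P₁] [Module.Projective A P₁]
    [Module.Finite A P₀] [Module.Projective A P₀] (d : P₁ →ₗ[A] P₀) :
    ∃ (Q₁ Q₀ : ModuleCat.{u} B) (b₁ : Perf σ P₁ Q₁) (b₀ : Perf σ P₀ Q₀) (d' : Q₀ →ₗ[B] Q₁),
      ∀ p q, b₁.b p (d' q) = b₀.b (d p) q := by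
  obtain ⟨d', h⟩ := (evalPerf σ P₁).exists_adj (evalPerf σ P₀) d
  exact ⟨ModuleCat.of B (DualMod σ P₁), ModuleCat.of B (DualMod σ P₀), evalPerf σ P₁,
    evalPerf σ P₀, d', h⟩

theorem syzStep_of_exact {P₂ P₁ P₀ Q₂ Q₁ Q₀ : Type u} [AddCommGroup P₂] [Module A P₂]
    [AddCommGroup P₁] [Module A P₁] [AddCommGroup P₀] [Module A P₀] [AddCommGroup Q₂] [Module B Q₂]
    [AddCommGroup Q₁] [Module B Q₁] [AddCommGroup Q₀] [Module B Q₀] (b₂ : Perf σ P₂ Q₂)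
    (b₁ : Perf σ P₁ Q₁) (b₀ : Perf σ P₀ Q₀) {e : P₂ →ₗ[A] P₁} {d : P₁ →ₗ[A] P₀}
    {e' : Q₁ →ₗ[B] Q₂} {d' : Q₀ →ₗ[B] Q₁} (he : ∀ p q, b₂.b p (e' q) = b₁.b (e p) q)
    (hd : ∀ p q, b₁.b p (d' q) = b₀.b (d p) q) (hed : Exact e d)
    (hext : ∀ g : P₁ →ₗ[A] A, g ∘ₗ e = 0 → ∃ w : P₀ →ₗ[A] A, w ∘ₗ d = g) :
    SyzStep B (Q₁ ⧸ LinearMap.range d') (Q₂ ⧸ LinearMap.range e') := by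
  have h0 : LinearMap.range d' ≤ LinearMap.ker e' := by
    rintro _ ⟨q, rfl⟩
    refine b₂.eq_zero_right fun p => ?_
    rw [he, hd, hed.apply_apply_eq_zero]
    simp
  have h1 : LinearMap.ker e' ≤ LinearMap.range d' := fun q hq => by
    obtain ⟨w, hw⟩ := hext (b₁.functional q) (LinearMap.ext fun p => by
      rw [LinearMap.comp_apply, Perf.functional_apply, ← he, LinearMap.mem_ker.mp hq]
      simp)
    obtain ⟨q₀, rfl⟩ := b₀.exists_functional w
    refine ⟨q₀, b₁.eq_right fun p => ?_⟩
    rw [hd]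
    exact LinearMap.congr_fun hw p
  refine ⟨ModuleCat.of B Q₂, (LinearMap.range d').liftQ e' h0, Submodule.mkQ _, b₂.symm.finite,
    b₂.symm.projective, ?_, Submodule.mkQ_surjective _, fun q => ?_, fun g => ?_⟩
  · rw [← LinearMap.ker_eq_bot]
    exact Submodule.ker_liftQ_eq_bot _ _ _ h1
  · rw [← LinearMap.mem_ker, Submodule.ker_mkQ]
    refine ⟨fun ⟨x, hx⟩ => ⟨Submodule.Quotient.mk x, hx⟩, fun ⟨x, hx⟩ => ?_⟩
    obtain ⟨y, rfl⟩ := Submodule.mkQ_surjective _ x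
    exact ⟨y, hx⟩
  · obtain ⟨p₁, hp₁⟩ := b₁.symm.exists_functional (g ∘ₗ Submodule.mkQ _)
    have hp₁' (q) : σ.e (b₁.b p₁ q) = g (Submodule.Quotient.mk q) := LinearMap.congr_fun hp₁ q
    have hdp : d p₁ = 0 := b₀.eq_zero_left fun q => σ.e.injective <| by
      have hq : (Submodule.Quotient.mk (d' q) : Q₁ ⧸ LinearMap.range d') = 0 :=
        (Submodule.Quotient.mk_eq_zero _).mpr ⟨q, rfl⟩
      rw [← hd, hp₁', hq]
      simp
    obtain ⟨p₂, rfl⟩ := (hed p₁).mp hdp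
    refine ⟨b₂.symm.functional p₂, Submodule.linearMap_qext _ (LinearMap.ext fun q => ?_)⟩
    refine Eq.trans ?_ (hp₁' q)
    change σ.e (b₂.b p₂ (e' q)) = _
    rw [he]

/-- Both the cokernel and the dual cokernel have good syzygies. -/
def DPres.Good (c : DPres σ) : Prop := SyzGood A c.coker ∧ SyzGood B c.swap.coker

theorem exists_extend_of_ker_le {X P₁ P₀ : Type u} [AddCommGroup X] [Module A X] [AddCommGroup P₁]
    [Module A P₁] [AddCommGroup P₀] [Module A P₀] [Module.Finite A P₀] [Module.Projective A P₀]
    (h : SyzGood A X) (p : P₀ →ₗ[A] X) (hp : Surjective p) (d : P₁ →ₗ[A] P₀) (hdp : Exact d p)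
    (g : P₁ →ₗ[A] A) (hg : LinearMap.ker d ≤ LinearMap.ker g) : ∃ w : P₀ →ₗ[A] A, w ∘ₗ d = g := by
  let e : (P₁ ⧸ LinearMap.ker d) ≃ₗ[A] LinearMap.ker p :=
    d.quotKerEquivRange.trans (LinearEquiv.ofEq _ _ hdp.linearMap_ker_eq.symm)
  obtain ⟨w, hw⟩ := h.extend p hp ((LinearMap.ker d).liftQ g hg ∘ₗ e.symm.toLinearMap)
  refine ⟨w, LinearMap.ext fun x => ?_⟩
  have := LinearMap.congr_fun hw (e (Submodule.Quotient.mk x))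
  simp only [LinearMap.comp_apply, LinearEquiv.coe_coe, LinearEquiv.symm_apply_apply] at this
  exact this

theorem DPres.Good.exists_left [IsNoetherianRing A] [IsNoetherianRing B] {c : DPres σ}
    (h : c.Good) : ∃ c' : DPres σ, c'.Good ∧ SyzStep A c'.coker c.coker ∧
      SyzStep B c.swap.coker c'.swap.coker := by
  have := c.b₁.finite; have := c.b₁.projective; have := c.b₀.finite; have := c.b₀.projective
  obtain ⟨n, p, hp⟩ := Module.Finite.exists_fin' A (LinearMap.ker c.d)
  let e : (Fin n → A) →ₗ[A] c.P₁ := (LinearMap.ker c.d).subtype ∘ₗ p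
  have hr : LinearMap.range e = LinearMap.ker c.d := by
    rw [LinearMap.range_comp_of_range_eq_top _ (LinearMap.range_eq_top.mpr hp),
      Submodule.range_subtype]
  have hed : Exact e c.d := LinearMap.exact_iff.mpr hr.symm
  have hdm : Exact c.d (LinearMap.range c.d).mkQ := LinearMap.exact_map_mkQ_range _
  have hm := (LinearMap.range c.d).mkQ_surjective
  have hext := exists_extend_of_ker_le h.1 _ hm c.d hdm
  let Pe := ModuleCat.of A (Fin n → A)
  let be := evalPerf σ (Fin n → A)
  obtain ⟨e', he⟩ := be.exists_adj c.b₁ e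
  let c' : DPres σ := ⟨Pe, c.P₁, ModuleCat.of B (DualMod σ (Fin n → A)), c.Q₁, be, c.b₁, e, e', he⟩
  have hst : SyzStep B c.swap.coker c'.swap.coker :=
    syzStep_of_exact be c.b₁ c.b₀ he c.adj hed fun g hg => hext g <| by
      rw [← hr]
      rintro _ ⟨x, rfl⟩
      exact LinearMap.congr_fun hg x
  let ι : (c.P₁ ⧸ LinearMap.range e) ≃ₗ[A] LinearMap.ker (LinearMap.range c.d).mkQ :=
    (Submodule.quotEquivOfEq _ _ hr).trans
      (c.d.quotKerEquivRange.trans (LinearEquiv.ofEq _ _ hdm.linearMap_ker_eq.symm))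
  have hst' : SyzStep A c'.coker c.coker := by
    refine SyzStep.of_equiv_left ι.symm ⟨c.P₀, Submodule.subtype _, Submodule.mkQ _, inferInstance,
      inferInstance, Submodule.subtype_injective _, hm, LinearMap.exact_subtype_ker_map _, ?_⟩
    exact fun g => h.1.extend _ hm g
  exact ⟨c', ⟨(h.1.ker _ hm).of_equiv ι.symm, h.2.of_step hst⟩, hst', hst⟩

theorem DPres.Good.swap {c : DPres σ} (h : c.Good) : c.swap.Good := ⟨h.2, h.1⟩

theorem DPres.Good.exists_right [IsNoetherianRing A] [IsNoetherianRing B] {c : DPres σ}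
    (h : c.Good) : ∃ c' : DPres σ, c'.Good ∧ SyzStep A c.coker c'.coker := by
  obtain ⟨c', h1, -, h2⟩ := h.swap.exists_left
  exact ⟨c'.swap, h1.swap, h2⟩

theorem DPres.Good.isGP [IsNoetherianRing A] [IsNoetherianRing B] {c : DPres σ}
    (h : c.Good) : IsGP A c.coker := by
  refine isGP_of_class (fun X => ∃ c : DPres σ, c.Good ∧ X = ModuleCat.of A c.coker) ?_ ?_ _
    ⟨c, h, rfl⟩
  · rintro _ ⟨c, h, rfl⟩
    obtain ⟨c', h', hs⟩ := h.exists_right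
    exact ⟨_, ⟨c', h', rfl⟩, hs⟩
  · rintro _ ⟨c, h, rfl⟩
    obtain ⟨c', h', hs, -⟩ := h.exists_left
    exact ⟨_, ⟨c', h', rfl⟩, hs⟩

theorem DPres.good_of_isGP [IsNoetherianRing A] [IsNoetherianRing B] {c : DPres σ}
    (h : IsGP A c.coker) : c.Good := by
  have := c.b₀.finite
  have := c.swap.b₀.finite
  have hf : Module.Finite B c.swap.P₀ := c.swap.b₀.finite
  obtain ⟨C, hiso, hup, hdown, hC⟩ := h.exists_class
  refine ⟨syzGood_of_forall C hdown _ hC, syzGood_of_forall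
    (fun Y => ∃ c : DPres σ, C (ModuleCat.of A c.coker) ∧ Y = ModuleCat.of B c.swap.coker) ?_ _
    ⟨c, hC, rfl⟩⟩
  rintro _ ⟨c, hc, rfl⟩
  obtain ⟨N, hN, P, i, p, _, _, hi, hp, hip, hext⟩ := hup _ hc
  have := c.b₀.finite; have := c.b₀.projective
  let e : c.P₀ →ₗ[A] P := i ∘ₗ (LinearMap.range c.d).mkQ
  have hr : LinearMap.range e = LinearMap.ker p := by
    rw [LinearMap.range_comp_of_range_eq_top _ (Submodule.range_mkQ _), hip.linearMap_ker_eq]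
  let bP := evalPerf σ P
  obtain ⟨e', he⟩ := c.b₀.exists_adj bP e
  let c' : DPres σ := ⟨c.P₀, P, c.Q₀, ModuleCat.of B (DualMod σ P), c.b₀, bP, e, e', he⟩
  refine ⟨_, ⟨c', hiso N _ ⟨?_⟩ hN, rfl⟩, ?_⟩
  · exact (p.quotKerEquivOfSurjective hp).symm.trans (Submodule.quotEquivOfEq _ _ hr.symm)
  · refine syzStep_of_exact c.b₁ c.b₀ bP c.adj he ?_ fun g hg => ?_
    · rw [LinearMap.exact_iff, LinearMap.ker_comp_of_ker_eq_bot _ (LinearMap.ker_eq_bot.mpr hi),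
        Submodule.ker_mkQ]
    · obtain ⟨w, hw⟩ := hext ((LinearMap.range c.d).liftQ g (by
        rintro _ ⟨x, rfl⟩
        exact LinearMap.congr_fun hg x))
      refine ⟨w, LinearMap.ext fun x => ?_⟩
      exact LinearMap.congr_fun hw (Submodule.Quotient.mk x)

/-- The cokernel is Gorenstein projective if and only if the dual cokernel is. -/
theorem DPres.isGP_iff [IsNoetherianRing A] [IsNoetherianRing B] (c : DPres σ) :
    IsGP A c.coker ↔ IsGP B c.swap.coker :=
  ⟨fun h => (DPres.good_of_isGP h).swap.isGP, fun h => (DPres.good_of_isGP h).swap.isGP⟩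

end DPres

section Adj

variable {A B : Type u} [Ring A] [Ring B] {σ : AntiIso A B}
variable {P Q P' Q' P'' Q'' : Type u} [AddCommGroup P] [Module A P] [AddCommGroup Q] [Module B Q]
  [AddCommGroup P'] [Module A P'] [AddCommGroup Q'] [Module B Q']
  [AddCommGroup P''] [Module A P''] [AddCommGroup Q''] [Module B Q'']

/-- Adjoint maps with respect to two perfect pairings. -/
def Adj (β : Perf σ P Q) (β' : Perf σ P' Q') (f : P →ₗ[A] P') (g : Q' →ₗ[B] Q) : Prop :=
  ∀ p q, β.b p (g q) = β'.b (f p) q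

variable {β : Perf σ P Q} {β' : Perf σ P' Q'} {β'' : Perf σ P'' Q''}

theorem Adj.symm {f : P →ₗ[A] P'} {g : Q' →ₗ[B] Q} (h : Adj β β' f g) :
    Adj β'.symm β.symm g f := fun q p => congrArg σ.e (h p q).symm

variable (β β') in
theorem exists_adj_left (g : Q' →ₗ[B] Q) : ∃ f, Adj β β' f g := by
  obtain ⟨f, hf⟩ := β'.symm.exists_adj β.symm g
  exact ⟨f, fun p q => σ.e.injective (hf q p).symm⟩

theorem Adj.comp {f : P →ₗ[A] P'} {g : Q' →ₗ[B] Q} {f' : P' →ₗ[A] P''} {g' : Q'' →ₗ[B] Q'}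
    (h : Adj β β' f g) (h' : Adj β' β'' f' g') : Adj β β'' (f' ∘ₗ f) (g ∘ₗ g') := fun p q =>
  (h p (g' q)).trans (h' (f p) q)

theorem Adj.right_unique {f : P →ₗ[A] P'} {g g' : Q' →ₗ[B] Q} (h : Adj β β' f g)
    (h' : Adj β β' f g') : g = g' :=
  LinearMap.ext fun q => β.eq_right fun p => (h p q).trans (h' p q).symm

theorem Adj.left_unique {f f' : P →ₗ[A] P'} {g : Q' →ₗ[B] Q} (h : Adj β β' f g)
    (h' : Adj β β' f' g) : f = f' := h.symm.right_unique h'.symm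

variable (β) in
theorem Adj.id : Adj β β LinearMap.id LinearMap.id := fun _ _ => rfl

theorem Adj.zero : Adj β β' 0 0 := fun p q => by simp

theorem Adj.add {f f' : P →ₗ[A] P'} {g g' : Q' →ₗ[B] Q} (h : Adj β β' f g) (h' : Adj β β' f' g') :
    Adj β β' (f + f') (g + g') := fun p q => by simp [h p q, h' p q]

theorem Adj.pow {f : P →ₗ[A] P} {g : Q →ₗ[B] Q} (h : Adj β β f g) (k : ℕ) :
    Adj β β ((f : Module.End A P) ^ k) ((g : Module.End B Q) ^ k) := by
  induction k with
  | zero => exact Adj.id β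
  | succ k ih =>
    rw [pow_succ, pow_succ']
    exact Adj.comp h ih

theorem Adj.isNilpotent {f : Module.End A P} {g : Module.End B Q} (h : Adj β β f g)
    (hf : IsNilpotent f) : IsNilpotent g := by
  obtain ⟨k, hk⟩ := hf
  have := h.pow k
  rw [hk] at this
  exact ⟨k, this.right_unique Adj.zero⟩

theorem Adj.exists_equiv {f : P ≃ₗ[A] P'} {g : Q' →ₗ[B] Q} (h : Adj β β' f g) :
    ∃ e : Q' ≃ₗ[B] Q, e.toLinearMap = g := by
  obtain ⟨g', h'⟩ := β'.exists_adj β f.symm.toLinearMap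
  have e1 : g ∘ₗ g' = LinearMap.id := by
    have := h.comp h'
    rw [LinearEquiv.symm_comp] at this
    exact this.right_unique (Adj.id β)
  have e2 : g' ∘ₗ g = LinearMap.id := by
    have := Adj.comp h' h
    rw [LinearEquiv.comp_symm] at this
    exact this.right_unique (Adj.id β')
  exact ⟨LinearEquiv.ofLinearMap g g' e1 e2, rfl⟩

theorem Adj.bijective {f : P →ₗ[A] P'} {g : Q' →ₗ[B] Q} (h : Adj β β' f g) (hf : Bijective f) :
    Bijective g := by
  obtain ⟨e, he⟩ := Adj.exists_equiv (f := LinearEquiv.ofBijective f hf) h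
  rw [← he]
  exact e.bijective

theorem Adj.exists_equiv_right (β : Perf σ P Q) (β' : Perf σ P' Q') (f : P ≃ₗ[A] P') :
    Nonempty (Q ≃ₗ[B] Q') := by
  obtain ⟨g, h⟩ := β.exists_adj β' f.toLinearMap
  obtain ⟨e, -⟩ := Adj.exists_equiv (f := f) h
  exact ⟨e.symm⟩

end Adj

section Complexes

variable {A B : Type u} [Ring A] [Ring B] {σ : AntiIso A B}

/-- Isomorphism of complexes. -/
def DPres.Iso (c c' : DPres σ) : Prop :=
  ∃ (f₁ : c.P₁ ≃ₗ[A] c'.P₁) (f₀ : c.P₀ ≃ₗ[A] c'.P₀), ∀ x, f₀ (c.d x) = c'.d (f₁ x)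

theorem DPres.Iso.symm {c c' : DPres σ} (h : c.Iso c') : c'.Iso c := by
  obtain ⟨f₁, f₀, h⟩ := h
  exact ⟨f₁.symm, f₀.symm, fun x => by rw [LinearEquiv.symm_apply_eq, h]; simp⟩

theorem DPres.Iso.swap {c c' : DPres σ} (h : c.Iso c') : c'.swap.Iso c.swap := by
  obtain ⟨f₁, f₀, h⟩ := h
  obtain ⟨g₁, h₁⟩ := c.b₁.exists_adj c'.b₁ f₁.toLinearMap
  obtain ⟨g₀, h₀⟩ := c.b₀.exists_adj c'.b₀ f₀.toLinearMap
  obtain ⟨e₁, rfl⟩ := Adj.exists_equiv (f := f₁) h₁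
  obtain ⟨e₀, rfl⟩ := Adj.exists_equiv (f := f₀) h₀
  have hc : Adj c.b₁ c.b₀ c.d c.d' := c.adj
  have hc' : Adj c'.b₁ c'.b₀ c'.d c'.d' := c'.adj
  have e1 := Adj.comp hc h₀
  rw [show f₀.toLinearMap ∘ₗ c.d = c'.d ∘ₗ f₁.toLinearMap from LinearMap.ext h] at e1
  exact ⟨e₀, e₁, fun x => LinearMap.congr_fun ((Adj.comp h₁ hc').right_unique e1) x⟩

theorem DPres.Iso.coker {c c' : DPres σ} (h : c.Iso c') : Nonempty (c.coker ≃ₗ[A] c'.coker) := by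
  obtain ⟨f₁, f₀, h⟩ := h
  refine ⟨Submodule.Quotient.equiv _ _ f₀ ?_⟩
  ext y
  constructor
  · rintro ⟨_, ⟨x, rfl⟩, rfl⟩
    exact ⟨f₁ x, (h x).symm⟩
  · rintro ⟨x, rfl⟩
    exact ⟨c.d (f₁.symm x), ⟨_, rfl⟩, (h _).trans (by simp)⟩

/-- Indecomposable complexes. -/
def DPres.IC (c : DPres σ) : Prop :=
  ¬ Bijective c.d ∧ ∀ (f₁ : Module.End A c.P₁) (f₀ : Module.End A c.P₀),
    (∀ x, f₀ (c.d x) = c.d (f₁ x)) →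
      (IsNilpotent f₁ ∧ IsNilpotent f₀) ∨ (Bijective f₁ ∧ Bijective f₀)

theorem DPres.IC.swap {c : DPres σ} (h : c.IC) : c.swap.IC := by
  have hc : Adj c.b₁ c.b₀ c.d c.d' := c.adj
  refine ⟨fun hb => h.1 (Adj.bijective hc.symm hb), fun g₀ g₁ hg => ?_⟩
  obtain ⟨f₀, h₀⟩ := exists_adj_left c.b₀ c.b₀ g₀
  obtain ⟨f₁, h₁⟩ := exists_adj_left c.b₁ c.b₁ g₁
  have e0 : (g₁ : c.Q₁ →ₗ[B] c.Q₁) ∘ₗ c.d' = c.d' ∘ₗ (g₀ : c.Q₀ →ₗ[B] c.Q₀) := LinearMap.ext hg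
  have e1 : Adj c.b₁ c.b₀ (c.d ∘ₗ f₁) (c.d' ∘ₗ (g₀ : c.Q₀ →ₗ[B] c.Q₀)) := e0 ▸ Adj.comp h₁ hc
  rcases h.2 f₁ f₀ (LinearMap.congr_fun ((Adj.comp hc h₀).left_unique e1)) with ⟨a, b⟩ | ⟨a, b⟩
  · exact Or.inl ⟨h₀.isNilpotent b, h₁.isNilpotent a⟩
  · exact Or.inr ⟨h₀.bijective b, h₁.bijective a⟩

/-- Maps between cokernels lift to maps of complexes. -/
theorem DPres.exists_lift {c c' : DPres σ} (g : c.coker →ₗ[A] c'.coker) :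
    ∃ (f₁ : c.P₁ →ₗ[A] c'.P₁) (f₀ : c.P₀ →ₗ[A] c'.P₀), (∀ x, f₀ (c.d x) = c'.d (f₁ x)) ∧
      ∀ x, g (Submodule.Quotient.mk x) = Submodule.Quotient.mk (f₀ x) := by
  have := c.b₀.projective
  have := c.b₁.projective
  obtain ⟨f₀, h₀⟩ := Module.projective_lifting_property (LinearMap.range c'.d).mkQ
    (g ∘ₗ (LinearMap.range c.d).mkQ) (Submodule.mkQ_surjective _)
  have h0 (x) : (Submodule.Quotient.mk (f₀ x) : c'.coker) = g (Submodule.Quotient.mk x) :=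
    LinearMap.congr_fun h₀ x
  have hr (x) : f₀ (c.d x) ∈ LinearMap.range c'.d := by
    have hx : (Submodule.Quotient.mk (c.d x) : c.coker) = 0 :=
      (Submodule.Quotient.mk_eq_zero _).mpr ⟨x, rfl⟩
    rw [← Submodule.Quotient.mk_eq_zero, h0, hx, map_zero]
  obtain ⟨f₁, h₁⟩ := Module.projective_lifting_property c'.d.rangeRestrict
    (LinearMap.codRestrict (LinearMap.range c'.d) (f₀ ∘ₗ c.d) hr) c'.d.surjective_rangeRestrict
  exact ⟨f₁, f₀, fun x => (congrArg Subtype.val (LinearMap.congr_fun h₁ x)).symm,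
    fun x => (h0 x).symm⟩

theorem DPres.IC.nilpotent_or_bijective [IsNoetherianRing A] {c : DPres σ} (h : c.IC)
    (g : Module.End A c.coker) : IsNilpotent g ∨ Bijective g := by
  obtain ⟨f₁, f₀, hf, hg⟩ := DPres.exists_lift g
  have := c.b₀.finite
  rcases h.2 f₁ f₀ hf with ⟨-, k, hk⟩ | ⟨-, hb⟩
  · refine Or.inl ⟨k, LinearMap.ext fun x => ?_⟩
    have key (j : ℕ) (x : c.P₀) : (g ^ j) (Submodule.Quotient.mk x) =
        (Submodule.Quotient.mk ((f₀ ^ j) x) : c.coker) := by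
      induction j with
      | zero => rfl
      | succ j ih =>
        rw [pow_succ', pow_succ']
        exact (congrArg g ih).trans (hg _)
    obtain ⟨y, rfl⟩ := Submodule.mkQ_surjective _ x
    refine (key k y).trans ?_
    rw [hk]
    exact Submodule.Quotient.mk_zero _
  · have hs : Surjective g := fun x => by
      obtain ⟨y, rfl⟩ := Submodule.mkQ_surjective _ x
      obtain ⟨z, rfl⟩ := hb.2 y
      exact ⟨Submodule.Quotient.mk z, hg z⟩
    exact Or.inr ⟨IsNoetherian.injective_of_surjective_endomorphism g hs, hs⟩

theorem DPres.IC.iso_of_coker {c c' : DPres σ} (h : c.IC)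
    (h' : c'.IC) [Nontrivial c.coker] (e : c.coker ≃ₗ[A] c'.coker) : c.Iso c' := by
  have key {c c' : DPres σ} (h : c.IC) [Nontrivial c.coker] (e : c.coker ≃ₗ[A] c'.coker)
      (f₁ : c.P₁ →ₗ[A] c'.P₁) (f₀ : c.P₀ →ₗ[A] c'.P₀) (g₁ : c'.P₁ →ₗ[A] c.P₁)
      (g₀ : c'.P₀ →ₗ[A] c.P₀) (hf : ∀ x, f₀ (c.d x) = c'.d (f₁ x))
      (hg : ∀ x, g₀ (c'.d x) = c.d (g₁ x))
      (hf' : ∀ x, e (Submodule.Quotient.mk x) = Submodule.Quotient.mk (f₀ x))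
      (hg' : ∀ x, e.symm (Submodule.Quotient.mk x) = Submodule.Quotient.mk (g₀ x)) :
      Bijective (g₁ ∘ₗ f₁) ∧ Bijective (g₀ ∘ₗ f₀) := by
    refine (h.2 (g₁ ∘ₗ f₁) (g₀ ∘ₗ f₀) fun x => ?_).resolve_left ?_
    · simp [hf, hg]
    · rintro ⟨-, k, hk⟩
      obtain ⟨x, hx⟩ := exists_ne (0 : c.coker)
      obtain ⟨y, rfl⟩ := Submodule.mkQ_surjective _ x
      have hj (j : ℕ) : (Submodule.Quotient.mk (((g₀ ∘ₗ f₀ : Module.End A c.P₀) ^ j) y) : c.coker) =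
          Submodule.Quotient.mk y := by
        induction j with
        | zero => rfl
        | succ j ih =>
          rw [pow_succ', ← ih]
          refine (hg' _).symm.trans ?_
          rw [← hf', LinearEquiv.symm_apply_apply]
      refine hx ((hj k).symm.trans ?_)
      rw [hk]
      exact Submodule.Quotient.mk_zero _
  have : Nontrivial c'.coker := e.symm.toEquiv.nontrivial
  obtain ⟨f₁, f₀, hf, hf'⟩ := DPres.exists_lift e.toLinearMap
  obtain ⟨g₁, g₀, hg, hg'⟩ := DPres.exists_lift e.symm.toLinearMap
  obtain ⟨a1, a0⟩ := key h e f₁ f₀ g₁ g₀ hf hg hf' hg'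
  obtain ⟨b1, b0⟩ := key h' e.symm g₁ g₀ f₁ f₀ hg hf hg' hf'
  exact ⟨LinearEquiv.ofBijective f₁ ⟨Injective.of_comp (f := g₁) a1.1, Surjective.of_comp (g := g₁) b1.2⟩,
    LinearEquiv.ofBijective f₀ ⟨Injective.of_comp (f := g₀) a0.1, Surjective.of_comp (g := g₀) b0.2⟩, hf⟩

theorem DPres.IC.subsingleton_P₀ {c : DPres σ} (h : c.IC) [Subsingleton c.coker] :
    Subsingleton c.P₀ := by
  have := c.b₀.projective
  have hs : Surjective c.d := by
    rw [← LinearMap.range_eq_top]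
    exact Submodule.Quotient.subsingleton_iff.mp ‹_›
  obtain ⟨s, hs'⟩ := Module.projective_lifting_property c.d LinearMap.id hs
  have hs'' (x) : c.d (s x) = x := LinearMap.congr_fun hs' x
  rcases h.2 (s ∘ₗ c.d) 1 fun x => (hs'' _).symm with ⟨-, k, hk⟩ | ⟨hb, -⟩
  · rw [one_pow] at hk
    exact ⟨fun x y => by
      have := LinearMap.congr_fun hk
      exact (this x).trans (this y).symm⟩
  · exact absurd ⟨Injective.of_comp (f := s) hb.1, hs⟩ h.1

end Complexes

section Nilpotent

variable {A : Type u} [Ring A]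

theorem isNilpotent_of_range_le {P : Type u} [AddCommGroup P] [Module A P] [IsNoetherian A P]
    [IsArtinian A P] {U : Submodule A P} (hU : IsSuperfluous A U) (h : Module.End A P) (k : ℕ)
    (hk : LinearMap.range (h ^ k) ≤ U) : IsNilpotent h := by
  obtain ⟨n, hn, hkn⟩ := ((LinearMap.eventually_isCompl_ker_pow_range_pow h).and
    (Filter.eventually_ge_atTop k)).exists
  refine ⟨n, superfluous_map_eq hU _ ?_⟩
  have hle : LinearMap.range (h ^ n) ≤ U := by
    refine le_trans ?_ hk
    obtain ⟨j, rfl⟩ := Nat.exists_eq_add_of_le hkn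
    rw [pow_add]
    exact LinearMap.range_comp_le_range _ _
  rintro _ ⟨x, rfl⟩
  obtain ⟨y, hy, z, hz, rfl⟩ := Submodule.mem_sup.mp
    (hn.sup_eq_top.symm ▸ Submodule.mem_top : x ∈ LinearMap.ker (h ^ n) ⊔ LinearMap.range (h ^ n))
  exact ⟨z, hle hz, by rw [map_add, LinearMap.mem_ker.mp hy, zero_add]⟩

theorem bijective_of_range_sup {P : Type u} [AddCommGroup P] [Module A P] [IsNoetherian A P]
    {U : Submodule A P} (hU : IsSuperfluous A U) (h : Module.End A P)
    (hk : U ⊔ LinearMap.range h = ⊤) : Bijective h := by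
  have hs : Surjective h := LinearMap.range_eq_top.mp (hU _ hk)
  exact ⟨IsNoetherian.injective_of_surjective_endomorphism h hs, hs⟩

end Nilpotent

section Silting

variable {A B : Type u} [Ring A] [Ring B] {σ : AntiIso A B}

theorem DPres.ic_of_min [IsArtinianRing A] {c : DPres σ} (h : IsIndec A c.coker)
    (h₀ : IsSuperfluous A (LinearMap.range c.d)) (h₁ : IsSuperfluous A (LinearMap.ker c.d)) :
    c.IC := by
  have := c.b₁.finite
  have := c.b₀.finite
  constructor
  · intro hb
    have := h.1
    exact not_subsingleton c.coker
      (Submodule.Quotient.subsingleton_iff.mpr (LinearMap.range_eq_top.mpr hb.2))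
  · intro f₁ f₀ hf
    have hle : LinearMap.range c.d ≤ (LinearMap.range c.d).comap f₀ := by
      rintro _ ⟨x, rfl⟩
      exact ⟨f₁ x, (hf x).symm⟩
    let g : Module.End A c.coker := Submodule.mapQ _ _ f₀ hle
    have hg (k : ℕ) (x : c.P₀) : (g ^ k) (Submodule.Quotient.mk x) =
        (Submodule.Quotient.mk ((f₀ ^ k) x) : c.coker) := by
      induction k with
      | zero => rfl
      | succ j ih =>
        rw [pow_succ', pow_succ']
        exact congrArg g ih
    have hf' (k : ℕ) (x : c.P₁) : (f₀ ^ k) (c.d x) = c.d ((f₁ ^ k) x) := by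
      induction k with
      | zero => rfl
      | succ j ih =>
        rw [pow_succ', pow_succ']
        exact (congrArg f₀ ih).trans (hf _)
    rcases nilpotent_or_bijective_of_isIndec h g with ⟨k, hk⟩ | hb
    · left
      have hn₀ : IsNilpotent f₀ := isNilpotent_of_range_le h₀ f₀ k <| by
        rintro _ ⟨x, rfl⟩
        rw [← Submodule.Quotient.mk_eq_zero, ← hg, hk]
        rfl
      refine ⟨?_, hn₀⟩
      obtain ⟨j, hj⟩ := hn₀
      refine isNilpotent_of_range_le h₁ f₁ j ?_
      rintro _ ⟨x, rfl⟩
      rw [LinearMap.mem_ker, ← hf', hj]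
      rfl
    · right
      have hb₀ : Bijective f₀ := bijective_of_range_sup h₀ f₀ <| by
        rw [eq_top_iff]
        rintro x -
        obtain ⟨y, hy⟩ := hb.2 (Submodule.Quotient.mk x)
        obtain ⟨z, rfl⟩ := Submodule.mkQ_surjective _ y
        have hz : x - f₀ z ∈ LinearMap.range c.d := by
          rw [← Submodule.Quotient.eq]
          exact hy.symm
        exact Submodule.mem_sup.mpr ⟨_, hz, _, ⟨z, rfl⟩, sub_add_cancel _ _⟩
      refine ⟨bijective_of_range_sup h₁ f₁ ?_, hb₀⟩
      rw [eq_top_iff]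
      rintro x -
      obtain ⟨y, hy⟩ := hb₀.2 (c.d x)
      have hy' : y ∈ LinearMap.range c.d := by
        rw [← Submodule.Quotient.mk_eq_zero]
        refine hb.1 ?_
        refine Eq.trans ?_ (map_zero g).symm
        refine (congrArg Submodule.Quotient.mk hy).trans ?_
        exact (Submodule.Quotient.mk_eq_zero _).mpr ⟨x, rfl⟩
      obtain ⟨z, rfl⟩ := hy'
      have hz : x - f₁ z ∈ LinearMap.ker c.d := by
        rw [LinearMap.mem_ker, map_sub, ← hf, hy, sub_self]
      exact Submodule.mem_sup.mpr ⟨_, hz, _, ⟨z, rfl⟩, sub_add_cancel _ _⟩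

theorem DPres.ic_of_subsingleton [IsArtinianRing A] {c : DPres σ} [Subsingleton c.P₀]
    (h : IsIndec A c.P₁) : c.IC := by
  have := c.b₁.finite
  have h0 (f : Module.End A c.P₀) : f = 0 := LinearMap.ext fun x => Subsingleton.elim _ _
  constructor
  · intro hb
    have := h.1
    have := hb.1.subsingleton
    exact not_subsingleton c.P₁ this
  · intro f₁ f₀ _
    rcases nilpotent_or_bijective_of_isIndec h f₁ with hn | hb
    · exact Or.inl ⟨hn, 1, h0 _⟩
    · exact Or.inr ⟨hb, fun x y _ => Subsingleton.elim _ _, fun x => ⟨0, Subsingleton.elim _ _⟩⟩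

theorem DPres.IC.isIndec_P₁ [IsArtinianRing A] {c : DPres σ} (h : c.IC) [Subsingleton c.P₀] :
    IsIndec A c.P₁ := by
  have : Nontrivial c.P₁ := by
    by_contra hn
    have := not_nontrivial_iff_subsingleton.mp hn
    exact h.1 ⟨fun x y _ => Subsingleton.elim _ _, fun x => ⟨0, Subsingleton.elim _ _⟩⟩
  exact isIndec_of_end fun f => (h.2 f 1 fun x => Subsingleton.elim _ _).imp And.left And.left

theorem DPres.iso_of_P₁ {c c' : DPres σ} [Subsingleton c.P₀] [Subsingleton c'.P₀]
    (e : c.P₁ ≃ₗ[A] c'.P₁) : c.Iso c' :=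
  ⟨e, ⟨0, fun _ => 0, fun _ => Subsingleton.elim _ _, fun _ => Subsingleton.elim _ _⟩,
    fun _ => Subsingleton.elim _ _⟩

theorem DPres.IC.isIndec_coker [IsNoetherianRing A] {c : DPres σ} (h : c.IC)
    [Nontrivial c.coker] : IsIndec A c.coker :=
  isIndec_of_end h.nilpotent_or_bijective

/-- A family of pairwise nonisomorphic indecomposable complexes whose sum is presilting. -/
structure SF {ι : Type} (c : ι → DPres σ) : Prop where
  ic : ∀ i, (c i).IC
  inj : ∀ i j, (c i).Iso (c j) → i = j
  ext : ∀ i j (f : (c i).P₁ →ₗ[A] (c j).P₀), ∃ (a : (c i).P₀ →ₗ[A] (c j).P₀)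
    (b : (c i).P₁ →ₗ[A] (c j).P₁), f = a ∘ₗ (c i).d + (c j).d ∘ₗ b

theorem SF.swap {ι : Type} {c : ι → DPres σ} (h : SF c) : SF fun i => (c i).swap where
  ic i := (h.ic i).swap
  inj i j hij := (h.inj j i hij.swap).symm
  ext i j f := by
    obtain ⟨g, hg⟩ := exists_adj_left (c j).b₁ (c i).b₀ f
    obtain ⟨a, b, rfl⟩ := h.ext j i g
    obtain ⟨a', ha⟩ := (c j).b₀.exists_adj (c i).b₀ a
    obtain ⟨b', hb⟩ := (c j).b₁.exists_adj (c i).b₁ b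
    refine ⟨b', a', ?_⟩
    have hi : Adj (c i).b₁ (c i).b₀ (c i).d (c i).d' := (c i).adj
    have hj : Adj (c j).b₁ (c j).b₀ (c j).d (c j).d' := (c j).adj
    have := hg.right_unique ((Adj.comp hj ha).add (Adj.comp hb hi))
    exact this.trans (add_comm _ _)

theorem DPres.exists_decomp {c c' : DPres σ}
    (h : ∀ g : c.P₁ →ₗ[A] c'.coker, ∃ w : c.P₀ →ₗ[A] c'.coker, g = w ∘ₗ c.d)
    (f : c.P₁ →ₗ[A] c'.P₀) : ∃ (a : c.P₀ →ₗ[A] c'.P₀) (b : c.P₁ →ₗ[A] c'.P₁),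
      f = a ∘ₗ c.d + c'.d ∘ₗ b := by
  have := c.b₀.projective
  have := c.b₁.projective
  obtain ⟨w, hw⟩ := h ((LinearMap.range c'.d).mkQ ∘ₗ f)
  obtain ⟨a, rfl⟩ := Module.projective_lifting_property (LinearMap.range c'.d).mkQ w
    (Submodule.mkQ_surjective _)
  have hr (x) : f x - a (c.d x) ∈ LinearMap.range c'.d := by
    rw [← Submodule.Quotient.eq]
    exact LinearMap.congr_fun hw x
  obtain ⟨b, hb⟩ := Module.projective_lifting_property c'.d.rangeRestrict
    (LinearMap.codRestrict (LinearMap.range c'.d) (f - a ∘ₗ c.d) hr) c'.d.surjective_rangeRestrict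
  refine ⟨a, b, LinearMap.ext fun x => ?_⟩
  have hx : c'.d (b x) = f x - a (c.d x) := congrArg Subtype.val (LinearMap.congr_fun hb x)
  simp [hx]

theorem SF.extend {ι : Type} {c : ι → DPres σ} (h : SF c) (i : ι)
    (g : (c i).P₁ →ₗ[A] ∀ j, (c j).coker) :
    ∃ w : (c i).P₀ →ₗ[A] ∀ j, (c j).coker, g = w ∘ₗ (c i).d := by
  have := (c i).b₁.projective
  refine extend_pi (c i).d (fun j g => ?_) g
  obtain ⟨f, rfl⟩ := Module.projective_lifting_property (LinearMap.range (c j).d).mkQ g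
    (Submodule.mkQ_surjective _)
  obtain ⟨a, b, rfl⟩ := h.ext i j f
  refine ⟨Submodule.mkQ _ ∘ₗ a, LinearMap.ext fun x => ?_⟩
  have : (Submodule.Quotient.mk ((c j).d (b x)) : (c j).coker) = 0 :=
    (Submodule.Quotient.mk_eq_zero _).mpr ⟨_, rfl⟩
  simp [this]

theorem SF.eRigid {ι : Type} [Finite ι] {c : ι → DPres σ} (h : SF c) :
    ERigid A (∀ i, (c i).coker) := by
  intro N _ _ hN
  refine Ext1Vanishes.pi (fun i => ModuleCat.of A (c i).coker) fun i => ?_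
  have := (c i).b₀.projective
  have := (c i).b₁.projective
  exact ext1Vanishes_of_extend (c i).d (Submodule.mkQ _) (Submodule.mkQ_surjective _)
    (LinearMap.exact_map_mkQ_range _) (extend_of_facOf (c i).d (h.extend i) hN)

theorem SF.hom_eq_zero {ι : Type} {c : ι → DPres σ} (h : SF c) {i : ι} [Subsingleton (c i).coker]
    (g : (c i).P₁ →ₗ[A] ∀ j, (c j).coker) : g = 0 := by
  have := (h.ic i).subsingleton_P₀
  obtain ⟨w, rfl⟩ := h.extend i g
  ext x : 1
  rw [LinearMap.comp_apply, Subsingleton.elim ((c i).d x) 0, map_zero]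
  rfl

end Silting

section DropZero

variable {A : Type u} [Ring A]

theorem exists_pi_nontrivial {ι : Type} [Fintype ι] (X : ι → ModuleCat.{u} A) :
    ∃ (m : ℕ) (s : Fin m → ι), Injective s ∧ (∀ i, Nontrivial (X i) ↔ i ∈ Set.range s) ∧
      Nonempty ((∀ i, X i) ≃ₗ[A] ∀ k, X (s k)) := by
  classical
  let e := Fintype.equivFin {i // Nontrivial (X i)}
  let s : Fin (Fintype.card {i // Nontrivial (X i)}) → ι := fun k => (e.symm k).1
  have hs : Injective s := Subtype.val_injective.comp e.symm.injective
  have hr (i) : Nontrivial (X i) ↔ i ∈ Set.range s :=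
    ⟨fun h => ⟨e ⟨i, h⟩, by simp [s]⟩, fun ⟨k, hk⟩ => hk ▸ (e.symm k).2⟩
  refine ⟨_, s, hs, hr, ⟨LinearEquiv.ofBijective
    (LinearMap.pi fun k => LinearMap.proj (s k) : (∀ i, X i) →ₗ[A] ∀ k, X (s k)) ⟨?_, ?_⟩⟩⟩
  · intro x y hxy
    funext i
    by_cases hi : Nontrivial (X i)
    · obtain ⟨k, rfl⟩ := (hr i).mp hi
      exact congrFun hxy k
    · have := not_nontrivial_iff_subsingleton.mp hi
      exact Subsingleton.elim _ _
  · intro y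
    refine ⟨fun i => if h : ∃ k, s k = i then h.choose_spec ▸ y h.choose else 0, funext fun k => ?_⟩
    have h : ∃ k', s k' = s k := ⟨k, rfl⟩
    have key (k' : Fin _) (hk : s k' = s k) : (hk ▸ y k' : X (s k)) = y k := by
      obtain rfl := hs hk
      rfl
    simp only [LinearMap.pi_apply, LinearMap.proj_apply, dif_pos h]
    exact key _ _

end DropZero

section Count

variable {A B : Type u} [Ring A] [Ring B] {σ : AntiIso A B} {ι : Type}

/-- The sum of the cokernels of a family of complexes. -/
abbrev cokerSum (c : ι → DPres σ) : Type u := ∀ i, (c i).coker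

theorem cokerSum_finite [Finite ι] (c : ι → DPres σ) : Module.Finite A (cokerSum c) := by
  have := fun i => (c i).b₀.finite
  infer_instance

theorem SF.exists_index [IsArtinianRing A] {c : ι → DPres σ} (h : SF c) {n : ℕ}
    {P : Fin n → ModuleCat.{u} A} (hP : ProjFam P) :
    ∃ z : {j // Subsingleton (c j).coker} → Fin n, Injective z ∧
      ∀ j, Nonempty ((c j.1).P₁ ≃ₗ[A] P (z j)) ∧ z j ∉ supp P (cokerSum c) := by
  have h0 (j : {j // Subsingleton (c j).coker}) : Subsingleton (c j.1).P₀ :=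
    have := j.2
    (h.ic j.1).subsingleton_P₀
  choose z hz using fun j : {j // Subsingleton (c j).coker} =>
    hP.complete (c j.1).P₁ (c j.1).b₁.finite (c j.1).b₁.projective (h.ic j.1).isIndec_P₁
  refine ⟨z, fun i j hij => Subtype.ext (h.inj _ _ (DPres.iso_of_P₁ ?_)), fun j => ⟨hz j, ?_⟩⟩
  · exact (hz i).some.trans ((LinearEquiv.cast (R := A) (M := fun t => (P t : Type u)) hij).trans
      (hz j).some.symm)
  · rw [mem_supp]
    rintro ⟨f, hf⟩
    have := j.2
    refine hf (LinearMap.ext fun x => ?_)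
    have := LinearMap.congr_fun (h.hom_eq_zero (f ∘ₗ (hz j).some.toLinearMap)) ((hz j).some.symm x)
    simpa using this

theorem card_nontrivial [Fintype ι] (c : ι → DPres σ) {m : ℕ} {s : Fin m → ι} (hs : Injective s)
    (hr : ∀ i, Nontrivial (c i).coker ↔ i ∈ Set.range s) :
    Nat.card {j // Subsingleton (c j).coker} + m = Fintype.card ι := by
  classical
  have e1 : Nat.card {j // Nontrivial (c j).coker} = m := by
    have : Nat.card (Set.range s) = m := by
      rw [Nat.card_range_of_injective hs, Nat.card_fin]
    rw [← this]
    exact Nat.card_congr (Equiv.subtypeEquivRight hr)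
  have e2 : Nat.card {j // Subsingleton (c j).coker} =
      Nat.card {j // ¬ Nontrivial (c j).coker} :=
    Nat.card_congr (Equiv.subtypeEquivRight fun i => not_nontrivial_iff_subsingleton.symm)
  rw [e2, ← e1, ← Nat.card_eq_fintype_card, add_comm, ← Nat.card_sum]
  exact Nat.card_congr (Equiv.sumCompl _)

theorem SF.indecFam [IsArtinianRing A] {c : ι → DPres σ} (h : SF c) {m : ℕ} {s : Fin m → ι}
    (hs : Injective s) (hr : ∀ i, Nontrivial (c i).coker ↔ i ∈ Set.range s) :
    IndecFam fun k => ModuleCat.of A (c (s k)).coker := by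
  have := fun k => (hr (s k)).mpr ⟨k, rfl⟩
  exact ⟨fun k => (h.ic (s k)).isIndec_coker, fun i j ⟨e⟩ =>
    hs (h.inj _ _ ((h.ic (s i)).iso_of_coker (h.ic (s j)) e))⟩

theorem SF.cf [IsArtinianRing A] [Fintype ι] {c : ι → DPres σ} (h : SF c) {n : ℕ}
    {P : Fin n → ModuleCat.{u} A} (hP : ProjFam P) (hn : n ≤ Fintype.card ι) :
    CF A (cokerSum c) := by
  classical
  obtain ⟨m, s, hs, hr, he⟩ := exists_pi_nontrivial fun i => ModuleCat.of A (c i).coker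
  refine ⟨cokerSum_finite c, h.eRigid, m, n, _, P, h.indecFam hs hr, he, hP, ?_⟩
  obtain ⟨z, hz, hz'⟩ := h.exists_index hP
  have h1 := card_nontrivial c hs hr
  have h2 : Nat.card {j // Subsingleton (c j).coker} ≤ (supp P (cokerSum c))ᶜ.card := by
    rw [← Fintype.card_coe, ← Nat.card_eq_fintype_card]
    exact Nat.card_le_card_of_injective
      (fun j => (⟨z j, Finset.mem_compl.mpr (hz' j).2⟩ : {x // x ∈ (supp P (cokerSum c))ᶜ}))
      fun i j hij => hz (congrArg Subtype.val hij)
  rw [Finset.card_compl, Fintype.card_fin] at h2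
  have h3 : (supp P (cokerSum c)).card ≤ n := by
    simpa using Finset.card_le_univ (supp P (cokerSum c))
  omega

theorem SF.exists_iso (K : Type u) [Field K] [Algebra K A] [FiniteDimensional K A] {κ : Type}
    [Fintype κ] {c : ι → DPres σ} {c' : κ → DPres σ} (h : SF c) (h' : SF c') {n : ℕ}
    {P : Fin n → ModuleCat.{u} A} (hP : ProjFam P) (hn : n ≤ Fintype.card κ)
    (e : cokerSum c ≃ₗ[A] cokerSum c') (i : ι) : ∃ j, (c i).Iso (c' j) := by
  classical
  have := IsArtinianRing.of_finite K A
  have hfin := cokerSum_finite c'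
  have hb := (c i).b₀.finite
  obtain ⟨m, s, hs, hr, ⟨e'⟩⟩ := exists_pi_nontrivial fun i => ModuleCat.of A (c' i).coker
  have hI := h'.indecFam hs hr
  rcases subsingleton_or_nontrivial (c i).coker with hi | hi
  · have hP₀ := (h.ic i).subsingleton_P₀
    obtain ⟨z, hz, hz'⟩ := h'.exists_index hP
    obtain ⟨l, ⟨f⟩⟩ := hP.complete (c i).P₁ (c i).b₁.finite (c i).b₁.projective (h.ic i).isIndec_P₁
    have hl : l ∉ supp P (cokerSum c') := by
      rw [mem_supp]
      rintro ⟨g, hg⟩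
      refine hg (LinearMap.ext fun x => ?_)
      have := LinearMap.congr_fun (h.hom_eq_zero (i := i)
        (e.symm.toLinearMap ∘ₗ g ∘ₗ f.toLinearMap)) (f.symm x)
      simpa using this
    have h1 := card_nontrivial c' hs hr
    have h2 : m ≤ (supp P (cokerSum c')).card := by
      have := hP.card_le K (M := cokerSum c') hI fun k =>
        h'.eRigid.extProjIn.of_isDirectSummand
          (isDirectSummand_pi (fun i => ModuleCat.of A (c' i).coker) (LinearEquiv.refl A _) (s k))
      simpa using this
    let t : Finset (Fin n) := Finset.univ.image z
    have ht : t = (supp P (cokerSum c'))ᶜ := by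
      refine Finset.eq_of_subset_of_card_le (fun x hx => ?_) ?_
      · obtain ⟨j, -, rfl⟩ := Finset.mem_image.mp hx
        exact Finset.mem_compl.mpr (hz' j).2
      · rw [Finset.card_image_of_injective _ hz, Finset.card_univ, Finset.card_compl,
          Fintype.card_fin, ← Nat.card_eq_fintype_card]
        omega
    have hlt : l ∈ t := by
      rw [ht]
      exact Finset.mem_compl.mpr hl
    obtain ⟨j, -, rfl⟩ := Finset.mem_image.mp hlt
    have := j.2
    have := (h'.ic j.1).subsingleton_P₀
    exact ⟨j.1, DPres.iso_of_P₁ (f.trans (hz' j).1.some.symm)⟩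
  · have hd := (isDirectSummand_pi (fun i => ModuleCat.of A (c i).coker)
      (LinearEquiv.refl A (cokerSum c)) i).trans (isDirectSummand_of_equiv e)
    obtain ⟨k, ⟨f⟩⟩ := exists_equiv_of_isDirectSummand_pi (h.ic i).isIndec_coker _ hI.1 e' hd
    exact ⟨s k, (h.ic i).iso_of_coker (h'.ic _) f⟩

theorem SF.cokerSum_equiv [IsArtinianRing A] [Fintype ι] {κ : Type} [Fintype κ] {c : ι → DPres σ}
    {c' : κ → DPres σ} (h : SF c) (h' : SF c') (hi : ∀ i, ∃ j, (c i).Iso (c' j))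
    (hj : ∀ j, ∃ i, (c' j).Iso (c i)) : Nonempty (cokerSum c ≃ₗ[A] cokerSum c') := by
  have key {κ κ' : Type} {c : κ → DPres σ} {c' : κ' → DPres σ} {m : ℕ} {s : Fin m → κ} {m' : ℕ}
      {s' : Fin m' → κ'} (hr : ∀ i, Nontrivial (c i).coker ↔ i ∈ Set.range s)
      (hr' : ∀ i, Nontrivial (c' i).coker ↔ i ∈ Set.range s') (hi : ∀ i, ∃ j, (c i).Iso (c' j))
      (k : Fin m) : ∃ k', Nonempty ((c (s k)).coker ≃ₗ[A] (c' (s' k')).coker) := by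
    obtain ⟨j, hj⟩ := hi (s k)
    obtain ⟨e⟩ := hj.coker
    have := (hr (s k)).mpr ⟨k, rfl⟩
    obtain ⟨k', rfl⟩ := (hr' j).mp e.symm.toEquiv.nontrivial
    exact ⟨k', ⟨e⟩⟩
  obtain ⟨m, s, hs, hr, ⟨e⟩⟩ := exists_pi_nontrivial fun i => ModuleCat.of A (c i).coker
  obtain ⟨m', s', hs', hr', ⟨e'⟩⟩ := exists_pi_nontrivial fun i => ModuleCat.of A (c' i).coker
  obtain ⟨f⟩ := pi_equiv_of_forall (h.indecFam hs hr) (h'.indecFam hs' hr')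
    (key hr hr' hi) (key hr' hr hj)
  exact ⟨(e.trans f).trans e'.symm⟩

theorem CF.exists_sf (K : Type u) [Field K] [Algebra K A] [FiniteDimensional K A]
    (σ : AntiIso A B) {M : Type u} [AddCommGroup M] [Module A M] (h : CF A M) :
    ∃ (κ : Type) (_ : Fintype κ) (c : κ → DPres σ) (n : ℕ) (P : Fin n → ModuleCat.{u} A), SF c ∧
      ProjFam P ∧ Fintype.card κ = n ∧ Nonempty (M ≃ₗ[A] cokerSum c) := by
  classical
  have := IsArtinianRing.of_finite K A
  obtain ⟨hfin, hE, m, n, X, P, hX, ⟨e⟩, hP, hc⟩ := h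
  have hds := isDirectSummand_pi X e
  have hXfin (i) : Module.Finite A (X i) := finite_of_isDirectSummand (hds i)
  have hcard : m = (supp P M).card := by
    refine le_antisymm ?_ hc
    simpa using hP.card_le K (M := M) hX fun i => hE.extProjIn.of_isDirectSummand (hds i)
  have hex (i : Fin m) : ∃ c : DPres σ, Nonempty (c.coker ≃ₗ[A] X i) ∧ c.IC ∧
      IsSuperfluous A (LinearMap.ker c.d) := by
    obtain ⟨pr⟩ := exists_minPres (A := A) (X i)
    have := pr.fin₁; have := pr.fin₀; have := pr.proj₁; have := pr.proj₀
    obtain ⟨Q₁, Q₀, b₁, b₀, d', hadj⟩ := exists_dPres σ pr.d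
    let c : DPres σ := ⟨ModuleCat.of A pr.P₁, ModuleCat.of A pr.P₀, Q₁, Q₀, b₁, b₀, pr.d, d', hadj⟩
    have hr : LinearMap.range pr.d = LinearMap.ker pr.p := pr.exact.linearMap_ker_eq.symm
    let f : c.coker ≃ₗ[A] X i :=
      (Submodule.quotEquivOfEq _ _ hr).trans (pr.p.quotKerEquivOfSurjective pr.surj)
    refine ⟨c, ⟨f⟩, DPres.ic_of_min ((hX.1 i).of_equiv f.symm) ?_ pr.min₁, pr.min₁⟩
    exact (congrArg (IsSuperfluous A) hr).mpr pr.min₀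
  have hex' (l : {l // l ∉ supp P M}) : ∃ c : DPres σ, Subsingleton c.P₀ ∧
      Nonempty (c.P₁ ≃ₗ[A] P l.1) ∧ c.IC := by
    have := hP.finite l.1; have := hP.projective l.1
    obtain ⟨Q₁, Q₀, b₁, b₀, d', hadj⟩ := exists_dPres σ (0 : P l.1 →ₗ[A] PUnit.{u + 1})
    let c : DPres σ := ⟨P l.1, ModuleCat.of A PUnit.{u + 1}, Q₁, Q₀, b₁, b₀, 0, d', hadj⟩
    have hsub : Subsingleton c.P₀ := inferInstanceAs (Subsingleton PUnit.{u + 1})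
    exact ⟨c, hsub, ⟨LinearEquiv.refl A (P l.1)⟩, DPres.ic_of_subsingleton (hP.indec.1 l.1)⟩
  choose c hcX hcI hcS using hex
  choose c' hc0 hcP hcI' using hex'
  have hc0' (l) : Subsingleton (c' l).coker := inferInstance
  have hnt (i) : Nontrivial (c i).coker :=
    have := (hX.1 i).1
    (hcX i).some.toEquiv.nontrivial
  have hMc (i) (Y : DPres σ) (hY : FacOf A M Y.coker) (g : (c i).P₁ →ₗ[A] Y.coker) :
      ∃ w : (c i).P₀ →ₗ[A] Y.coker, g = w ∘ₗ (c i).d := by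
    have := (c i).b₀.projective
    have := Y.b₀.finite
    refine extend_of_ext1Vanishes (c i).d (Submodule.mkQ _) (Submodule.mkQ_surjective _)
      (LinearMap.exact_map_mkQ_range _) (hcS i) (fun L => ?_) g
    exact (hE _ (hY.of_surjective L.mkQ L.mkQ_surjective)).of_isDirectSummand
      ((isDirectSummand_of_equiv (hcX i).some).trans (hds i))
  have hF (i) : FacOf A M (c i).coker := (facOf_of_isDirectSummand (hds i)).of_surjective
    (hcX i).some.symm.toLinearMap (hcX i).some.symm.surjective
  have hzero (Y : DPres σ) (hY : Subsingleton Y.coker) : FacOf A M Y.coker :=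
    (facOf_self M).of_surjective 0 fun x => ⟨0, Subsingleton.elim _ _⟩
  let d : Fin m ⊕ {l // l ∉ supp P M} → DPres σ := Sum.elim c c'
  have hFd (i) : FacOf A M (d i).coker := by
    rcases i with i | l
    · exact hF i
    · exact hzero _ (hc0' l)
  have hSF : SF d := by
    refine ⟨fun i => ?_, fun i j hij => ?_, fun i j f => DPres.exists_decomp (fun g => ?_) f⟩
    · rcases i with i | l
      · exact hcI i
      · exact hcI' l
    · obtain ⟨f⟩ := hij.coker
      rcases i with i | l <;> rcases j with j | l'
      · exact congrArg Sum.inl (hX.2 i j ⟨((hcX i).some.symm.trans f).trans (hcX j).some⟩)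
      · have : Subsingleton (d (Sum.inr l')).coker := hc0' l'
        have h1 : Subsingleton (c i).coker := f.toEquiv.subsingleton
        exact (not_subsingleton _ h1).elim
      · have : Subsingleton (d (Sum.inr l)).coker := hc0' l
        have h1 : Subsingleton (c j).coker := f.symm.toEquiv.subsingleton
        exact (not_subsingleton _ h1).elim
      · obtain ⟨f₁, -⟩ := hij
        exact congrArg Sum.inr (Subtype.ext
          (hP.indec.2 _ _ ⟨((hcP l).some.symm.trans f₁).trans (hcP l').some⟩))
    · rcases i with i | l
      · exact hMc i _ (hFd j) g
      · refine ⟨0, ?_⟩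
        have := hP.projective l.1
        have h0 := hom_eq_zero_of_facOf (X := P l.1) (M := M) (fun f => by
          by_contra hf
          exact l.2 (mem_supp.mpr ⟨f, hf⟩)) (hFd j) (g ∘ₗ (hcP l).some.symm.toLinearMap)
        ext x : 1
        have := LinearMap.congr_fun h0 ((hcP l).some x)
        exact (congrArg g ((hcP l).some.symm_apply_apply x)).symm.trans this
  refine ⟨_, inferInstance, d, n, P, hSF, hP, ?_, ?_⟩
  · have h1 : (supp P M).card ≤ n := by simpa using Finset.card_le_univ (supp P M)
    have h2 : Fintype.card {l // l ∉ supp P M} = n - (supp P M).card := by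
      rw [Fintype.card_subtype_compl]
      simp
    rw [Fintype.card_sum, Fintype.card_fin, h2]
    omega
  · let e1 : cokerSum d ≃ₗ[A] (∀ i, X i) := LinearEquiv.ofBijective
      (LinearMap.pi fun i => (hcX i).some.toLinearMap ∘ₗ LinearMap.proj (Sum.inl i)) ⟨?_, ?_⟩
    · exact ⟨e.trans e1.symm⟩
    · intro x y hxy
      funext i
      rcases i with i | l
      · exact (hcX i).some.injective (congrFun hxy i)
      · exact Subsingleton.elim (h := hc0' l) _ _
    · intro y
      refine ⟨fun i => Sum.rec (fun i => (hcX i).some.symm (y i)) (fun l => 0) i, funext fun i => ?_⟩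
      exact (hcX i).some.apply_symm_apply (y i)

end Count

section Sum

variable {A B : Type u} [Ring A] [Ring B] {σ : AntiIso A B}

/-- The direct sum of perfect pairings. -/
def Perf.pi {ι : Type} [Fintype ι] {P Q : ι → Type u} [∀ i, AddCommGroup (P i)]
    [∀ i, Module A (P i)] [∀ i, AddCommGroup (Q i)] [∀ i, Module B (Q i)]
    (β : ∀ i, Perf σ (P i) (Q i)) : Perf σ (∀ i, P i) (∀ i, Q i) where
  b := AddMonoidHom.mk' (fun p => AddMonoidHom.mk' (fun q => ∑ i, (β i).b (p i) (q i))
    fun x y => by simp [Finset.sum_add_distrib]) fun x y => by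
      ext; simp [Finset.sum_add_distrib]
  smul_left a p q := by simp [(β _).smul_left, Finset.mul_sum]
  smul_right p b q := by simp [(β _).smul_right, Finset.sum_mul]
  exists_dual := by
    classical
    choose n p q hp hq using fun i => (β i).exists_dual
    let e := (Fintype.equivFin (Σ i, Fin (n i))).symm
    refine ⟨_, fun k => Pi.single (e k).1 (p _ (e k).2), fun k => Pi.single (e k).1 (q _ (e k).2),
      fun x => ?_, fun y => ?_⟩
    · have h1 (i : ι) (v : Q i) :
          ∑ j, (β j).b (x j) ((Pi.single i v : ∀ i, Q i) j) = (β i).b (x i) v := by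
        rw [Finset.sum_eq_single i (fun j _ hj => by simp [hj]) (by simp)]
        simp
      refine Eq.trans ?_ (Equiv.sum_comp e fun s =>
        (∑ j, (β j).b (x j) ((Pi.single s.1 (q _ s.2) : ∀ i, Q i) j)) •
          (Pi.single s.1 (p _ s.2) : ∀ i, P i)).symm
      simp only [h1, Fintype.sum_sigma]
      funext i
      rw [Finset.sum_apply, Finset.sum_eq_single i (fun j _ hj => by simp [hj.symm]) (by simp)]
      simpa using hp i (x i)
    · have h1 (i : ι) (v : P i) :
          ∑ j, (β j).b ((Pi.single i v : ∀ i, P i) j) (y j) = (β i).b v (y i) := by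
        rw [Finset.sum_eq_single i (fun j _ hj => by simp [hj]) (by simp)]
        simp
      refine Eq.trans ?_ (Equiv.sum_comp e fun s =>
        σ.e (∑ j, (β j).b ((Pi.single s.1 (p _ s.2) : ∀ i, P i) j) (y j)) •
          (Pi.single s.1 (q _ s.2) : ∀ i, Q i)).symm
      simp only [h1, Fintype.sum_sigma]
      funext i
      rw [Finset.sum_apply, Finset.sum_eq_single i (fun j _ hj => by simp [hj.symm]) (by simp)]
      simpa using hq i (y i)

theorem nonempty_coker_pi {ι : Type} [Finite ι] {P Q : ι → Type u} [∀ i, AddCommGroup (P i)]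
    [∀ i, Module A (P i)] [∀ i, AddCommGroup (Q i)] [∀ i, Module A (Q i)]
    (d : ∀ i, P i →ₗ[A] Q i) :
    Nonempty (((∀ i, Q i) ⧸ LinearMap.range (LinearMap.pi fun i => d i ∘ₗ LinearMap.proj i)) ≃ₗ[A]
      ∀ i, Q i ⧸ LinearMap.range (d i)) := by
  classical
  let f : (∀ i, Q i) →ₗ[A] ∀ i, Q i ⧸ LinearMap.range (d i) :=
    LinearMap.pi fun i => (LinearMap.range (d i)).mkQ ∘ₗ LinearMap.proj i
  have hf : Surjective f := fun y => by
    choose x hx using fun i => Submodule.mkQ_surjective _ (y i)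
    exact ⟨x, funext hx⟩
  have hk : LinearMap.range (LinearMap.pi fun i => d i ∘ₗ LinearMap.proj i) = LinearMap.ker f := by
    ext x
    rw [LinearMap.mem_ker]
    refine ⟨?_, fun h => ?_⟩
    · rintro ⟨y, rfl⟩
      exact funext fun i => (Submodule.Quotient.mk_eq_zero _).mpr ⟨y i, rfl⟩
    · choose y hy using fun i => (Submodule.Quotient.mk_eq_zero _).mp (congrFun h i)
      exact ⟨y, funext hy⟩
  exact ⟨(Submodule.quotEquivOfEq _ _ hk).trans (f.quotKerEquivOfSurjective hf)⟩

/-- The direct sum of a family of complexes. -/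
def DPres.pi {ι : Type} [Fintype ι] (c : ι → DPres σ) : DPres σ where
  P₁ := ModuleCat.of A (∀ i, (c i).P₁)
  P₀ := ModuleCat.of A (∀ i, (c i).P₀)
  Q₁ := ModuleCat.of B (∀ i, (c i).Q₁)
  Q₀ := ModuleCat.of B (∀ i, (c i).Q₀)
  b₁ := Perf.pi fun i => (c i).b₁
  b₀ := Perf.pi fun i => (c i).b₀
  d := LinearMap.pi fun i => (c i).d ∘ₗ LinearMap.proj i
  d' := LinearMap.pi fun i => (c i).d' ∘ₗ LinearMap.proj i
  adj p q := Finset.sum_congr rfl fun i _ => (c i).adj (p i) (q i)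

theorem isGP_cokerSum_iff [IsNoetherianRing A] [IsNoetherianRing B] {ι : Type} [Fintype ι]
    (c : ι → DPres σ) : IsGP A (cokerSum c) ↔ IsGP B (cokerSum fun i => (c i).swap) := by
  obtain ⟨e⟩ := nonempty_coker_pi fun i => (c i).d
  obtain ⟨e'⟩ := nonempty_coker_pi fun i => (c i).d'
  have h := (DPres.pi c).isGP_iff
  exact ⟨fun H => (h.mp (H.of_equiv e.symm)).of_equiv e',
    fun H => (h.mpr (H.of_equiv e'.symm)).of_equiv e⟩

theorem Perf.isIndec {P Q : Type u} [AddCommGroup P] [Module A P] [AddCommGroup Q] [Module B Q]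
    [IsArtinianRing A] (β : Perf σ P Q) (h : IsIndec A P) : IsIndec B Q := by
  have := β.finite
  have := h.1
  have : Nontrivial Q := by
    by_contra hn
    rw [not_nontrivial_iff_subsingleton] at hn
    obtain ⟨x, hx⟩ := exists_ne (0 : P)
    exact hx (β.eq_zero_left fun q => by rw [Subsingleton.elim q 0, map_zero])
  refine isIndec_of_end fun g => ?_
  obtain ⟨f, hf⟩ := exists_adj_left β β g
  exact (nilpotent_or_bijective_of_isIndec h f).imp hf.isNilpotent hf.bijective

/-- The duals of the indecomposable projectives are the indecomposable projectives. -/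
theorem ProjFam.dual [IsArtinianRing A] [IsArtinianRing B] (σ : AntiIso A B) {n : ℕ}
    {P : Fin n → ModuleCat.{u} A} (hP : ProjFam P) :
    ∃ Q : Fin n → ModuleCat.{u} B, ProjFam Q := by
  have := hP.finite
  have := hP.projective
  refine ⟨fun l => ModuleCat.of B (DualMod σ (P l)), ⟨fun l => ?_, fun i j ⟨e⟩ => ?_⟩, fun l => ?_,
    fun l => ?_, fun Q _ _ h1 h2 hQ => ?_⟩
  · exact (evalPerf σ (P l)).isIndec (hP.indec.1 l)
  · exact hP.indec.2 i j (Adj.exists_equiv_right (evalPerf σ (P i)).symm (evalPerf σ (P j)).symm e)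
  · exact (evalPerf σ (P l)).symm.finite
  · exact (evalPerf σ (P l)).symm.projective
  · have β := evalPerf σ.symm Q
    obtain ⟨l, ⟨e⟩⟩ := hP.complete _ β.symm.finite β.symm.projective (β.isIndec hQ)
    exact ⟨l, Adj.exists_equiv_right (σ := σ) β.symm (evalPerf σ (P l)) e⟩

/-- A module and a module over the opposite ring which are the cokernels of a complex and of its
dual. -/
def DualRel (σ : AntiIso A B) (M N : Type u) [AddCommGroup M] [Module A M] [AddCommGroup N]
    [Module B N] : Prop :=
  ∃ (κ : Type) (_ : Fintype κ) (c : κ → DPres σ) (n : ℕ) (P : Fin n → ModuleCat.{u} A), SF c ∧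
    ProjFam P ∧ Fintype.card κ = n ∧ Nonempty (M ≃ₗ[A] cokerSum c) ∧
      Nonempty (N ≃ₗ[B] cokerSum fun i => (c i).swap)

section Rel

variable {M N M' N' : Type u} [AddCommGroup M] [Module A M] [AddCommGroup N] [Module B N]
  [AddCommGroup M'] [Module A M'] [AddCommGroup N'] [Module B N']

theorem DualRel.symm [IsArtinianRing A] [IsArtinianRing B] (h : DualRel σ M N) :
    DualRel σ.symm N M := by
  obtain ⟨κ, _, c, n, P, h, hP, hn, h1, h2⟩ := h
  obtain ⟨Q, hQ⟩ := hP.dual σ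
  exact ⟨κ, _, fun i => (c i).swap, n, Q, h.swap, hQ, hn, h2, h1⟩

theorem CF.of_equiv (e : M ≃ₗ[A] M') (h : CF A M) : CF A M' := by
  obtain ⟨hf, hE, m, n, X, P, hX, ⟨f⟩, hP, hc⟩ := h
  refine ⟨Module.Finite.equiv e, fun Y _ _ hY => (hE Y (hY.of_equiv_left e.symm)).of_isDirectSummand
    (isDirectSummand_of_equiv e.symm), m, n, X, P, hX, ⟨e.symm.trans f⟩, hP, ?_⟩
  exact (Finset.card_le_card (supp_subset_of_facOf hP
    ((facOf_self M).of_surjective e.toLinearMap e.surjective))).trans hc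

theorem DualRel.equiv_right (K : Type u) [Field K] [Algebra K A] [FiniteDimensional K A]
    [IsArtinianRing B] (h : DualRel σ M N) (h' : DualRel σ M' N') (e : M ≃ₗ[A] M') :
    Nonempty (N ≃ₗ[B] N') := by
  have := IsArtinianRing.of_finite K A
  obtain ⟨κ, _, c, n, P, h, hP, hn, ⟨f⟩, ⟨g⟩⟩ := h
  obtain ⟨κ', _, c', n', P', h', hP', hn', ⟨f'⟩, ⟨g'⟩⟩ := h'
  let ε : cokerSum c ≃ₗ[A] cokerSum c' := f.symm.trans (e.trans f')
  obtain ⟨w⟩ := h.swap.cokerSum_equiv h'.swap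
    (fun i => (h.exists_iso K h' hP' hn'.ge ε i).imp fun j hj => hj.swap.symm)
    (fun i => (h'.exists_iso K h hP hn.ge ε.symm i).imp fun j hj => hj.swap.symm)
  exact ⟨g.trans (w.trans g'.symm)⟩

theorem DualRel.isGP_iff [IsNoetherianRing A] [IsNoetherianRing B] (h : DualRel σ M N) :
    IsGP A M ↔ IsGP B N := by
  obtain ⟨κ, _, c, n, P, h, hP, hn, ⟨f⟩, ⟨g⟩⟩ := h
  have h := isGP_cokerSum_iff c
  exact ⟨fun H => (h.mp (H.of_equiv f)).of_equiv g.symm,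
    fun H => (h.mpr (H.of_equiv g)).of_equiv f.symm⟩

theorem DualRel.cf_left [IsArtinianRing A] (h : DualRel σ M N) : CF A M := by
  obtain ⟨κ, _, c, n, P, h, hP, hn, ⟨f⟩, ⟨g⟩⟩ := h
  exact (h.cf hP hn.ge).of_equiv f.symm

theorem CF.exists_dualRel (K : Type u) [Field K] [Algebra K A] [FiniteDimensional K A]
    (σ : AntiIso A B) (h : CF A M) : ∃ N : ModuleCat.{u} B, DualRel σ M N := by
  obtain ⟨κ, i, c, n, P, h1, h2, h3, h4⟩ := h.exists_sf K σ
  exact ⟨ModuleCat.of B (cokerSum fun i => (c i).swap), κ, i, c, n, P, h1, h2, h3, h4,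
    ⟨LinearEquiv.refl B _⟩⟩

end Rel

end Sum

/-- A perfect `K`-valued pairing between an `A`-module and a `B`-module. -/
structure KPair (K : Type u) [Field K] {A B : Type u} [Ring A] [Algebra K A] [Ring B] [Algebra K B]
    (σ : AntiIso A B) (M N : Type u) [AddCommGroup M] [Module A M] [AddCommGroup N]
    [Module B N] where
  b : M →+ N →+ K
  adj : ∀ a m n, b (a • m) n = b m (σ.e a • n)
  smul_left : ∀ k m n, b (algebraMap K A k • m) n = k * b m n
  smul_right : ∀ k m n, b m (algebraMap K B k • n) = k * b m n
  exists_dual : ∃ (r : ℕ) (p : Fin r → M) (q : Fin r → N),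
    (∀ x, x = ∑ k, algebraMap K A (b x (q k)) • p k) ∧
      ∀ y, y = ∑ k, algebraMap K B (b (p k) y) • q k

section Pairing

variable {K : Type u} [Field K] {A B : Type u} [Ring A] [Algebra K A] [Ring B] [Algebra K B]
  {σ : AntiIso A B}
  {M N M' N' M'' N'' : Type u} [AddCommGroup M] [Module A M] [AddCommGroup N] [Module B N]
  [AddCommGroup M'] [Module A M'] [AddCommGroup N'] [Module B N']
  [AddCommGroup M''] [Module A M''] [AddCommGroup N''] [Module B N'']

/-- The flipped pairing. -/
def KPair.symm (β : KPair K σ M N) : KPair K σ.symm N M where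
  b := β.b.flip
  adj a n m := by
    change β.b m (a • n) = β.b (σ.e.symm a • m) n
    rw [β.adj, AddEquiv.apply_symm_apply]
  smul_left k n m := β.smul_right k m n
  smul_right k n m := β.smul_left k m n
  exists_dual := by
    obtain ⟨r, p, q, hp, hq⟩ := β.exists_dual
    exact ⟨r, q, p, hq, hp⟩

theorem KPair.eq_zero_right (β : KPair K σ M N) {n : N} (h : ∀ m, β.b m n = 0) : n = 0 := by
  obtain ⟨r, p, q, -, hq⟩ := β.exists_dual
  rw [hq n]
  simp [h]

theorem KPair.eq_right (β : KPair K σ M N) {q q' : N} (h : ∀ p, β.b p q = β.b p q') : q = q' :=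
  sub_eq_zero.mp (β.eq_zero_right fun p => by rw [map_sub, h, sub_self])

theorem KPair.finite (β : KPair K σ M N) : Module.Finite A M := by
  obtain ⟨r, p, q, hp, -⟩ := β.exists_dual
  exact Module.Finite.of_surjective (Fintype.linearCombination A p)
    fun x => ⟨fun k => algebraMap K A (β.b x (q k)), (hp x).symm⟩

/-- A pair of adjoint maps. -/
def KAdj (β : KPair K σ M N) (β' : KPair K σ M' N') (f : M →ₗ[A] M') (g : N' →ₗ[B] N) : Prop :=
  ∀ m n, β.b m (g n) = β'.b (f m) n

theorem KPair.exists_adj (β : KPair K σ M N) (β' : KPair K σ M' N') (f : M →ₗ[A] M') :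
    ∃ g, KAdj β β' f g := by
  obtain ⟨r, p, q, hp, hq⟩ := β.exists_dual
  have key (m n) : β.b m (∑ k, algebraMap K B (β'.b (f (p k)) n) • q k) = β'.b (f m) n := by
    conv_rhs => rw [hp m]
    simp [β.smul_right, β'.smul_left, mul_comm]
  refine ⟨{ toFun := fun n => ∑ k, algebraMap K B (β'.b (f (p k)) n) • q k,
            map_add' := fun x y => ?_, map_smul' := fun a x => ?_ }, key⟩
  · exact β.eq_right fun m => by rw [map_add, key, key, key, map_add]
  · refine β.eq_right fun m => ?_
    obtain ⟨a, rfl⟩ := σ.e.surjective a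
    rw [RingHom.id_apply, key, ← β.adj, key, f.map_smul, β'.adj]

variable {β : KPair K σ M N} {β' : KPair K σ M' N'} {β'' : KPair K σ M'' N''}

theorem KAdj.symm {f : M →ₗ[A] M'} {g : N' →ₗ[B] N} (h : KAdj β β' f g) :
    KAdj β'.symm β.symm g f := fun q p => (h p q).symm

variable (β β') in
theorem KPair.exists_adj_left (g : N' →ₗ[B] N) : ∃ f, KAdj β β' f g := by
  obtain ⟨f, h⟩ := β'.symm.exists_adj β.symm g
  exact ⟨f, fun m n => (h n m).symm⟩

theorem KAdj.comp {f : M →ₗ[A] M'} {g : N' →ₗ[B] N} {f' : M' →ₗ[A] M''} {g' : N'' →ₗ[B] N'}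
    (h : KAdj β β' f g) (h' : KAdj β' β'' f' g') : KAdj β β'' (f' ∘ₗ f) (g ∘ₗ g') :=
  fun m n => (h m (g' n)).trans (h' (f m) n)

theorem KAdj.right_unique {f : M →ₗ[A] M'} {g g' : N' →ₗ[B] N} (h : KAdj β β' f g)
    (h' : KAdj β β' f g') : g = g' :=
  LinearMap.ext fun n => β.eq_right fun m => (h m n).trans (h' m n).symm

theorem KAdj.left_unique {f f' : M →ₗ[A] M'} {g : N' →ₗ[B] N} (h : KAdj β β' f g)
    (h' : KAdj β β' f' g) : f = f' := h.symm.right_unique h'.symm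

variable (β) in
theorem KAdj.id : KAdj β β LinearMap.id LinearMap.id := fun _ _ => rfl

theorem KAdj.zero : KAdj β β' 0 0 := fun p q => by simp

theorem KAdj.pow {f : M →ₗ[A] M} {g : N →ₗ[B] N} (h : KAdj β β f g) (k : ℕ) :
    KAdj β β ((f : Module.End A M) ^ k) ((g : Module.End B N) ^ k) := by
  induction k with
  | zero => exact KAdj.id β
  | succ k ih =>
    rw [pow_succ', pow_succ]
    exact ih.comp h

theorem KAdj.isNilpotent {f : Module.End A M} {g : Module.End B N} (h : KAdj β β f g)
    (hf : IsNilpotent f) : IsNilpotent g := by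
  obtain ⟨k, hk⟩ := hf
  have := h.pow k
  rw [hk] at this
  exact ⟨k, this.right_unique KAdj.zero⟩

theorem KAdj.exists_equiv {f : M ≃ₗ[A] M'} {g : N' →ₗ[B] N} (h : KAdj β β' f.toLinearMap g) :
    ∃ e : N' ≃ₗ[B] N, e.toLinearMap = g := by
  obtain ⟨g', h'⟩ := β'.exists_adj β f.symm.toLinearMap
  have e1 : g ∘ₗ g' = LinearMap.id := by
    have := KAdj.comp h h'
    rw [LinearEquiv.symm_comp] at this
    exact this.right_unique (KAdj.id β)
  have e2 : g' ∘ₗ g = LinearMap.id := by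
    have := KAdj.comp h' h
    rw [LinearEquiv.comp_symm] at this
    exact this.right_unique (KAdj.id β')
  exact ⟨LinearEquiv.ofLinearMap g g' e1 e2, rfl⟩

theorem KAdj.bijective {f : M →ₗ[A] M'} {g : N' →ₗ[B] N} (h : KAdj β β' f g) (hf : Bijective f) :
    Bijective g := by
  obtain ⟨e, he⟩ := KAdj.exists_equiv (f := LinearEquiv.ofBijective f hf) h
  rw [← he]
  exact e.bijective

theorem KPair.exists_equiv_right (β : KPair K σ M N) (β' : KPair K σ M' N') (f : M ≃ₗ[A] M') :
    Nonempty (N ≃ₗ[B] N') := by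
  obtain ⟨g, h⟩ := β.exists_adj β' f.toLinearMap
  obtain ⟨e, -⟩ := KAdj.exists_equiv h
  exact ⟨e.symm⟩

theorem KPair.exists_separating (β : KPair K σ M N) (L : Submodule B N) {y : N} (hy : y ∉ L) :
    ∃ m, (∀ n ∈ L, β.b m n = 0) ∧ β.b m y ≠ 0 := by
  obtain ⟨r, p, q, hp, hq⟩ := β.exists_dual
  let _ : Module K N := Module.compHom N (algebraMap K B)
  have hs (k : K) (n : N) : k • n = algebraMap K B k • n := rfl
  let L' : Submodule K N :=
    { L with smul_mem' := fun k n hn => L.smul_mem (algebraMap K B k) hn }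
  obtain ⟨φ, hφ, hL⟩ := Submodule.exists_le_ker_of_notMem (p := L') (show y ∉ L' from hy)
  have key (n) : β.b (∑ k, algebraMap K A (φ (q k)) • p k) n = φ n := by
    conv_rhs => rw [hq n]
    simp [β.smul_left, ← hs, mul_comm]
  exact ⟨_, fun n hn => (key n).trans (hL hn), (key y).symm ▸ hφ⟩

theorem KAdj.exact {f : M →ₗ[A] M'} {g : N' →ₗ[B] N} {f' : M' →ₗ[A] M''} {g' : N'' →ₗ[B] N'}
    (h : KAdj β β' f g) (h' : KAdj β' β'' f' g') (hf : Exact f f') : Exact g' g := by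
  intro n
  refine ⟨fun hn => ?_, ?_⟩
  · by_contra hc
    obtain ⟨m, hm, hmn⟩ := β'.exists_separating (LinearMap.range g') hc
    have hm0 : f' m = 0 := β''.symm.eq_zero_right fun n =>
      (h' m n).symm.trans (hm _ ⟨n, rfl⟩)
    obtain ⟨x, rfl⟩ := (hf m).mp hm0
    exact hmn ((h x n).symm.trans (by rw [hn, map_zero]))
  · rintro ⟨y, rfl⟩
    refine β.eq_zero_right fun m => ?_
    rw [h, h', hf.apply_apply_eq_zero, map_zero, AddMonoidHom.zero_apply]

theorem KAdj.surjective {f : M →ₗ[A] M'} {g : N' →ₗ[B] N} (h : KAdj β β' f g) (hf : Injective f) :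
    Surjective g := by
  intro n
  by_contra hc
  obtain ⟨m, hm, hmn⟩ := β.exists_separating (LinearMap.range g) hc
  have hm0 : f m = 0 := β'.symm.eq_zero_right fun n => (h m n).symm.trans (hm _ ⟨n, rfl⟩)
  rw [map_eq_zero_iff f hf] at hm0
  exact hmn (by rw [hm0, map_zero, AddMonoidHom.zero_apply])

theorem KAdj.injective {f : M →ₗ[A] M'} {g : N' →ₗ[B] N} (h : KAdj β β' f g) (hf : Surjective f) :
    Injective g := by
  rw [injective_iff_map_eq_zero]
  refine fun n hn => β'.eq_zero_right fun m => ?_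
  obtain ⟨x, rfl⟩ := hf m
  rw [← h, hn, map_zero]

theorem KPair.isIndec [IsArtinianRing A] (β : KPair K σ M N) (h : IsIndec A M) : IsIndec B N := by
  have := β.finite
  have := h.1
  have : Nontrivial N := by
    by_contra hn
    rw [not_nontrivial_iff_subsingleton] at hn
    obtain ⟨x, hx⟩ := exists_ne (0 : M)
    exact hx (β.symm.eq_zero_right fun q => by rw [Subsingleton.elim q 0, map_zero]; rfl)
  refine isIndec_of_end fun g => ?_
  obtain ⟨f, hf⟩ := KPair.exists_adj_left β β g
  exact (nilpotent_or_bijective_of_isIndec h f).imp hf.isNilpotent hf.bijective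

/-- Transport of a pairing along an isomorphism. -/
def KPair.congrRight (β : KPair K σ M N) (e : N ≃ₗ[B] N') : KPair K σ M N' where
  b := AddMonoidHom.mk' (fun m => (β.b m).comp e.symm.toLinearMap.toAddMonoidHom)
    fun x y => by ext; simp
  adj a m n := by
    change β.b (a • m) (e.symm n) = β.b m (e.symm (σ.e a • n))
    rw [e.symm.map_smul, β.adj]
  smul_left k m n := β.smul_left k m (e.symm n)
  smul_right k m n := by
    change β.b m (e.symm (algebraMap K B k • n)) = k * β.b m (e.symm n)
    rw [e.symm.map_smul, β.smul_right]
  exists_dual := by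
    obtain ⟨r, p, q, hp, hq⟩ := β.exists_dual
    refine ⟨r, p, fun k => e (q k), fun x => ?_, fun y => ?_⟩
    · simpa using hp x
    · have := congrArg e (hq (e.symm y))
      simpa using this

/-- The pairing of direct sums. -/
def KPair.pi {ι : Type} [Fintype ι] {P Q : ι → Type u} [∀ i, AddCommGroup (P i)]
    [∀ i, Module A (P i)] [∀ i, AddCommGroup (Q i)] [∀ i, Module B (Q i)]
    (β : ∀ i, KPair K σ (P i) (Q i)) : KPair K σ (∀ i, P i) (∀ i, Q i) where
  b := AddMonoidHom.mk' (fun p => AddMonoidHom.mk' (fun q => ∑ i, (β i).b (p i) (q i))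
    fun x y => by simp [Finset.sum_add_distrib]) fun x y => by
      ext; simp [Finset.sum_add_distrib]
  adj a p q := Finset.sum_congr rfl fun i _ => (β i).adj a (p i) (q i)
  smul_left k p q := by simp [(β _).smul_left, Finset.mul_sum]
  smul_right k p q := by simp [(β _).smul_right, Finset.mul_sum]
  exists_dual := by
    classical
    choose n p q hp hq using fun i => (β i).exists_dual
    let e := (Fintype.equivFin (Σ i, Fin (n i))).symm
    refine ⟨_, fun k => Pi.single (e k).1 (p _ (e k).2), fun k => Pi.single (e k).1 (q _ (e k).2),
      fun x => ?_, fun y => ?_⟩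
    · have h1 (i : ι) (v : Q i) :
          ∑ j, (β j).b (x j) ((Pi.single i v : ∀ i, Q i) j) = (β i).b (x i) v := by
        rw [Finset.sum_eq_single i (fun j _ hj => by simp [hj]) (by simp)]
        simp
      refine Eq.trans ?_ (Equiv.sum_comp e fun s =>
        algebraMap K A (∑ j, (β j).b (x j) ((Pi.single s.1 (q _ s.2) : ∀ i, Q i) j)) •
          (Pi.single s.1 (p _ s.2) : ∀ i, P i)).symm
      simp only [h1, Fintype.sum_sigma]
      funext i
      rw [Finset.sum_apply, Finset.sum_eq_single i (fun j _ hj => by simp [hj.symm]) (by simp)]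
      simpa using hp i (x i)
    · have h1 (i : ι) (v : P i) :
          ∑ j, (β j).b ((Pi.single i v : ∀ i, P i) j) (y j) = (β i).b v (y i) := by
        rw [Finset.sum_eq_single i (fun j _ hj => by simp [hj]) (by simp)]
        simp
      refine Eq.trans ?_ (Equiv.sum_comp e fun s =>
        algebraMap K B (∑ j, (β j).b ((Pi.single s.1 (p _ s.2) : ∀ i, P i) j) (y j)) •
          (Pi.single s.1 (q _ s.2) : ∀ i, Q i)).symm
      simp only [h1, Fintype.sum_sigma]
      funext i
      rw [Finset.sum_apply, Finset.sum_eq_single i (fun j _ hj => by simp [hj.symm]) (by simp)]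
      simpa using hq i (y i)

end Pairing

section Step

/-- A short exact sequence with finitely generated injective middle term along which maps from
the dual of the regular module lift. -/
def InjStep (K R : Type u) [Field K] [Ring R] [Algebra K R] (Z Y : Type u) [AddCommGroup Z] [Module R Z] [AddCommGroup Y] [Module R Y] : Prop :=
  ∃ (I : ModuleCat.{u} R) (i : Z →ₗ[R] I) (p : I →ₗ[R] Y), Module.Finite R I ∧
    Module.Injective R I ∧ Injective i ∧ Surjective p ∧ Exact i p ∧
    ∀ g : OpDual R K R →ₗ[R] Y, ∃ h : OpDual R K R →ₗ[R] I, p ∘ₗ h = g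

variable {K R : Type u} [Field K] [Ring R] [Algebra K R]

theorem InjStep.finite_right {Z Y : Type u} [AddCommGroup Z] [Module R Z] [AddCommGroup Y]
    [Module R Y] (h : InjStep K R Z Y) : Module.Finite R Y := by
  obtain ⟨I, i, p, h1, h2, h3, h4, h5, h6⟩ := h
  exact Module.Finite.of_surjective p h4

theorem InjStep.of_equiv_left {Z Z' Y : Type u} [AddCommGroup Z] [Module R Z] [AddCommGroup Z']
    [Module R Z'] [AddCommGroup Y] [Module R Y] (e : Z ≃ₗ[R] Z') (h : InjStep K R Z Y) :
    InjStep K R Z' Y := by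
  obtain ⟨I, i, p, h1, h2, h3, h4, h5, h6⟩ := h
  refine ⟨I, i ∘ₗ e.symm.toLinearMap, p, h1, h2, h3.comp e.symm.injective, h4, fun x => ?_, h6⟩
  rw [h5]
  exact ⟨fun ⟨y, hy⟩ => ⟨e y, by simpa using hy⟩, fun ⟨y, hy⟩ => ⟨e.symm y, hy⟩⟩

theorem InjStep.of_equiv_right {Z Y' Y : Type u} [AddCommGroup Z] [Module R Z] [AddCommGroup Y']
    [Module R Y'] [AddCommGroup Y] [Module R Y] (e : Y ≃ₗ[R] Y') (h : InjStep K R Z Y) :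
    InjStep K R Z Y' := by
  obtain ⟨I, i, p, h1, h2, h3, h4, h5, h6⟩ := h
  refine ⟨I, i, e.toLinearMap ∘ₗ p, h1, h2, h3, e.surjective.comp h4, fun x => ?_, fun g => ?_⟩
  · rw [← h5]
    simp
  · obtain ⟨t, ht⟩ := h6 (e.symm.toLinearMap ∘ₗ g)
    refine ⟨t, ?_⟩
    rw [LinearMap.comp_assoc, ht]
    ext x
    simp

theorem isGI_of_class (C : ModuleCat.{u} R → Prop) (h : ∀ X, C X → ∃ Y, C Y ∧ InjStep K R X Y)
    (h' : ∀ X, C X → ∃ Y, C Y ∧ InjStep K R Y X) (X : Type u) [AddCommGroup X] [Module R X]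
    (hX : C (ModuleCat.of R X)) : IsGI R K X := by
  obtain ⟨f, hf0, hf⟩ := exists_int_chain (α := {X // C X}) (fun X Y => InjStep K R X.1 Y.1)
    (fun X => by obtain ⟨Y, hY, hXY⟩ := h X.1 X.2; exact ⟨⟨Y, hY⟩, hXY⟩)
    (fun X => by obtain ⟨Y, hY, hXY⟩ := h' X.1 X.2; exact ⟨⟨Y, hY⟩, hXY⟩) ⟨_, hX⟩
  choose I i p h1 h2 h3 h4 h5 h6 using hf
  refine ⟨fun n => I n, inferInstance, inferInstance, fun n => i (n + 1) ∘ₗ p n, h1, h2,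
    fun n x => ?_, fun n g => ?_, ?_⟩
  · rw [LinearMap.comp_apply, map_eq_zero_iff _ (h3 _), h5]
    constructor
    · rintro ⟨y, rfl⟩
      obtain ⟨z, rfl⟩ := h4 _ y
      exact ⟨z, rfl⟩
    · rintro ⟨z, rfl⟩
      exact ⟨_, rfl⟩
  · constructor
    · intro hg
      have hg0 (x) : g x ∈ LinearMap.range (i (n + 1)) := by
        rw [LinearMap.mem_range]
        refine (h5 (n + 1) (g x)).mp (h3 _ ?_)
        rw [map_zero]
        exact LinearMap.congr_fun hg x
      obtain ⟨w, hw⟩ := h6 n ((LinearEquiv.ofInjective (i (n + 1)) (h3 _)).symm.toLinearMap ∘ₗ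
        LinearMap.codRestrict _ g hg0)
      refine ⟨w, LinearMap.ext fun x => ?_⟩
      change i (n + 1) (p n (w x)) = g x
      have hx : p n (w x) = (LinearEquiv.ofInjective (i (n + 1)) (h3 _)).symm ⟨g x, hg0 x⟩ :=
        LinearMap.congr_fun hw x
      rw [hx]
      exact congrArg Subtype.val
        ((LinearEquiv.ofInjective (i (n + 1)) (h3 _)).apply_symm_apply ⟨g x, hg0 x⟩)
    · rintro ⟨w, rfl⟩
      refine LinearMap.ext fun x => ?_
      change i _ (p _ (i _ (p _ (w x)))) = 0
      rw [(h5 (n + 1)).apply_apply_eq_zero, map_zero]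
  · have e0 : Nonempty (X ≃ₗ[R] (f 0).1) := by
      rw [hf0]
      exact ⟨LinearEquiv.refl R X⟩
    have hr : LinearMap.range (i (-1 + 1) ∘ₗ p (-1)) = LinearMap.range (i (-1 + 1)) :=
      LinearMap.range_comp_of_range_eq_top _ (LinearMap.range_eq_top.mpr (h4 _))
    exact ⟨e0.some.trans ((LinearEquiv.ofInjective (i (-1 + 1)) (h3 _)).trans
      (LinearEquiv.ofEq _ _ hr.symm))⟩

theorem IsGI.exists_class {X : Type u} [AddCommGroup X] [Module R X] (h : IsGI R K X) :
    ∃ C : ModuleCat.{u} R → Prop, (∀ X, C X → ∃ Y, C Y ∧ InjStep K R X Y) ∧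
      (∀ X, C X → ∃ Y, C Y ∧ InjStep K R Y X) ∧ C (ModuleCat.of R X) := by
  obtain ⟨P, _, _, d, h1, h2, h3, h4, ⟨e⟩⟩ := h
  let I (n : ℤ) : ModuleCat.{u} R := ModuleCat.of R (LinearMap.range (d (n + 1)))
  have hs (n : ℤ) : InjStep K R (I n) (I (n + 1)) := by
    refine ⟨ModuleCat.of R (P (n + 1 + 1)), (LinearMap.range (d (n + 1))).subtype,
      (d (n + 1 + 1)).rangeRestrict, h1 _, h2 _, Submodule.subtype_injective _,
      LinearMap.surjective_rangeRestrict _, fun x => ?_, fun g => ?_⟩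
    · rw [← LinearMap.mem_ker, LinearMap.ker_rangeRestrict, LinearMap.mem_ker, h3 (n + 1)]
      exact ⟨fun hx => ⟨⟨x, hx⟩, rfl⟩, fun ⟨y, hy⟩ => hy ▸ y.2⟩
    · obtain ⟨w, hw⟩ := (h4 (n + 1 + 1) ((LinearMap.range (d (n + 1 + 1))).subtype ∘ₗ g)).mp
        (LinearMap.ext fun x => by
          obtain ⟨y, hy⟩ := (g x).2
          change d _ (g x).1 = 0
          rw [← hy]
          exact (h3 (n + 1 + 1)).apply_apply_eq_zero y)
      exact ⟨w, LinearMap.ext fun x => Subtype.ext (LinearMap.congr_fun hw x)⟩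
  refine ⟨fun Y => ∃ n, Nonempty (I n ≃ₗ[R] Y), ?_, ?_, ?_⟩
  · rintro X ⟨n, ⟨f⟩⟩
    exact ⟨I (n + 1), ⟨_, ⟨LinearEquiv.refl R _⟩⟩, (hs n).of_equiv_left f⟩
  · rintro X ⟨n, ⟨f⟩⟩
    obtain ⟨m, rfl⟩ : ∃ m, n = m + 1 := ⟨n - 1, by ring⟩
    exact ⟨I m, ⟨_, ⟨LinearEquiv.refl R _⟩⟩, (hs m).of_equiv_right f⟩
  · have hk (k : ℤ) (f : X ≃ₗ[R] LinearMap.range (d k)) : ∃ n, Nonempty (I n ≃ₗ[R] X) := by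
      obtain ⟨m, rfl⟩ : ∃ m, k = m + 1 := ⟨k - 1, by ring⟩
      exact ⟨m, ⟨f.symm⟩⟩
    exact hk _ e

theorem SyzStep.finite_right {B : Type u} [Ring B] {Z Y : Type u}
    [AddCommGroup Z] [Module B Z] [AddCommGroup Y] [Module B Y] (h : SyzStep B Z Y) :
    Module.Finite B Y := by
  obtain ⟨I, i, p, h1, h2, h3, h4, h5, h6⟩ := h
  exact Module.Finite.of_surjective p h4

end Step

section Dual

variable (K : Type u) [Field K] (R : Type u) [Ring R] [Algebra K R]

/-- The evaluation pairing of a module with its `K`-dual. -/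
def ldualPair (N : Type u) [AddCommGroup N] [Module R N] [Module K N] [IsScalarTower K R N]
    [FiniteDimensional K N] : KPair K (AntiIso.op R) N (LDual R K N) where
  b := AddMonoidHom.mk' (fun n => AddMonoidHom.mk' (fun ξ => LDual.toL R K N ξ n)
    fun _ _ => rfl) fun x y => by ext ξ; exact map_add (LDual.toL R K N ξ) x y
  adj _ _ _ := rfl
  smul_left k n ξ := by
    change LDual.toL R K N ξ (algebraMap K R k • n) = k * LDual.toL R K N ξ n
    rw [algebraMap_smul, map_smul, smul_eq_mul]
  smul_right k n ξ := by
    change LDual.toL R K N ξ (algebraMap K R k • n) = k * LDual.toL R K N ξ n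
    rw [algebraMap_smul, map_smul, smul_eq_mul]
  exists_dual := by
    let c := Module.finBasis K N
    let q (k : Fin (Module.finrank K N)) : LDual R K N := c.coord k
    refine ⟨_, c, q, fun x => ?_, fun ξ => ?_⟩
    · simp only [algebraMap_smul]
      exact (c.sum_repr x).symm
    · simp only [algebraMap_smul]
      have h (f : N →ₗ[K] K) : f = ∑ k, f (c k) • c.coord k := by
        refine c.ext fun j => ?_
        simp
      exact h (LDual.toL R K N ξ)

/-- The evaluation pairing of the `K`-dual of a right module with the module. -/
def opDualPair (Y : Type u) [AddCommGroup Y] [Module Rᵐᵒᵖ Y] [Module K Y]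
    [IsScalarTower K Rᵐᵒᵖ Y] [FiniteDimensional K Y] :
    KPair K (AntiIso.op R) (OpDual R K Y) Y where
  b := AddMonoidHom.mk' (fun ξ => (OpDual.toL R K Y ξ).toAddMonoidHom) fun _ _ => rfl
  adj _ _ _ := rfl
  smul_left k ξ n := by
    change OpDual.toL R K Y ξ (algebraMap K Rᵐᵒᵖ k • n) = k * OpDual.toL R K Y ξ n
    rw [algebraMap_smul, map_smul, smul_eq_mul]
  smul_right k ξ n := by
    change OpDual.toL R K Y ξ (algebraMap K Rᵐᵒᵖ k • n) = k * OpDual.toL R K Y ξ n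
    rw [algebraMap_smul, map_smul, smul_eq_mul]
  exists_dual := by
    let c := Module.finBasis K Y
    let q (k : Fin (Module.finrank K Y)) : OpDual R K Y := c.coord k
    refine ⟨_, q, c, fun ξ => ?_, fun x => ?_⟩
    · simp only [algebraMap_smul]
      have h (f : Y →ₗ[K] K) : f = ∑ k, f (c k) • c.coord k := by
        refine c.ext fun j => ?_
        simp
      exact h (OpDual.toL R K Y ξ)
    · simp only [algebraMap_smul]
      exact (c.sum_repr x).symm

variable [FiniteDimensional K R]

theorem exists_kpair_right (X : Type u) [AddCommGroup X] [Module R X] [Module.Finite R X] :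
    ∃ Y : ModuleCat.{u} Rᵐᵒᵖ, Nonempty (KPair K (AntiIso.op R) X Y) := by
  let _ := restrictedModule R K X
  have := restrictedModule_tower (A := R) K X
  have : FiniteDimensional K X := Module.Finite.trans R X
  exact ⟨ModuleCat.of Rᵐᵒᵖ (LDual R K X), ⟨ldualPair K R X⟩⟩

theorem exists_kpair_left (Y : Type u) [AddCommGroup Y] [Module Rᵐᵒᵖ Y]
    [Module.Finite Rᵐᵒᵖ Y] :
    ∃ X : ModuleCat.{u} R, Nonempty (KPair K (AntiIso.op R) X Y) := by
  let _ := restrictedModule Rᵐᵒᵖ K Y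
  have := restrictedModule_tower (A := Rᵐᵒᵖ) K Y
  have : FiniteDimensional K Y := Module.Finite.trans Rᵐᵒᵖ Y
  exact ⟨ModuleCat.of R (OpDual R K Y), ⟨opDualPair K R Y⟩⟩

/-- The pairing of the dual of the regular module with the regular right module. -/
def regPair : KPair K (AntiIso.op R) (OpDual R K R) Rᵐᵒᵖ :=
  (opDualPair K R R).congrRight
    { opAddEquiv with
      map_smul' := fun _ _ => rfl }

variable {K R}
variable {X Y X' Y' : Type u} [AddCommGroup X] [Module R X] [AddCommGroup Y] [Module Rᵐᵒᵖ Y]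
  [AddCommGroup X'] [Module R X'] [AddCommGroup Y'] [Module Rᵐᵒᵖ Y']

theorem KPair.projective_of_injective (β : KPair K (AntiIso.op R) X Y) (h : Module.Injective R X) :
    Module.Projective Rᵐᵒᵖ Y := by
  have := β.symm.finite
  obtain ⟨n, π, hπ⟩ := Module.Finite.exists_fin' Rᵐᵒᵖ Y
  obtain ⟨Z, ⟨γ⟩⟩ := exists_kpair_left K R (Fin n → Rᵐᵒᵖ)
  obtain ⟨f, hf⟩ := KPair.exists_adj_left β γ π
  obtain ⟨t, ht⟩ := Module.Injective.out f (hf.symm.injective hπ) LinearMap.id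
  obtain ⟨s, hs⟩ := γ.exists_adj β t
  refine Module.Projective.of_split s π ?_
  have h1 := hf.comp hs
  rw [show t ∘ₗ f = LinearMap.id from LinearMap.ext ht] at h1
  exact h1.right_unique (KAdj.id β)

theorem KPair.injective_of_projective (β : KPair K (AntiIso.op R) X Y)
    (h : Module.Projective Rᵐᵒᵖ Y) : Module.Injective R X := by
  have := IsArtinianRing.of_finite K R
  refine Module.Baer.injective fun J g => ?_
  obtain ⟨Z, ⟨γ⟩⟩ := exists_kpair_right K R R
  obtain ⟨W, ⟨δ⟩⟩ := exists_kpair_right K R J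
  obtain ⟨ι', hι⟩ := δ.exists_adj γ (Submodule.subtype J)
  obtain ⟨g', hg⟩ := δ.exists_adj β g
  obtain ⟨l, hl⟩ := Module.projective_lifting_property ι' g'
    (hι.surjective (Submodule.subtype_injective J))
  obtain ⟨t, ht⟩ := KPair.exists_adj_left γ β l
  have h1 := hι.comp ht
  rw [hl] at h1
  exact ⟨t, fun x hx => LinearMap.congr_fun (h1.left_unique hg) ⟨x, hx⟩⟩

theorem InjStep.syzStep (β : KPair K (AntiIso.op R) X Y) (β' : KPair K (AntiIso.op R) X' Y')
    (h : InjStep K R X X') : SyzStep Rᵐᵒᵖ Y' Y := by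
  obtain ⟨I, i, p, h1, h2, h3, h4, h5, h6⟩ := h
  obtain ⟨P, ⟨γ⟩⟩ := exists_kpair_right K R I
  obtain ⟨i', hi⟩ := β.exists_adj γ i
  obtain ⟨p', hp⟩ := γ.exists_adj β' p
  refine ⟨P, p', i', γ.symm.finite, γ.projective_of_injective h2, hp.injective h4,
    hi.surjective h3, hi.exact hp h5, fun g => ?_⟩
  obtain ⟨g', hg⟩ := KPair.exists_adj_left (regPair K R) β' g
  obtain ⟨t, rfl⟩ := h6 g'
  obtain ⟨t', ht⟩ := (regPair K R).exists_adj γ t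
  exact ⟨t', (ht.comp hp).right_unique hg⟩

theorem SyzStep.injStep (β : KPair K (AntiIso.op R) X Y) (β' : KPair K (AntiIso.op R) X' Y')
    (h : SyzStep Rᵐᵒᵖ Y' Y) : InjStep K R X X' := by
  obtain ⟨P, p, i, h1, h2, h3, h4, h5, h6⟩ := h
  obtain ⟨I, ⟨γ⟩⟩ := exists_kpair_left K R P
  obtain ⟨i', hi⟩ := KPair.exists_adj_left β γ i
  obtain ⟨p', hp⟩ := KPair.exists_adj_left γ β' p
  refine ⟨I, i', p', γ.finite, γ.injective_of_projective h2, hi.symm.injective h4,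
    hp.symm.surjective h3, hp.symm.exact hi.symm h5, fun g => ?_⟩
  obtain ⟨g', hg⟩ := (regPair K R).exists_adj β' g
  obtain ⟨t, rfl⟩ := h6 g'
  obtain ⟨t', ht⟩ := KPair.exists_adj_left (regPair K R) γ t
  exact ⟨t', (ht.comp hp).left_unique hg⟩

theorem InjStep.finite_left {Z Y : Type u} [AddCommGroup Z] [Module R Z] [AddCommGroup Y]
    [Module R Y] (h : InjStep K R Z Y) : Module.Finite R Z := by
  have := IsArtinianRing.of_finite K R
  obtain ⟨I, i, p, h1, h2, h3, h4, h5, h6⟩ := h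
  exact Module.Finite.of_injective i h3

theorem SyzStep.finite_left {B : Type u} [Ring B] [IsNoetherianRing B] {Z Y : Type u}
    [AddCommGroup Z] [Module B Z] [AddCommGroup Y] [Module B Y] (h : SyzStep B Z Y) :
    Module.Finite B Z := by
  obtain ⟨I, i, p, h1, h2, h3, h4, h5, h6⟩ := h
  exact Module.Finite.of_injective i h3

theorem KPair.isGI_iff (β : KPair K (AntiIso.op R) X Y) : IsGI R K X ↔ IsGP Rᵐᵒᵖ Y := by
  constructor
  · intro h
    obtain ⟨C, h1, h2, h3⟩ := h.exists_class
    refine isGP_of_class (fun Y => ∃ X, C X ∧ Nonempty (KPair K (AntiIso.op R) X Y))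
      ?_ ?_ Y ⟨_, h3, ⟨β⟩⟩
    · rintro Y ⟨X, hX, ⟨γ⟩⟩
      obtain ⟨X', hX', hs⟩ := h2 X hX
      have := hs.finite_left
      obtain ⟨Y', ⟨γ'⟩⟩ := exists_kpair_right K R X'
      exact ⟨Y', ⟨X', hX', ⟨γ'⟩⟩, hs.syzStep γ' γ⟩
    · rintro Y ⟨X, hX, ⟨γ⟩⟩
      obtain ⟨X', hX', hs⟩ := h1 X hX
      have := hs.finite_right
      obtain ⟨Y', ⟨γ'⟩⟩ := exists_kpair_right K R X'
      exact ⟨Y', ⟨X', hX', ⟨γ'⟩⟩, hs.syzStep γ γ'⟩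
  · intro h
    have := IsArtinianRing.of_finite K Rᵐᵒᵖ
    obtain ⟨C, -, h1, h2, h3⟩ := h.exists_class
    refine isGI_of_class (fun X => ∃ Y, C Y ∧ Nonempty (KPair K (AntiIso.op R) X Y))
      ?_ ?_ X ⟨_, h3, ⟨β⟩⟩
    · rintro X ⟨Y, hY, ⟨γ⟩⟩
      obtain ⟨Y', hY', hs⟩ := h2 Y hY
      have := hs.finite_left
      obtain ⟨X', ⟨γ'⟩⟩ := exists_kpair_left K R Y'
      exact ⟨X', ⟨Y', hY', ⟨γ'⟩⟩, hs.injStep γ γ'⟩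
    · rintro X ⟨Y, hY, ⟨γ⟩⟩
      obtain ⟨Y', hY', hs⟩ := h1 Y hY
      have := hs.finite_right
      obtain ⟨X', ⟨γ'⟩⟩ := exists_kpair_left K R Y'
      exact ⟨X', ⟨Y', hY', ⟨γ'⟩⟩, hs.injStep γ' γ⟩

end Dual

section Transfer

variable {K : Type u} [Field K] {A B : Type u} [Ring A] [Algebra K A] [Ring B] [Algebra K B]
  {σ : AntiIso A B} {M N : Type u} [AddCommGroup M] [Module A M] [AddCommGroup N] [Module B N]

theorem IndecFam.exists_kpair [IsArtinianRing A]
    (hσ : ∀ X : ModuleCat.{u} A, Module.Finite A X →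
      ∃ Y : ModuleCat.{u} B, Nonempty (KPair K σ X Y))
    {n : ℕ} {X : Fin n → ModuleCat.{u} A} (hX : IndecFam X) (hf : ∀ i, Module.Finite A (X i)) :
    ∃ Y : Fin n → ModuleCat.{u} B, IndecFam Y ∧ ∀ i, Nonempty (KPair K σ (X i) (Y i)) := by
  choose Y hY using fun i => hσ (X i) (hf i)
  refine ⟨Y, ⟨fun i => (hY i).some.isIndec (hX.1 i), fun i j ⟨e⟩ => hX.2 i j ?_⟩, hY⟩
  exact (hY i).some.symm.exists_equiv_right (hY j).some.symm e

theorem KPair.isBasic [IsArtinianRing A]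
    (hσ : ∀ X : ModuleCat.{u} A, Module.Finite A X →
      ∃ Y : ModuleCat.{u} B, Nonempty (KPair K σ X Y))
    (β : KPair K σ M N) (h : IsBasic A M) : IsBasic B N := by
  rw [isBasic_iff] at h ⊢
  obtain ⟨n, X, hX, ⟨e⟩⟩ := h
  have := β.finite
  have hf (i : Fin n) : Module.Finite A (X i) :=
    Module.Finite.of_surjective
      ((LinearMap.proj i : (∀ j, X j) →ₗ[A] X i) ∘ₗ e.toLinearMap)
      ((Function.surjective_eval i).comp e.surjective)
  obtain ⟨Y, hY, γ⟩ := hX.exists_kpair hσ hf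
  exact ⟨n, Y, hY, β.exists_equiv_right (KPair.pi fun i => (γ i).some) e⟩

theorem KPair.numIndec [IsArtinianRing A]
    (hσ : ∀ X : ModuleCat.{u} A, Module.Finite A X →
      ∃ Y : ModuleCat.{u} B, Nonempty (KPair K σ X Y))
    (β : KPair K σ M N) {k : ℕ} (h : NumIndec A M k) : NumIndec B N k := by
  rw [numIndec_iff] at h ⊢
  obtain ⟨X, hX, n, c, hc, ⟨e⟩⟩ := h
  have := β.finite
  have hf (i : Fin k) : Module.Finite A (X i) := by
    obtain ⟨j, rfl⟩ := hc i
    exact Module.Finite.of_surjective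
      ((LinearMap.proj j : (∀ j, X (c j)) →ₗ[A] X (c j)) ∘ₗ e.toLinearMap)
      ((Function.surjective_eval j).comp e.surjective)
  obtain ⟨Y, hY, γ⟩ := hX.exists_kpair hσ hf
  exact ⟨Y, hY, n, c, hc, β.exists_equiv_right (KPair.pi fun j => (γ (c j)).some) e⟩

end Transfer

theorem numIndec_self_iff {A B : Type u} [Ring A] [Ring B] [IsArtinianRing A] [IsArtinianRing B]
    (σ : AntiIso A B) (l : ℕ) : NumIndec A A l ↔ NumIndec B B l := by
  obtain ⟨n, P, hP⟩ := exists_projFam (A := A)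
  obtain ⟨Q, hQ⟩ := hP.dual σ
  have h1 := hP.numIndec
  have h2 := hQ.numIndec
  constructor
  · intro h
    rwa [h.unique h1]
  · intro h
    rwa [h.unique h2]

section TauInv

variable {K : Type u} [Field K] {S : Type u} [Ring S] [Algebra K S]
  {N : Type u} [AddCommGroup N] [Module S N] [Module K N] [IsScalarTower K S N]

theorem isTauInvRigid_iff [FiniteDimensional K N] :
    IsTauInvRigid S K N ↔ IsTauRigid Sᵐᵒᵖ K (LDual S K N) := by
  refine forall_congr' fun pr => ⟨fun h f => ?_, fun h f hf => ?_⟩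
  · let c (x : pr.Tr) : Module.Dual K (Module.Dual K N) :=
      { toFun := fun ξ => OpDual.toL Sᵐᵒᵖ K pr.Tr (f ξ) x
        map_add' := fun ξ η =>
          congrArg (fun g => OpDual.toL Sᵐᵒᵖ K pr.Tr g x)
            (f.map_add (ξ : LDual S K N) (η : LDual S K N))
        map_smul' := fun k ξ => by
          have h1 : f (k • (ξ : LDual S K N)) = k • f ξ := LinearMap.map_smul_of_tower f k ξ
          exact (congrArg (fun g => OpDual.toL Sᵐᵒᵖ K pr.Tr g x) h1) }
    let g (x : pr.Tr) : N := (Module.evalEquiv K N).symm (c x)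
    have hg (ξ : LDual S K N) (x : pr.Tr) :
        LDual.toL S K N ξ (g x) = OpDual.toL Sᵐᵒᵖ K pr.Tr (f ξ) x :=
      Module.apply_evalEquiv_symm_apply (R := K) (M := N) ξ (c x)
    have hext {n n' : N} (h : ∀ ξ : LDual S K N, LDual.toL S K N ξ n = LDual.toL S K N ξ n') :
        n = n' := (Module.evalEquiv K N).injective (LinearMap.ext h)
    have h0 := h (AddMonoidHom.mk' g fun x y => hext fun ξ => by
      rw [map_add, hg, hg, hg, map_add]) fun r x => hext fun ξ => by
        change LDual.toL S K N ξ (g _) = LDual.toL S K N (op r • ξ) (g x)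
        rw [hg, hg, f.map_smul]
        rfl
    refine LinearMap.ext fun ξ => OpDual.toL_injective _ _ _ (LinearMap.ext fun x => ?_)
    rw [← hg, show g x = 0 from DFunLike.congr_fun h0 x, map_zero]
    rfl
  · have hK (k : K) (x : pr.Tr) : f (k • x) = k • f x := by
      rw [← algebraMap_smul S k (f x), ← hf, ← algebraMap_smul Sᵐᵒᵖᵐᵒᵖ k x]
      rfl
    have h0 := h
      { toFun := fun ξ => (LDual.toL S K N ξ ∘ₗ
          ({ f with map_smul' := hK } : pr.Tr →ₗ[K] N) : pr.Tr →ₗ[K] K)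
        map_add' := fun ξ η => rfl
        map_smul' := fun s ξ => by
          refine OpDual.toL_injective _ _ _ (LinearMap.ext fun x => ?_)
          change LDual.toL S K N ξ (unop s • f x) = LDual.toL S K N ξ (f (op s • x))
          rw [← hf]
          rfl }
    refine AddMonoidHom.ext fun x => (Module.forall_dual_apply_eq_zero_iff K _).mp fun ξ => ?_
    exact LinearMap.congr_fun (congrArg (OpDual.toL Sᵐᵒᵖ K pr.Tr) (LinearMap.congr_fun h0 ξ)) x

variable (K S) in
theorem exists_kpair_symm [FiniteDimensional K S] (X : ModuleCat.{u} Sᵐᵒᵖ)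
    (hX : Module.Finite Sᵐᵒᵖ X) :
    ∃ Y : ModuleCat.{u} S, Nonempty (KPair K (AntiIso.op S).symm X Y) := by
  obtain ⟨Y, ⟨β⟩⟩ := exists_kpair_left K S X
  exact ⟨Y, ⟨β.symm⟩⟩

theorem isBasic_ldual_iff [FiniteDimensional K S] [FiniteDimensional K N] :
    IsBasic S N ↔ IsBasic Sᵐᵒᵖ (LDual S K N) := by
  have := IsArtinianRing.of_finite K S
  have := IsArtinianRing.of_finite K Sᵐᵒᵖ
  exact ⟨(ldualPair K S N).isBasic fun X _ => exists_kpair_right K S X,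
    (ldualPair K S N).symm.isBasic (exists_kpair_symm K S)⟩

theorem isTauInvTilting_iff [FiniteDimensional K S] [FiniteDimensional K N] :
    IsTauInvTilting S K N ↔ IsTauTilting Sᵐᵒᵖ K (LDual S K N) := by
  have := IsArtinianRing.of_finite K S
  have := IsArtinianRing.of_finite K Sᵐᵒᵖ
  have h (m) : NumIndec S N m ↔ NumIndec Sᵐᵒᵖ (LDual S K N) m :=
    ⟨(ldualPair K S N).numIndec fun X _ => exists_kpair_right K S X,
      (ldualPair K S N).symm.numIndec (exists_kpair_symm K S)⟩
  simp only [IsTauInvTilting, IsTauTilting, isTauInvRigid_iff, h,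
    numIndec_self_iff (AntiIso.op S)]

end TauInv

section Support

variable {K : Type u} [Field K] {R : Type u} [Ring R] [Algebra K R]
  {N : Type u} [AddCommGroup N] [Module R N] [Module K N] [IsScalarTower K R N]

theorem IsQuotientByIdem.op {e : R} {S : Type u} [Ring S] {φ : R →+* S}
    (h : IsQuotientByIdem R e S φ) : IsQuotientByIdem Rᵐᵒᵖ (op e) Sᵐᵒᵖ (RingHom.op φ) := by
  obtain ⟨h1, h2, h3⟩ := h
  refine ⟨fun s => ?_, congrArg MulOpposite.op h2, fun S' _ ψ hψ => ?_⟩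
  · obtain ⟨r, hr⟩ := h1 (unop s)
    exact ⟨MulOpposite.op r, congrArg MulOpposite.op hr⟩
  · obtain ⟨χ, hχ⟩ := h3 S'ᵐᵒᵖ inferInstance
      { toFun := fun r => MulOpposite.op (ψ (MulOpposite.op r))
        map_one' := by simp
        map_mul' := by simp
        map_zero' := by simp
        map_add' := by simp } (congrArg MulOpposite.op hψ)
    refine ⟨{ toFun := fun s => unop (χ (unop s))
              map_one' := by simp
              map_mul' := by simp
              map_zero' := by simp
              map_add' := by simp }, RingHom.ext fun r => ?_⟩
    exact congrArg unop (RingHom.congr_fun hχ (unop r))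

variable [FiniteDimensional K R]

theorem isSuppTauInvTilting_iff [FiniteDimensional K N] :
    IsBasic R N ∧ IsSuppTauInvTilting R K N ↔ CF Rᵐᵒᵖ (LDual R K N) := by
  constructor
  · rintro ⟨hb, e, he, S, _, _, φ, hK, hq, _, hφ, _, ht⟩
    have := finiteDimensional_of_surjective K hq.1 hK
    have := (ldualPair K R N).symm.finite
    refine cf_of_isSuppTauTilting K (isBasic_ldual_iff.mp hb) ⟨op e, congrArg op he.eq, Sᵐᵒᵖ,
      inferInstance, inferInstance, RingHom.op φ, fun k => congrArg op (hK k), hq.op,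
      inferInstanceAs (Module Sᵐᵒᵖ (LDual S K N)), fun r ξ => ?_, isTauInvTilting_iff.mp ht⟩
    refine LDual.toL_injective R K N (LinearMap.ext fun x => ?_)
    exact congrArg (LDual.toL R K N ξ) (hφ (unop r) x)
  · intro h
    refine ⟨isBasic_ldual_iff.mpr h.isBasic, ?_⟩
    obtain ⟨a, ha, ha0, H⟩ := h.exists_idem K
    obtain ⟨S, _, _, φ, hK, hq⟩ := exists_quotient (A := R) K (unop a)
    have hN (n : N) : unop a • n = 0 := (Module.forall_dual_apply_eq_zero_iff K _).mp fun ξ =>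
      LinearMap.congr_fun (congrArg (LDual.toL R K N) (ha0 ξ)) n
    obtain ⟨_, hφ⟩ := hq.exists_module hN
    have := finiteDimensional_of_surjective K hq.1 hK
    have : IsScalarTower K S N := ⟨fun k s n => by
      obtain ⟨r, rfl⟩ := hq.1 s
      rw [Algebra.smul_def, ← hK, ← map_mul, hφ, hφ, mul_smul, algebraMap_smul]⟩
    refine ⟨unop a, congrArg unop ha.eq, S, _, _, φ, hK, hq, _, hφ, this,
      isTauInvTilting_iff.mpr ?_⟩
    refine H Sᵐᵒᵖ (RingHom.op φ) (fun k => congrArg op (hK k)) hq.op (LDual S K N)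
      (AddEquiv.refl (N →ₗ[K] K)) fun r ξ => ?_
    refine LDual.toL_injective S K N (LinearMap.ext fun x => ?_)
    exact congrArg (LDual.toL R K N ξ) (hφ (unop r) x).symm

theorem gisttMod_iff (N : KMod K R) :
    GISTTmod K R N ↔ CF Rᵐᵒᵖ (LDual R K N.M) ∧ IsGP Rᵐᵒᵖ (LDual R K N.M) := by
  have := N.fin
  have : FiniteDimensional K N.M := Module.Finite.trans R N.M
  rw [← isSuppTauInvTilting_iff, ← (ldualPair K R N.M).isGI_iff, and_assoc]
  exact and_congr_right fun _ => and_comm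

end Support

theorem nonempty_quotient_equiv {α β : Type*} (s : Setoid α) (t : Setoid β) (r : α → β → Prop)
    (h₁ : ∀ a, ∃ b, r a b) (h₂ : ∀ b, ∃ a, r a b)
    (h : ∀ a a' b b', r a b → r a' b' → (s a a' ↔ t b b')) :
    Nonempty (Quotient s ≃ Quotient t) := by
  choose f hf using h₁
  refine ⟨Equiv.ofBijective (Quotient.map f fun a a' haa => (h _ _ _ _ (hf a) (hf a')).mp haa)
    ⟨?_, ?_⟩⟩
  · rintro ⟨a⟩ ⟨a'⟩ haa
    exact Quotient.sound ((h _ _ _ _ (hf a) (hf a')).mpr (Quotient.exact haa))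
  · rintro ⟨b⟩
    obtain ⟨a, ha⟩ := h₂ b
    exact ⟨Quotient.mk s a, Quotient.sound ((h _ _ _ _ (hf a) ha).mp (s.refl a))⟩

theorem DualRel.of_equiv_right {A B : Type u} [Ring A] [Ring B] {σ : AntiIso A B}
    {M N N' : Type u} [AddCommGroup M] [Module A M] [AddCommGroup N] [Module B N]
    [AddCommGroup N'] [Module B N'] (e : N ≃ₗ[B] N') (h : DualRel σ M N) : DualRel σ M N' := by
  obtain ⟨κ, i, c, n, P, h1, h2, h3, h4, ⟨f⟩⟩ := h
  exact ⟨κ, i, c, n, P, h1, h2, h3, h4, ⟨e.symm.trans f⟩⟩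

section Final

variable (K R : Type u) [Field K] [Ring R] [Algebra K R] [FiniteDimensional K R]

theorem KMod.finiteDimensional (N : KMod K R) : FiniteDimensional K N.M := by
  have := N.fin
  exact Module.Finite.trans R N.M

theorem exists_ldual_equiv (Y : Type u) [AddCommGroup Y] [Module Rᵐᵒᵖ Y] [Module.Finite Rᵐᵒᵖ Y] :
    ∃ N : KMod K R, Nonempty (Y ≃ₗ[Rᵐᵒᵖ] LDual R K N.M) := by
  let _ := restrictedModule Rᵐᵒᵖ K Y
  have := restrictedModule_tower (A := Rᵐᵒᵖ) K Y
  have : FiniteDimensional K Y := Module.Finite.trans Rᵐᵒᵖ Y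
  let N : KMod K R := { M := OpDual R K Y, fin := (opDualPair K R Y).finite }
  have := N.finiteDimensional
  exact ⟨N, (opDualPair K R Y).exists_equiv_right (ldualPair K R N.M) (LinearEquiv.refl R _)⟩

theorem nonempty_equiv_iff_ldual (N N' : KMod K R) :
    Nonempty (N.M ≃ₗ[R] N'.M) ↔ Nonempty (LDual R K N.M ≃ₗ[Rᵐᵒᵖ] LDual R K N'.M) := by
  have := N.finiteDimensional
  have := N'.finiteDimensional
  exact ⟨fun ⟨e⟩ => (ldualPair K R N.M).exists_equiv_right (ldualPair K R N'.M) e,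
    fun ⟨e⟩ => (ldualPair K R N.M).symm.exists_equiv_right (ldualPair K R N'.M).symm e⟩

theorem nonempty_equiv_gisttMod :
    Nonempty (Quotient (modSetoid R (GPSTTmod K R)) ≃
      Quotient (kmodSetoid K R (GISTTmod K R))) := by
  have := IsArtinianRing.of_finite K R
  have := IsArtinianRing.of_finite K Rᵐᵒᵖ
  refine nonempty_quotient_equiv _ _
    (fun X N => DualRel (AntiIso.op R) X.1 (LDual R K N.1.M)) ?_ ?_ ?_
  · rintro ⟨X, hX⟩
    obtain ⟨hX, hG⟩ := (gpsttMod_iff K X).mp hX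
    obtain ⟨Y, hY⟩ := hX.exists_dualRel K (AntiIso.op R)
    have := hY.symm.cf_left.1
    obtain ⟨N, ⟨e⟩⟩ := exists_ldual_equiv K R Y
    have h := hY.of_equiv_right e
    exact ⟨⟨N, (gisttMod_iff N).mpr ⟨h.symm.cf_left, h.isGP_iff.mp hG⟩⟩, h⟩
  · rintro ⟨N, hN⟩
    obtain ⟨hC, hG⟩ := (gisttMod_iff N).mp hN
    obtain ⟨X, hX⟩ := hC.exists_dualRel K (AntiIso.op R).symm
    have h : DualRel (AntiIso.op R) X (LDual R K N.M) := hX.symm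
    exact ⟨⟨X, (gpsttMod_iff K X).mpr ⟨h.cf_left, h.isGP_iff.mpr hG⟩⟩, h⟩
  · rintro ⟨X, hX⟩ ⟨X', hX'⟩ ⟨N, hN⟩ ⟨N', hN'⟩ h h'
    refine Iff.trans ⟨fun ⟨e⟩ => h.equiv_right K h' e, fun ⟨e⟩ => ?_⟩
      (nonempty_equiv_iff_ldual K R N N').symm
    exact h.symm.equiv_right K h'.symm e

end Final

/-- `T ↦ Fac T` is a bijection between isomorphism classes of
basic Gorenstein projective support τ-tilting modules and functorially finite
Gorenstein torsion pairs; moreover both sets are in bijection with the set of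
isomorphism classes of basic Gorenstein injective support τ⁻¹-tilting
modules. -/
theorem gp_supp_tau_tilting_torsion_bijection (K R : Type u) [Field K] [Ring R]
    [Algebra K R] [FiniteDimensional K R] :
    (∃ e : Quotient (modSetoid R (GPSTTmod K R)) ≃
        {TF : (ModuleCat.{u} R → Prop) × (ModuleCat.{u} R → Prop) //
          IsGorensteinTP R TF.1 TF.2},
      ∀ x : {X : ModuleCat.{u} R // GPSTTmod K R X},
        (e (Quotient.mk _ x)).1.1 =
          fun Y : ModuleCat.{u} R => Module.Finite R Y ∧ FacOf R x.1 Y) ∧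
    Nonempty (Quotient (modSetoid R (GPSTTmod K R)) ≃
      Quotient (kmodSetoid K R (GISTTmod K R))) := by
  exact ⟨exists_equiv_gorensteinTP K, nonempty_equiv_gisttMod K R⟩

end GPTau
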